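/- Suppose ℓ < k. For every d ≥ 0, the set of matrices P(∂) in M_{ℓ,k}(d) for which the distributed system ℬ(P) is controllable contains a nonempty Zariski-open subset of M_{ℓ,k}(d); that is, there exists a nonzero polynomial F in N = ℓ·k·(n+d choose n) variables such that every ℓ×k matrix of degree at most d whose coefficient vector is not a zero of F defines a controllable system. -/

import Mathlib

noncomputable section

/-- The space of smooth (infinitely differentiable) functions `ℝⁿ → ℂ`,
as a `ℂ`-submodule of the space of all functions `ℝⁿ → ℂ`. -/
def Cinf (n : ℕ) : Submodule ℂ ((Fin n → ℝ) → ℂ) where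
  carrier := {f | ContDiff ℝ (⊤ : ℕ∞) f}
  add_mem' := fun {f g} hf hg => by
    simp only [Set.mem_setOf_eq] at *
    exact hf.add hg
  zero_mem' := by
    simp only [Set.mem_setOf_eq]
    exact contDiff_const
  smul_mem' := fun c f hf => by
    simp only [Set.mem_setOf_eq] at *
    exact hf.const_smul c

/-- The distributed system `ℬ(P)` defined by an `ℓ × k` matrix `M` of elements of
`A = ℂ[∂₁, …, ∂ₙ]`: the kernel `{f ∈ (C^∞)^k : M f = 0}` of the operator
`(C^∞)^k → (C^∞)^ℓ` given by `M`, where `A` acts on `C^∞` via a given module structure. -/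
def system {n ℓ k : ℕ} [Module (MvPolynomial (Fin n) ℂ) (Cinf n)]
    (M : Matrix (Fin ℓ) (Fin k) (MvPolynomial (Fin n) ℂ)) : Set (Fin k → Cinf n) :=
  {f | ∀ i : Fin ℓ, ∑ j, M i j • f j = 0}

/-- A behaviour `B ⊆ (C^∞)^k` is controllable if for any two subsets `U₁, U₂` of `ℝⁿ`
whose closures do not intersect, and any `f₁, f₂ ∈ B`, there is an `f ∈ B` agreeing with
`f₁` on a neighbourhood of `U₁` and with `f₂` on a neighbourhood of `U₂`. -/
def IsControllable {n k : ℕ} (B : Set (Fin k → Cinf n)) : Prop :=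
  ∀ U₁ U₂ : Set (Fin n → ℝ), closure U₁ ∩ closure U₂ = ∅ →
    ∀ f₁ ∈ B, ∀ f₂ ∈ B, ∃ f ∈ B, ∃ V₁ V₂ : Set (Fin n → ℝ),
      IsOpen V₁ ∧ IsOpen V₂ ∧ U₁ ⊆ V₁ ∧ U₂ ⊆ V₂ ∧
      (∀ x ∈ V₁, ∀ j, (f j : (Fin n → ℝ) → ℂ) x = (f₁ j : (Fin n → ℝ) → ℂ) x) ∧
      (∀ x ∈ V₂, ∀ j, (f j : (Fin n → ℝ) → ℂ) x = (f₂ j : (Fin n → ℝ) → ℂ) x)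

/-- The coefficient of the monomial `m` (of degree at most `d`) in the `(i, j)` entry of the
matrix `M`: the coordinates of `M ∈ M_{ℓ,k}(d)` under the identification of `M_{ℓ,k}(d)` with
the affine space `ℂ^N`, `N = ℓ·k·(n+d choose n)`. -/
def matrixCoeffs {n ℓ k d : ℕ} (M : Matrix (Fin ℓ) (Fin k) (MvPolynomial (Fin n) ℂ)) :
    Fin ℓ × Fin k × {m : Fin n →₀ ℕ // m.degree ≤ d} → ℂ :=
  fun v => MvPolynomial.coeff v.2.2.1 (M v.1 v.2.1)

set_option autoImplicit false
open MvPolynomial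

abbrev AA (n : ℕ) := MvPolynomial (Fin n) ℂ

class GoodMod (n : ℕ) [Module (AA n) (Cinf n)] : Prop where
  hX : ∀ (i : Fin n) (f : Cinf n),
      (((MvPolynomial.X i : MvPolynomial (Fin n) ℂ) • f : Cinf n) : (Fin n → ℝ) → ℂ) =
        fun x => fderiv ℝ (f : (Fin n → ℝ) → ℂ) x (Pi.single i 1)
  hC : ∀ (c : ℂ) (f : Cinf n),
      ((MvPolynomial.C c : MvPolynomial (Fin n) ℂ) • f : Cinf n) = c • f

section base
variable {n : ℕ}

/-- the linear functional with given partial derivatives -/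
def dlin (v : Fin n → ℂ) : (Fin n → ℝ) →L[ℝ] ℂ :=
  ∑ j, (ContinuousLinearMap.proj j : (Fin n → ℝ) →L[ℝ] ℝ).smulRight (v j)

theorem dlin_apply (v : Fin n → ℂ) (y : Fin n → ℝ) : dlin v y = ∑ j, (y j : ℂ) * v j := by
  simp [dlin]

theorem dlin_single (v : Fin n → ℂ) (i : Fin n) : dlin v (Pi.single i 1) = v i := by
  rw [dlin_apply, Finset.sum_eq_single i] <;> simp +contextual [Pi.single_apply]

theorem dlin_eq (L : (Fin n → ℝ) →L[ℝ] ℂ) : L = dlin fun i => L (Pi.single i 1) := by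
  apply ContinuousLinearMap.coe_injective
  apply LinearMap.pi_ext'
  intro i
  ext
  simp [dlin_single]

theorem Cinf.contDiff (f : Cinf n) : ContDiff ℝ (⊤ : ℕ∞) f.1 := f.2

theorem Cinf.differentiable (f : Cinf n) : Differentiable ℝ f.1 :=
  (Cinf.contDiff f).differentiable (by simp)

theorem Cinf.continuous (f : Cinf n) : Continuous f.1 := (Cinf.contDiff f).continuous

theorem Cinf.ext' {f g : Cinf n} (h : ∀ x, f.1 x = g.1 x) : f = g :=
  Subtype.ext (_root_.funext h)

@[simp] theorem Cinf.add_apply (f g : Cinf n) (x) : (f + g).1 x = f.1 x + g.1 x := rfl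
@[simp] theorem Cinf.sub_apply (f g : Cinf n) (x) : (f - g).1 x = f.1 x - g.1 x := rfl
@[simp] theorem Cinf.neg_apply (f : Cinf n) (x) : (-f).1 x = -f.1 x := rfl
@[simp] theorem Cinf.zero_apply (x) : (0 : Cinf n).1 x = 0 := rfl
@[simp] theorem Cinf.csmul_apply (c : ℂ) (f : Cinf n) (x) : (c • f).1 x = c * f.1 x := rfl
@[simp] theorem Cinf.sum_apply {ι : Type*} (s : Finset ι) (f : ι → Cinf n) (x) :
    (∑ i ∈ s, f i).1 x = ∑ i ∈ s, (f i).1 x := by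
  classical
  induction s using Finset.induction_on with
  | empty => simp
  | insert a s ha ih => rw [Finset.sum_insert ha, Finset.sum_insert ha, Cinf.add_apply, ih]

/-- pointwise product -/
def mulC (f g : Cinf n) : Cinf n := ⟨fun x => f.1 x * g.1 x, (Cinf.contDiff f).mul (Cinf.contDiff g)⟩


@[simp] theorem Cinf.mul_apply (f g : Cinf n) (x) : (mulC f g).1 x = f.1 x * g.1 x := rfl

/-- induction principle for the action -/
theorem act_induction {Q : AA n → Prop} (p : AA n) (h1 : Q 1)
    (hadd : ∀ p q, Q p → Q q → Q (p + q)) (hC : ∀ c p, Q p → Q (C c * p))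
    (hXm : ∀ i p, Q p → Q (X i * p)) : Q p := by
  induction p using MvPolynomial.induction_on with
  | C a => simpa using hC a 1 h1
  | add p q hp hq => exact hadd _ _ hp hq
  | mul_X p i hp => rw [mul_comm]; exact hXm _ _ hp

/-- Smooth families. -/
theorem smooth_family {ι : Type*} (v : ι → (Fin n → ℝ) → ℂ) (D : Fin n → ι → ι)
    (h : ∀ i x, HasFDerivAt (v i)
      (dlin fun j => v (D j i) x) x) (i : ι) : ContDiff ℝ (⊤ : ℕ∞) (v i) := by
  rw [contDiff_infty]
  intro m
  induction m generalizing i with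
  | zero =>
    simp only [Nat.cast_zero, contDiff_zero]
    exact continuous_iff_continuousAt.2 fun x => (h i x).continuousAt
  | succ m ih =>
    have := (contDiff_succ_iff_hasFDerivAt (𝕜 := ℝ) (n := m) (f := v i)).2
      ⟨_, ?_, h i⟩
    · exact_mod_cast this
    · refine ContDiff.sum fun j _ => ?_
      exact ContDiff.smulRight contDiff_const (ih _)

variable [Module (AA n) (Cinf n)] [GoodMod n]

theorem X_smul_apply (i : Fin n) (f : Cinf n) (x) :
    ((X i : AA n) • f).1 x = fderiv ℝ f.1 x (Pi.single i 1) := by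
  rw [GoodMod.hX]

@[simp] theorem C_smul (c : ℂ) (f : Cinf n) : (C c : AA n) • f = c • f := GoodMod.hC c f

theorem C_mul_smul (c : ℂ) (p : AA n) (f : Cinf n) : (C c * p : AA n) • f = c • (p • f) := by
  rw [mul_smul, C_smul]

theorem smul_csmul (c : ℂ) (p : AA n) (f : Cinf n) : p • (c • f) = c • (p • f) := by
  rw [← C_smul, ← C_smul, smul_smul, smul_smul, mul_comm]

theorem monomial_smul (m : Fin n →₀ ℕ) (c : ℂ) (f : Cinf n) :
    (monomial m c : AA n) • f = c • ((monomial m 1 : AA n) • f) := by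
  rw [← C_mul_smul, C_mul_monomial, mul_one]

theorem X_smul_congr_on {U : Set (Fin n → ℝ)} (hU : IsOpen U) {f g : Cinf n}
    (h : ∀ x ∈ U, f.1 x = g.1 x) (i : Fin n) :
    ∀ x ∈ U, ((X i : AA n) • f).1 x = ((X i : AA n) • g).1 x := by
  intro x hx
  rw [X_smul_apply, X_smul_apply]
  have : f.1 =ᶠ[nhds x] g.1 := Filter.eventually_of_mem (hU.mem_nhds hx) h
  rw [this.fderiv_eq]

theorem smul_congr_on {U : Set (Fin n → ℝ)} (hU : IsOpen U) {f g : Cinf n}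
    (h : ∀ x ∈ U, f.1 x = g.1 x) (p : AA n) :
    ∀ x ∈ U, (p • f).1 x = (p • g).1 x := by
  induction p using act_induction with
  | h1 => simpa using h
  | hadd p q hp hq => intro x hx; simp [add_smul, hp x hx, hq x hx]
  | hC c p hp => intro x hx; simp [mul_smul, hp x hx]
  | hXm i p hp => rw [mul_smul, mul_smul]; exact X_smul_congr_on hU hp i

theorem smul_zero_on {U : Set (Fin n → ℝ)} (hU : IsOpen U) {f : Cinf n}
    (h : ∀ x ∈ U, f.1 x = 0) (p : AA n) : ∀ x ∈ U, (p • f).1 x = 0 := by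
  intro x hx
  have := smul_congr_on hU (g := 0) (by simpa using h) p x hx
  simpa using this

theorem Cinf.hasFDerivAt (f : Cinf n) (x) :
    HasFDerivAt f.1 (dlin fun j => ((X j : AA n) • f).1 x) x := by
  have h := ((Cinf.differentiable f) x).hasFDerivAt
  rw [dlin_eq (fderiv ℝ f.1 x)] at h
  simpa only [X_smul_apply] using h

theorem X_smul_of_hasFDerivAt (f : Cinf n) (x) (v : Fin n → ℂ)
    (h : HasFDerivAt f.1 (dlin fun j => v j) x) (i : Fin n) : ((X i : AA n) • f).1 x = v i := by
  rw [X_smul_apply, h.fderiv, dlin_single]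

theorem family_cinf (v : AA n → (Fin n → ℝ) → ℂ)
    (hadd : ∀ p q x, v (p + q) x = v p x + v q x) (hC : ∀ c p x, v (C c * p) x = c * v p x)
    (h : ∀ p x, HasFDerivAt (v p)
      (dlin fun j => v (X j * p) x) x) : ∃ u : Cinf n, ∀ p x, (p • u).1 x = v p x := by
  have hs := smooth_family v (fun j p => X j * p) h
  refine ⟨⟨v 1, hs 1⟩, fun p => ?_⟩
  induction p using act_induction with
  | h1 => simp
  | hadd p q hp hq => intro x; simp [add_smul, hp, hq, hadd]
  | hC c p hp => intro x; simp [mul_smul, hp, hC]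
  | hXm i p hp =>
    intro x
    rw [mul_smul]
    apply X_smul_of_hasFDerivAt (p • _) x (fun j => v (X j * p) x)
    have : (p • (⟨v 1, hs 1⟩ : Cinf n)).1 = v p := _root_.funext hp
    rw [this]; exact h p x

theorem X_smul_mul (i : Fin n) (f g : Cinf n) :
    (X i : AA n) • (mulC f g) = mulC ((X i : AA n) • f) g + mulC f ((X i : AA n) • g) := by
  apply Cinf.ext'
  intro x
  have := ((Cinf.differentiable f) x).hasFDerivAt.mul ((Cinf.differentiable g) x).hasFDerivAt
  rw [X_smul_apply]
  have h2 : fderiv ℝ (mulC f g).1 x = _ := this.fderiv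
  rw [h2]
  simp [X_smul_apply]; ring

theorem smul_mul_of_supported {s : Set (Fin n)} {ψ : Cinf n} (hψ : ∀ j ∈ s, (X j : AA n) • ψ = 0)
    {p : AA n} (hp : p ∈ supported ℂ s) (f : Cinf n) : p • (mulC ψ f) = mulC ψ (p • f) := by
  rw [supported] at hp
  induction hp using Algebra.adjoin_induction generalizing f with
  | mem x hx =>
    obtain ⟨j, hj, rfl⟩ := hx
    rw [X_smul_mul, hψ j hj]
    apply Cinf.ext'; simp
  | algebraMap r =>
    apply Cinf.ext'; intro x
    rw [MvPolynomial.algebraMap_eq, C_smul, C_smul]; simp; ring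
  | add x y _ _ hx hy => apply Cinf.ext'; intro z; rw [add_smul, hx, hy, add_smul]; simp; ring
  | mul x y _ _ hx hy => rw [mul_smul, hy, hx, mul_smul]

end base

set_option autoImplicit false
open MvPolynomial Filter Topology

section lims
variable {n : ℕ}

theorem norm_dlin_le (v : Fin n → ℂ) : ‖dlin v‖ ≤ ∑ j, ‖v j‖ := by
  refine ContinuousLinearMap.opNorm_le_bound _ (by positivity) fun y => ?_
  rw [dlin_apply, Finset.sum_mul]
  refine (norm_sum_le _ _).trans (Finset.sum_le_sum fun j _ => ?_)
  rw [norm_mul, mul_comm]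
  gcongr
  simpa using norm_le_pi_norm y j

theorem dlin_sub (v w : Fin n → ℂ) : dlin (fun j => v j - w j) = dlin v - dlin w := by
  ext y
  simp [dlin_apply, mul_sub]

theorem ucs_of_geom {s : Set (Fin n → ℝ)} {F : ℕ → (Fin n → ℝ) → ℂ} {C : ℝ} {k0 : ℕ}
    (h : ∀ k ≥ k0, ∀ x ∈ s, ‖F (k+1) x - F k x‖ ≤ C * (1/2)^k) :
    UniformCauchySeqOn F atTop s := by
  have key : ∀ k ≥ k0, ∀ i, ∀ x ∈ s, ‖F (k+i) x - F k x‖ ≤ 2 * C * (1/2)^k - 2 * C * (1/2)^(k+i) := by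
    intro k hk i x hx
    induction i with
    | zero => simp
    | succ i ih =>
      have := h (k+i) (by omega) x hx
      have h2 : F (k+(i+1)) x - F k x = (F (k+i+1) x - F (k+i) x) + (F (k+i) x - F k x) := by
        rw [← add_assoc]; ring
      rw [h2]
      refine (norm_add_le _ _).trans ?_
      have e : (1/2:ℝ)^(k+(i+1)) = (1/2)^(k+i) * (1/2) := by rw [← add_assoc, pow_succ]
      rw [e]
      linarith
  by_cases hs : s.Nonempty
  swap
  · rw [Set.not_nonempty_iff_eq_empty] at hs
    subst hs
    intro u hu
    simp
  obtain ⟨x0, hx0⟩ := hs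
  have hC : 0 ≤ C := by
    have := (norm_nonneg _).trans (h k0 le_rfl x0 hx0)
    by_contra hc
    push Not at hc
    have : C * (1/2:ℝ)^k0 < 0 := mul_neg_of_neg_of_pos hc (by positivity)
    linarith
  rw [Metric.uniformCauchySeqOn_iff]
  intro ε hε
  have ht : Tendsto (fun k : ℕ => 4 * C * (1/2:ℝ)^k) atTop (𝓝 0) := by
    have := (tendsto_pow_atTop_nhds_zero_of_lt_one (r := (1/2:ℝ)) (by norm_num) (by norm_num)).const_mul (4*C)
    simpa using this
  obtain ⟨K, hK⟩ := ((ht.eventually (gt_mem_nhds hε)).and (eventually_ge_atTop k0)).exists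
  refine ⟨K, fun m hm k hk x hx => ?_⟩
  obtain ⟨i, rfl⟩ := Nat.exists_eq_add_of_le hm
  obtain ⟨j, rfl⟩ := Nat.exists_eq_add_of_le hk
  have h1 := key K hK.2 i x hx
  have h2 := key K hK.2 j x hx
  have p1 : 0 ≤ 2 * C * (1/2:ℝ)^(K+i) := by positivity
  have p2 : 0 ≤ 2 * C * (1/2:ℝ)^(K+j) := by positivity
  rw [dist_eq_norm]
  have : F (K+i) x - F (K+j) x = (F (K+i) x - F K x) - (F (K+j) x - F K x) := by ring
  rw [this]
  refine (norm_sub_le _ _).trans_lt ?_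
  linarith [hK.1]

variable [Module (AA n) (Cinf n)] [GoodMod n]

theorem cinf_limit (u : ℕ → Cinf n)
    (h : ∀ (p : AA n) (N : ℕ), UniformCauchySeqOn (fun k x => (p • u k).1 x) atTop
      (Metric.ball 0 (N : ℝ))) :
    ∃ w : Cinf n, ∀ (p : AA n) x, Tendsto (fun k => (p • u k).1 x) atTop (𝓝 ((p • w).1 x)) := by
  have hx : ∀ x : Fin n → ℝ, ∃ N : ℕ, x ∈ Metric.ball (0 : Fin n → ℝ) (N : ℝ) := by
    intro x
    obtain ⟨N, hN⟩ := exists_nat_gt ‖x‖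
    exact ⟨N, by simpa using hN⟩
  have hl : ∀ (p : AA n) x, ∃ l, Tendsto (fun k => (p • u k).1 x) atTop (𝓝 l) := by
    intro p x
    obtain ⟨N, hN⟩ := hx x
    exact cauchySeq_tendsto_of_complete ((h p N).cauchySeq hN)
  choose v hv using hl
  have hunif : ∀ (p : AA n) (N : ℕ), TendstoUniformlyOn (fun k x => (p • u k).1 x) (v p) atTop
      (Metric.ball 0 (N : ℝ)) := fun p N =>
    (h p N).tendstoUniformlyOn_of_tendsto fun x _ => hv p x
  have hfam : ∃ w : Cinf n, ∀ p x, (p • w).1 x = v p x := ?_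
  · obtain ⟨w, hw⟩ := hfam
    exact ⟨w, fun p x => by rw [hw]; exact hv p x⟩
  refine family_cinf v ?_ ?_ ?_
  · intro p q x
    refine tendsto_nhds_unique (hv (p+q) x) ?_
    simpa [add_smul] using (hv p x).add (hv q x)
  · intro c p x
    refine tendsto_nhds_unique (hv (C c * p) x) ?_
    simpa [C_mul_smul] using (hv p x).const_mul c
  · intro p x
    obtain ⟨N, hN⟩ := hx x
    refine hasFDerivAt_of_tendstoUniformlyOn (l := atTop) (s := Metric.ball 0 (N : ℝ)) Metric.isOpen_ball
      (f := fun k x => (p • u k).1 x)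
      (f' := fun k x => dlin fun j => ((X j * p) • u k).1 x) (g' := fun x => dlin fun j => v (X j * p) x)
      ?_ ?_ ?_ hN
    · rw [Metric.tendstoUniformlyOn_iff]
      intro ε hε
      have hall : ∀ᶠ k in atTop, ∀ j : Fin n, ∀ y ∈ Metric.ball (0 : Fin n → ℝ) (N:ℝ),
          dist (v (X j * p) y) (((X j * p) • u k).1 y) < ε / (n + 1) := by
        rw [eventually_all]
        intro j
        exact (Metric.tendstoUniformlyOn_iff.1 (hunif (X j * p) N)) _ (by positivity)
      filter_upwards [hall] with k hk y hy
      rw [dist_eq_norm, ← dlin_sub]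
      refine (norm_dlin_le _).trans_lt ?_
      calc _ ≤ ∑ j : Fin n, ε / (n + 1) := Finset.sum_le_sum fun j _ => by
              have := (hk j y hy).le; rwa [dist_eq_norm] at this
        _ = n * (ε / (n+1)) := by simp
        _ < ε := by
          rw [← mul_div_assoc, div_lt_iff₀ (by positivity)]; nlinarith
    · intro k y hy
      have := Cinf.hasFDerivAt (p • u k) y
      simpa only [mul_smul] using this
    · intro y hy; exact hv p y

theorem mittag_leffler {ι : Type*} (c : ι → AA n) (w : ι → Cinf n)
    (hloc : ∀ N : ℕ, ∃ y : Cinf n, ∀ i, ∀ x ∈ Metric.ball (0 : Fin n → ℝ) (N:ℝ), (c i • y).1 x = (w i).1 x)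
    (hdens : ∀ N : ℕ, ∃ N' : ℕ, ∀ y : Cinf n,
      (∀ i, ∀ x ∈ Metric.ball (0 : Fin n → ℝ) (N':ℝ), (c i • y).1 x = 0) →
      ∀ (Q : Finset (AA n)) (ε : ℝ), 0 < ε → ∃ y' : Cinf n, (∀ i, c i • y' = 0) ∧
        ∀ q ∈ Q, ∀ x ∈ Metric.ball (0 : Fin n → ℝ) (N:ℝ), ‖(q • y - q • y').1 x‖ ≤ ε) :
    ∃ y : Cinf n, ∀ i, c i • y = w i := by
  choose N' hN' using hdens
  obtain ⟨R, R1, R2⟩ : ∃ R : ℕ → ℕ, (∀ k, N' (R k) ≤ R (k+1)) ∧ (∀ k, R k + 1 ≤ R (k+1)) :=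
    ⟨fun k => Nat.rec (motive := fun _ => ℕ) 0 (fun _ r => max (N' r) (r + 1)) k,
      fun k => le_max_left _ _, fun k => le_max_right _ _⟩
  have R3 : ∀ k, k ≤ R k := by
    intro k
    induction k with
    | zero => simp
    | succ k ih => have := R2 k; omega
  obtain ⟨e, he⟩ := exists_surjective_nat (Fin n →₀ ℕ)
  classical
  let Q : ℕ → Finset (AA n) := fun k => (Finset.range (k+1)).image fun i => monomial (e i) 1
  let S : ℕ → Type := fun k => {z : Cinf n // ∀ i, ∀ x ∈ Metric.ball (0 : Fin n → ℝ) (R (k+1) : ℝ), (c i • z).1 x = (w i).1 x}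
  have step : ∀ (k : ℕ) (z : S k), ∃ z' : S (k+1), ∀ q ∈ Q k, ∀ x ∈ Metric.ball (0 : Fin n → ℝ) ((R k : ℕ) : ℝ),
      ‖(q • z'.1 - q • z.1).1 x‖ ≤ (1/2)^k := by
    intro k z
    obtain ⟨y, hy⟩ := hloc (R (k+2))
    obtain ⟨y', h1, h2⟩ := hN' (R k) (y - z.1) (by
      intro i x hx
      have hx' : x ∈ Metric.ball (0 : Fin n → ℝ) (R (k+1):ℝ) :=
        Metric.ball_subset_ball (by exact_mod_cast R1 k) hx
      have hx'' : x ∈ Metric.ball (0 : Fin n → ℝ) (R (k+2):ℝ) :=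
        Metric.ball_subset_ball (by have : R (k+1) + 1 ≤ R (k+2) := R2 (k+1); exact_mod_cast (by omega)) hx'
      rw [smul_sub, Cinf.sub_apply, hy i x hx'', z.2 i x hx', sub_self]) (Q k) ((1/2)^k) (by positivity)
    refine ⟨⟨y - y', ?_⟩, ?_⟩
    · intro i x hx
      rw [smul_sub, h1, sub_zero]
      exact hy i x hx
    · intro q hq x hx
      have := h2 q hq x hx
      convert this using 2
      simp only [smul_sub, Cinf.sub_apply]
      ring
  choose F hF using step
  obtain ⟨y0, hy0⟩ := hloc (R 1)
  let z : ∀ k, S k := fun k => Nat.rec ⟨y0, hy0⟩ (fun k zk => F k zk) k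
  have hz : ∀ k : ℕ, ∀ q ∈ Q k, ∀ x ∈ Metric.ball (0 : Fin n → ℝ) ((R k : ℕ) : ℝ),
      ‖(q • (z (k+1)).1 - q • (z k).1).1 x‖ ≤ (1/2)^k := fun k => hF k (z k)
  have hcauchy : ∀ (p : AA n) (N : ℕ), ∃ (C : ℝ) (k0 : ℕ), ∀ k ≥ k0, ∀ x ∈ Metric.ball (0 : Fin n → ℝ) (N:ℝ),
      ‖(p • (z (k+1)).1).1 x - (p • (z k).1).1 x‖ ≤ C * (1/2)^k := by
    intro p N
    induction p using MvPolynomial.induction_on' with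
    | monomial m a =>
      obtain ⟨i, rfl⟩ := he m
      refine ⟨‖a‖, max i N, fun k hk x hx => ?_⟩
      have := hz k (monomial (e i) 1) (Finset.mem_image.2 ⟨i, by simp; omega, rfl⟩) x
        (Metric.ball_subset_ball (by have := R3 k; exact_mod_cast (by omega)) hx)
      rw [monomial_smul, monomial_smul (c := a), Cinf.csmul_apply, Cinf.csmul_apply, ← mul_sub, norm_mul]
      gcongr
      exact this
    | add p q hp hq =>
      obtain ⟨C1, k1, h1⟩ := hp
      obtain ⟨C2, k2, h2⟩ := hq
      refine ⟨C1 + C2, max k1 k2, fun k hk x hx => ?_⟩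
      have a1 := h1 k (le_trans (le_max_left _ _) hk) x hx
      have a2 := h2 k (le_trans (le_max_right _ _) hk) x hx
      rw [add_smul, add_smul, Cinf.add_apply, Cinf.add_apply, add_mul, add_sub_add_comm]
      exact (norm_add_le _ _).trans (add_le_add a1 a2)
  obtain ⟨y, hy⟩ := cinf_limit (fun k => (z k).1) (fun p N => by
    obtain ⟨C, k0, h⟩ := hcauchy p N
    exact ucs_of_geom h)
  refine ⟨y, fun i => Cinf.ext' fun x => ?_⟩
  refine tendsto_nhds_unique (hy (c i) x) ?_
  obtain ⟨N, hN⟩ := exists_nat_gt ‖x‖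
  refine tendsto_const_nhds.congr' ?_
  filter_upwards [eventually_ge_atTop N] with k hk
  refine ((z k).2 i x ?_).symm
  rw [mem_ball_zero_iff]
  refine hN.trans_le ?_
  have := R3 (k+1)
  exact_mod_cast (by omega)
end lims

set_option autoImplicit false
open MvPolynomial Filter Topology

section crit
variable {n : ℕ}

theorem exists_cutoff {s t : Set (Fin n → ℝ)} (hs : IsClosed s) (ht : IsClosed t) (hd : Disjoint s t) :
    ∃ f : Cinf n, ∃ V W : Set (Fin n → ℝ), IsOpen V ∧ IsOpen W ∧ s ⊆ V ∧ t ⊆ W ∧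
      (∀ x ∈ V, f.1 x = 0) ∧ (∀ x ∈ W, f.1 x = 1) := by
  obtain ⟨f, h0, h1, -⟩ := exists_contMDiffMap_zero_one_nhds_of_isClosed (n := (⊤ : ℕ∞))
    (modelWithCornersSelf ℝ (Fin n → ℝ)) hs ht hd
  rw [eventually_nhdsSet_iff_exists] at h0 h1
  obtain ⟨V, hV, hsV, hV0⟩ := h0
  obtain ⟨W, hW, htW, hW1⟩ := h1
  have hf : ContDiff ℝ (⊤ : ℕ∞) f := f.contMDiff.contDiff
  refine ⟨⟨fun x => (f x : ℂ), Complex.ofRealCLM.contDiff.comp hf⟩, V, W, hV, hW, hsV, htW, ?_, ?_⟩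
  · intro x hx; simp [hV0 x hx]
  · intro x hx; simp [hW1 x hx]

/-- one-dimensional cutoff -/
def kap (N : ℕ) : ContDiffBump (0 : ℝ) := ⟨N + 1, N + 2, by positivity, by linarith⟩

def kapC (N : ℕ) (j : Fin n) : Cinf n :=
  ⟨fun x => ((kap N (x j) : ℝ) : ℂ), Complex.ofRealCLM.contDiff.comp
    ((kap N).contDiff.comp (contDiff_apply ℝ ℝ j))⟩

theorem kapC_one (N : ℕ) (j : Fin n) (x : Fin n → ℝ) (hx : |x j| ≤ N + 1) : (kapC N j).1 x = 1 := by
  have : kap N (x j) = 1 := (kap N).one_of_mem_closedBall (by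
    simpa [kap] using hx)
  simp [kapC, this]

theorem kapC_zero (N : ℕ) (j : Fin n) (x : Fin n → ℝ) (hx : N + 2 ≤ |x j|) : (kapC N j).1 x = 0 := by
  have : kap N (x j) = 0 := (kap N).zero_of_le_dist (by
    simpa [kap] using hx)
  simp [kapC, this]

variable [Module (AA n) (Cinf n)] [GoodMod n]

theorem X_smul_kapC (N : ℕ) (i j : Fin n) (h : i ≠ j) : (X i : AA n) • kapC N j = 0 := by
  apply Cinf.ext'
  intro x
  rw [X_smul_apply]
  have h1 : HasFDerivAt (fun x : Fin n → ℝ => ((kap N (x j) : ℝ) : ℂ)) _ x :=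
    (Complex.ofRealCLM.hasFDerivAt (x := kap N (x j))).comp x
      ((((kap N).contDiff (n := 1)).differentiable (by simp) (x j)).hasFDerivAt.comp x
        (ContinuousLinearMap.proj (R := ℝ) (φ := fun _ : Fin n => ℝ) j).hasFDerivAt)
  have h2 : fderiv ℝ (kapC N j).1 x = _ := h1.fderiv
  rw [h2]
  simp [Pi.single_apply, h.symm]

theorem controllable_of_div {ℓ k : ℕ} (P : Matrix (Fin ℓ) (Fin k) (AA n))
    (Q : Matrix (Fin k) (Fin ℓ) (AA n)) (a : AA n)
    (hPQ : P * Q = a • (1 : Matrix (Fin ℓ) (Fin ℓ) (AA n)))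
    (hdiv : ∀ f ∈ system P, ∃ g ∈ system P, ∀ j, a • g j = f j) :
    IsControllable (system P) := by
  intro U₁ U₂ hU f₁ hf₁ f₂ hf₂
  obtain ⟨g₁, hg₁, h₁⟩ := hdiv f₁ hf₁
  obtain ⟨g₂, hg₂, h₂⟩ := hdiv f₂ hf₂
  obtain ⟨χ, W, V, hW, hV, hUW, hUV, hχ0, hχ1⟩ := exists_cutoff (s := closure U₂) (t := closure U₁)
    isClosed_closure isClosed_closure (by
      rw [Set.disjoint_iff_inter_eq_empty, Set.inter_comm]; exact hU)
  let h : Fin k → Cinf n := fun j => mulC χ (g₁ j) + mulC (⟨fun x => 1 - χ.1 x, contDiff_const.sub (Cinf.contDiff χ)⟩ : Cinf n) (g₂ j)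
  have hV' : ∀ j, ∀ x ∈ V, (h j).1 x = (g₁ j).1 x := by
    intro j x hx; simp [h, hχ1 x hx]
  have hW' : ∀ j, ∀ x ∈ W, (h j).1 x = (g₂ j).1 x := by
    intro j x hx; simp [h, hχ0 x hx]
  let f : Fin k → Cinf n := fun j => a • h j - ∑ i, Q j i • ∑ j', P i j' • h j'
  have hloc : ∀ (O : Set (Fin n → ℝ)), IsOpen O → ∀ g : Fin k → Cinf n, g ∈ system P →
      (∀ j, ∀ x ∈ O, (h j).1 x = (g j).1 x) → ∀ x ∈ O, ∀ j, (f j).1 x = (a • g j).1 x := by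
    intro O hO g hg hh x hx j
    simp only [f, Cinf.sub_apply, Cinf.sum_apply]
    rw [smul_congr_on hO (hh j) a x hx, Finset.sum_eq_zero, sub_zero]
    intro i _
    refine smul_zero_on hO ?_ _ x hx
    intro y hy
    have := congrArg (fun u : Cinf n => u.1 y) (hg i)
    simp only [Cinf.sum_apply, Cinf.zero_apply] at this ⊢
    rw [← this]
    exact Finset.sum_congr rfl fun j' _ => smul_congr_on hO (hh j') _ y hy
  refine ⟨f, ?_, V, W, hV, hW, subset_closure.trans hUV, subset_closure.trans hUW, ?_, ?_⟩
  · intro i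
    simp only [f, smul_sub, Finset.sum_sub_distrib, Finset.smul_sum, smul_smul]
    rw [sub_eq_zero]
    have e : ∀ i', ∑ j, P i j * Q j i' = if i = i' then a else 0 := by
      intro i'
      have := congrFun (congrFun hPQ i) i'
      rw [Matrix.mul_apply] at this
      rw [this, Matrix.smul_apply, Matrix.one_apply]; simp
    rw [Finset.sum_comm]
    have : ∀ i', ∑ j, ∑ j', (P i j * (Q j i' * P i' j')) • h j' =
        ∑ j', ((if i = i' then a else 0) * P i' j') • h j' := by
      intro i'
      rw [Finset.sum_comm]
      refine Finset.sum_congr rfl fun j' _ => ?_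
      rw [← e, Finset.sum_mul, Finset.sum_smul]
      exact Finset.sum_congr rfl fun _ _ => by rw [mul_assoc]
    simp only [this]
    rw [Finset.sum_eq_single i]
    · simp [mul_comm]
    · intro i' _ hi'; simp [Ne.symm hi']
    · simp
  · intro x hx j
    rw [hloc V hV g₁ hg₁ hV' x hx j, h₁]
  · intro x hx j
    rw [hloc W hW g₂ hg₂ hW' x hx j, h₂]
end crit

set_option autoImplicit false
open MvPolynomial Filter Topology

section expo
variable {n : ℕ}

/-- exponential function -/
def expo (μ : Fin n → ℂ) : Cinf n := ⟨fun x => Complex.exp (dlin μ x),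
  show ContDiff ℝ (⊤ : ℕ∞) _ from (dlin μ).contDiff.cexp⟩

theorem expo_apply (μ : Fin n → ℂ) (x) : (expo μ).1 x = Complex.exp (dlin μ x) := rfl

theorem dlin_smul (c : ℂ) (v : Fin n → ℂ) : dlin (fun j => c * v j) = c • dlin v := by
  ext y; simp [dlin_apply, Finset.mul_sum, mul_left_comm]

theorem expo_hasFDerivAt (μ : Fin n → ℂ) (x) :
    HasFDerivAt (expo μ).1 (dlin fun j => μ j * (expo μ).1 x) x := by
  have h := (dlin μ).hasFDerivAt (x := x) |>.cexp
  have e : (dlin fun j => μ j * (expo μ).1 x) = Complex.exp (dlin μ x) • dlin μ := by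
    rw [← dlin_smul]; congr 1; ext j; rw [mul_comm]; rfl
  rw [e]; exact h

/-- frequencies -/
def fr (L : ℝ) (lam : Fin n → ℝ) (k : Fin n → ℤ) : Fin n → ℂ :=
  fun j => 2 * Real.pi * Complex.I * k j / L + lam j

def Rapid (L : ℝ) (lam : Fin n → ℝ) (h : (Fin n → ℤ) → ℂ) : Prop :=
  ∀ p : AA n, Summable fun k => ‖h k * eval (fr L lam k) p‖

theorem norm_expo_fr (L : ℝ) (lam : Fin n → ℝ) (k : Fin n → ℤ) (x) :
    ‖(expo (fr L lam k)).1 x‖ = Real.exp (∑ j, x j * lam j) := by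
  rw [expo_apply, Complex.norm_exp, dlin_apply]
  congr 1
  simp only [Complex.re_sum, fr]
  refine Finset.sum_congr rfl fun j _ => ?_
  have : (2 * Real.pi * Complex.I * k j / L + lam j : ℂ) =
      ((2 * Real.pi * k j / L : ℝ) : ℂ) * Complex.I + (lam j : ℝ) := by push_cast; ring
  rw [this]; simp

theorem norm_expo_fr_le (L : ℝ) (lam : Fin n → ℝ) (k : Fin n → ℤ) (x) (R : ℝ) (hx : ‖x‖ ≤ R) :
    ‖(expo (fr L lam k)).1 x‖ ≤ Real.exp (∑ j, R * |lam j|) := by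
  rw [norm_expo_fr]
  refine Real.exp_le_exp.2 (Finset.sum_le_sum fun j _ => ?_)
  calc x j * lam j ≤ |x j| * |lam j| := by rw [← abs_mul]; exact le_abs_self _
    _ ≤ _ := by
      gcongr
      exact (norm_le_pi_norm x j).trans hx

variable [Module (AA n) (Cinf n)] [GoodMod n]

theorem EE_exists (L : ℝ) (lam : Fin n → ℝ) (h : (Fin n → ℤ) → ℂ) (hr : Rapid L lam h) :
    ∃ u : Cinf n, ∀ p x, (p • u).1 x =
      ∑' k, h k * eval (fr L lam k) p * (expo (fr L lam k)).1 x := by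
  have hs : ∀ (p : AA n) x, Summable fun k => h k * eval (fr L lam k) p * (expo (fr L lam k)).1 x := by
    intro p x
    apply Summable.of_norm
    simp_rw [norm_mul _ ((expo _).1 x), norm_expo_fr]
    exact (hr p).mul_right _
  apply family_cinf
  · intro p q x
    rw [← (hs p x).tsum_add (hs q x)]
    congr 1; ext k; rw [map_add]; ring
  · intro c p x
    rw [← tsum_mul_left]
    congr 1; ext k; rw [map_mul, eval_C]; ring
  · intro p x
    set R := ‖x‖ + 1
    have key := hasFDerivAt_tsum_of_isPreconnected (𝕜 := ℝ) (α := Fin n → ℤ)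
      (f := fun k x => h k * eval (fr L lam k) p * (expo (fr L lam k)).1 x)
      (f' := fun k x => dlin fun j => h k * eval (fr L lam k) (X j * p) * (expo (fr L lam k)).1 x)
      (u := fun k => ∑ j, ‖h k * eval (fr L lam k) (X j * p)‖ * Real.exp (∑ j, R * |lam j|))
      (s := Metric.ball 0 R) (x₀ := x) (x := x) (summable_sum fun j _ => (hr (X j * p)).mul_right _) Metric.isOpen_ball
      (convex_ball _ _).isPreconnected ?_ ?_ ?_ (hs p x) ?_
    · refine key.congr_fderiv (Eq.symm ?_)
      have hsd : Summable fun k => dlin fun j => h k * eval (fr L lam k) (X j * p) * (expo (fr L lam k)).1 x := by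
        apply Summable.of_norm_bounded (summable_sum fun j (_ : j ∈ Finset.univ) => (hs (X j * p) x).norm)
        intro k; exact norm_dlin_le _
      ext y
      have := (ContinuousLinearMap.apply ℝ ℂ y).map_tsum hsd
      simp only [ContinuousLinearMap.apply_apply] at this
      rw [this]
      simp only [dlin_apply]
      rw [Summable.tsum_finsetSum]
      · simp [tsum_mul_left]
      · intro j _; exact (hs _ x).mul_left _
    · intro k y hy
      have := (expo_hasFDerivAt (fr L lam k) y).const_mul (h k * eval (fr L lam k) p)
      rw [← dlin_smul] at this
      refine this.congr_fderiv ?_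
      congr 1; ext j
      simp only [map_mul, eval_X]; ring
    · intro k y hy
      refine (norm_dlin_le _).trans (Finset.sum_le_sum fun j _ => ?_)
      rw [norm_mul]
      gcongr
      exact norm_expo_fr_le L lam k y R (by simpa using (Metric.mem_ball.1 hy).le)
    · simp [R]
    · simp [R]

open Classical in
/-- the sum of a Fourier series -/
def EE (L : ℝ) (lam : Fin n → ℝ) (h : (Fin n → ℤ) → ℂ) : Cinf n :=
  if hr : Rapid L lam h then (EE_exists L lam h hr).choose else 0

theorem EE_apply {L : ℝ} {lam : Fin n → ℝ} {h : (Fin n → ℤ) → ℂ} (hr : Rapid L lam h) (p : AA n) (x) :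
    (p • EE L lam h).1 x = ∑' k, h k * eval (fr L lam k) p * (expo (fr L lam k)).1 x := by
  rw [EE, dif_pos hr]; exact (EE_exists L lam h hr).choose_spec p x

theorem EE_apply1 {L : ℝ} {lam : Fin n → ℝ} {h : (Fin n → ℤ) → ℂ} (hr : Rapid L lam h) (x) :
    (EE L lam h).1 x = ∑' k, h k * (expo (fr L lam k)).1 x := by
  have := EE_apply hr 1 x
  simpa using this

theorem Rapid.summable {L : ℝ} {lam : Fin n → ℝ} {h : (Fin n → ℤ) → ℂ} (hr : Rapid L lam h) (x) :
    Summable fun k => h k * (expo (fr L lam k)).1 x := by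
  apply Summable.of_norm
  simp_rw [norm_mul _ ((expo _).1 x), norm_expo_fr]
  simpa using (hr 1).mul_right _

theorem Rapid.mul {L : ℝ} {lam : Fin n → ℝ} {h : (Fin n → ℤ) → ℂ} (hr : Rapid L lam h) (p : AA n) :
    Rapid L lam (fun k => h k * eval (fr L lam k) p) := by
  intro q
  have := hr (p * q)
  simpa [mul_assoc] using this

theorem Rapid.add {L : ℝ} {lam : Fin n → ℝ} {h h' : (Fin n → ℤ) → ℂ} (hr : Rapid L lam h) (hr' : Rapid L lam h') :
    Rapid L lam (fun k => h k + h' k) := by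
  intro q
  refine Summable.of_nonneg_of_le (fun _ => norm_nonneg _) (fun k => ?_) ((hr q).add (hr' q))
  rw [add_mul]; exact norm_add_le _ _

theorem Rapid.sum {L : ℝ} {lam : Fin n → ℝ} {ι : Type*} (s : Finset ι) {h : ι → (Fin n → ℤ) → ℂ}
    (hr : ∀ i ∈ s, Rapid L lam (h i)) :
    Rapid L lam (fun k => ∑ i ∈ s, h i k) := by
  intro q
  refine Summable.of_nonneg_of_le (fun _ => norm_nonneg _) (fun k => ?_)
    (summable_sum fun i (hi : i ∈ s) => (hr i hi q))
  rw [Finset.sum_mul]; exact norm_sum_le _ _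

theorem EE_smul {L : ℝ} {lam : Fin n → ℝ} {h : (Fin n → ℤ) → ℂ} (hr : Rapid L lam h) (p : AA n) :
    p • EE L lam h = EE L lam (fun k => h k * eval (fr L lam k) p) := by
  apply Cinf.ext'; intro x
  rw [EE_apply hr, EE_apply1 (hr.mul p)]

theorem EE_sum {L : ℝ} {lam : Fin n → ℝ} {ι : Type*} (s : Finset ι) {h : ι → (Fin n → ℤ) → ℂ}
    (hr : ∀ i ∈ s, Rapid L lam (h i)) :
    EE L lam (fun k => ∑ i ∈ s, h i k) = ∑ i ∈ s, EE L lam (h i) := by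
  apply Cinf.ext'; intro x
  rw [EE_apply1 (Rapid.sum s hr), Cinf.sum_apply]
  simp_rw [Finset.sum_mul]
  rw [Summable.tsum_finsetSum fun i hi => (hr i hi).summable x]
  exact Finset.sum_congr rfl fun i hi => (EE_apply1 (hr i hi) x).symm

end expo

set_option autoImplicit false
open MvPolynomial Filter Topology

section fcoef
variable {n : ℕ}

def CS (R : ℝ) (φ : Cinf n) : Prop := ∀ x, R < ‖x‖ → φ.1 x = 0

theorem CS.hcs {R : ℝ} {φ : Cinf n} (h : CS R φ) : HasCompactSupport φ.1 :=
  HasCompactSupport.intro (isCompact_closedBall 0 R) fun x hx => h x (by simpa using hx)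

theorem CS.mul {R : ℝ} {φ : Cinf n} (h : CS R φ) (ψ : Cinf n) : CS R (mulC ψ φ) := by
  intro x hx; simp [h x hx]

theorem CS.sub {R : ℝ} {φ ψ : Cinf n} (h : CS R φ) (h' : CS R ψ) : CS R (φ - ψ) := by
  intro x hx; simp [h x hx, h' x hx]

/-- Fourier coefficients -/
def Hc (L : ℝ) (lam : Fin n → ℝ) (φ : Cinf n) (k : Fin n → ℤ) : ℂ :=
  ((|(L ^ n)⁻¹| : ℝ) : ℂ) * ∫ x, (expo (-fr L lam k)).1 x * φ.1 x

theorem CS.integrable {R : ℝ} {φ : Cinf n} (h : CS R φ) (ψ : Cinf n) :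
    MeasureTheory.Integrable (fun x => ψ.1 x * φ.1 x) := by
  have := (h.mul ψ).hcs
  exact (Cinf.continuous (mulC ψ φ)).integrable_of_hasCompactSupport this

def wgt (k : Fin n → ℤ) : ℝ := ∏ j, (1 + (k j : ℝ)^2)

theorem wgt_pos (k : Fin n → ℤ) : 0 < wgt k := Finset.prod_pos fun j _ => by positivity

theorem summable_one : Summable fun k : ℤ => (1 + (k:ℝ)^2)⁻¹ := by
  have h0 := (Real.summable_one_div_int_pow (p := 2)).2 (by norm_num)
  rw [← Finset.summable_compl_iff {(0:ℤ)}] at h0 ⊢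
  refine Summable.of_nonneg_of_le (fun _ => by positivity) (fun k => ?_) h0
  have hk : (k.1 : ℝ) ≠ 0 := by
    have := k.2
    simpa using this
  rw [one_div]
  apply inv_anti₀ (by positivity)
  linarith

theorem summable_wgt : Summable fun k : Fin n → ℤ => (wgt k)⁻¹ := by
  classical
  set S := ∑' k : ℤ, (1 + (k:ℝ)^2)⁻¹
  apply summable_of_sum_le (c := S ^ n) (fun k => (inv_pos.2 (wgt_pos k)).le)
  intro u
  set t : Fin n → Finset ℤ := fun j => u.image (fun k => k j)
  calc ∑ x ∈ u, (wgt x)⁻¹ ≤ ∑ x ∈ Fintype.piFinset t, (wgt x)⁻¹ := by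
        apply Finset.sum_le_sum_of_subset_of_nonneg
        · intro x hx
          rw [Fintype.mem_piFinset]
          intro j
          exact Finset.mem_image_of_mem _ hx
        · intro k _ _; exact (inv_pos.2 (wgt_pos k)).le
    _ = ∏ j, ∑ i ∈ t j, (1 + (i:ℝ)^2)⁻¹ := by
        rw [Finset.prod_univ_sum]
        refine Finset.sum_congr rfl fun k _ => ?_
        simp [wgt]
    _ ≤ ∏ j : Fin n, S := by
        apply Finset.prod_le_prod
        · intro j _; exact Finset.sum_nonneg fun _ _ => by positivity
        · intro j _; exact summable_one.sum_le_tsum _ fun _ _ => by positivity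
    _ = S ^ n := by simp

/-- weight polynomial -/
def Wpol (L : ℝ) (lam : Fin n → ℝ) : AA n :=
  ∏ j, (1 - C (((L / (2 * Real.pi) : ℝ) : ℂ) ^ 2) * (X j - C (lam j : ℂ)) ^ 2)

theorem eval_Wpol {L : ℝ} (hL : 0 < L) (lam : Fin n → ℝ) (k : Fin n → ℤ) :
    eval (fr L lam k) (Wpol L lam) = (wgt k : ℂ) := by
  rw [Wpol, map_prod, wgt]
  push_cast
  refine Finset.prod_congr rfl fun j _ => ?_
  have h1 : (L : ℂ) ≠ 0 := by exact_mod_cast hL.ne'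
  have h2 : (Real.pi : ℂ) ≠ 0 := by exact_mod_cast Real.pi_ne_zero
  simp only [map_sub, map_mul, map_one, eval_C, map_pow, eval_X, fr, add_sub_cancel_right]
  field_simp
  rw [Complex.I_sq]; ring

variable [Module (AA n) (Cinf n)] [GoodMod n]

theorem CS.smul {R : ℝ} {φ : Cinf n} (h : CS R φ) (p : AA n) : CS R (p • φ) := by
  have hU : IsOpen {x : Fin n → ℝ | R < ‖x‖} := isOpen_lt continuous_const continuous_norm
  exact fun x hx => smul_zero_on hU (fun x hx => h x hx) p x hx

theorem X_smul_expo (μ : Fin n → ℂ) (i : Fin n) : (X i : AA n) • expo μ = μ i • expo μ := by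
  apply Cinf.ext'; intro x
  exact X_smul_of_hasFDerivAt (expo μ) x _ (expo_hasFDerivAt μ x) i

theorem Hc_X {L : ℝ} {lam : Fin n → ℝ} {R : ℝ} {φ : Cinf n} (h : CS R φ) (i : Fin n) (k) :
    Hc L lam ((X i : AA n) • φ) k = Hc L lam φ k * fr L lam k i := by
  have hX (f : Cinf n) : (fun x => fderiv ℝ f.1 x (Pi.single i 1)) = ((X i : AA n) • f).1 := by
    ext x; rw [X_smul_apply]
  have hX' (f : Cinf n) (x) : fderiv ℝ f.1 x (Pi.single i 1) = ((X i : AA n) • f).1 x := by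
    rw [X_smul_apply]
  have key := integral_mul_fderiv_eq_neg_fderiv_mul_of_integrable (μ := MeasureTheory.volume) (f := (expo (-fr L lam k)).1) (g := φ.1)
    (v := Pi.single i 1) (by simp only [hX']; exact h.integrable _)
    (by simp only [hX']; exact (h.smul _).integrable _) (h.integrable _)
    (fun x _ => Cinf.differentiable _ x) (fun x _ => Cinf.differentiable _ x)
  simp only [hX', X_smul_expo] at key
  rw [Hc, key, Hc, mul_assoc]
  congr 1
  rw [← MeasureTheory.integral_neg, ← MeasureTheory.integral_mul_const]
  congr 1
  ext x
  simp; ring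

theorem Hc_add {L : ℝ} {lam : Fin n → ℝ} {R : ℝ} {φ ψ : Cinf n} (h : CS R φ) (h' : CS R ψ) (k) :
    Hc L lam (φ + ψ) k = Hc L lam φ k + Hc L lam ψ k := by
  rw [Hc, Hc, Hc, ← mul_add, ← MeasureTheory.integral_add (h.integrable _) (h'.integrable _)]
  refine congrArg _ (MeasureTheory.integral_congr_ae (Eventually.of_forall fun x => ?_))
  simp; ring

theorem Hc_csmul {L : ℝ} {lam : Fin n → ℝ} {φ : Cinf n} (c : ℂ) (k) :
    Hc L lam (c • φ) k = c * Hc L lam φ k := by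
  rw [Hc, Hc, mul_left_comm c, ← MeasureTheory.integral_const_mul c]
  refine congrArg _ (MeasureTheory.integral_congr_ae (Eventually.of_forall fun x => ?_))
  simp; ring

theorem Hc_zero {L : ℝ} {lam : Fin n → ℝ} (k) : Hc L lam (0 : Cinf n) k = 0 := by
  simp [Hc]

theorem CS.zero {R : ℝ} : CS R (0 : Cinf n) := fun _ _ => rfl

theorem CS.sum {R : ℝ} {ι : Type*} (s : Finset ι) {φ : ι → Cinf n} (h : ∀ i ∈ s, CS R (φ i)) :
    CS R (∑ i ∈ s, φ i) := by
  intro x hx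
  rw [Cinf.sum_apply]
  exact Finset.sum_eq_zero fun i hi => h i hi x hx

theorem Hc_sum {L : ℝ} {lam : Fin n → ℝ} {R : ℝ} {ι : Type*} (s : Finset ι) {φ : ι → Cinf n}
    (h : ∀ i ∈ s, CS R (φ i)) (k) :
    Hc L lam (∑ i ∈ s, φ i) k = ∑ i ∈ s, Hc L lam (φ i) k := by
  classical
  induction s using Finset.induction_on with
  | empty => simp [Hc_zero]
  | insert a s ha ih =>
    rw [Finset.sum_insert ha, Finset.sum_insert ha, Hc_add (h a (by simp)) (CS.sum s fun i hi => h i (by simp [hi])),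
      ih fun i hi => h i (by simp [hi])]

theorem Hc_smul {L : ℝ} {lam : Fin n → ℝ} {R : ℝ} {φ : Cinf n} (h : CS R φ) (p : AA n) (k) :
    Hc L lam (p • φ) k = Hc L lam φ k * eval (fr L lam k) p := by
  induction p using act_induction with
  | h1 => simp
  | hadd p q hp hq => rw [add_smul, Hc_add (h.smul p) (h.smul q), hp, hq, map_add]; ring
  | hC c p hp => rw [C_mul_smul, Hc_csmul, hp, map_mul, eval_C]; ring
  | hXm i p hp => rw [mul_smul, Hc_X (h.smul p), hp, map_mul, eval_X]; ring

theorem Hc_bound {L : ℝ} {lam : Fin n → ℝ} (φ : Cinf n) :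
    ∃ B, ∀ k, ‖Hc L lam φ k‖ ≤ B := by
  refine ⟨|(L^n)⁻¹| * ∫ x, Real.exp (-∑ j, x j * lam j) * ‖φ.1 x‖, fun k => ?_⟩
  rw [Hc, norm_mul, Complex.norm_real, Real.norm_eq_abs, abs_abs]
  gcongr
  refine (MeasureTheory.norm_integral_le_integral_norm _).trans (le_of_eq ?_)
  congr 1; ext x
  rw [norm_mul]
  congr 1
  have h1 : (expo (-fr L lam k)).1 x = ((expo (fr L lam k)).1 x)⁻¹ := by
    rw [expo_apply, expo_apply, ← Complex.exp_neg]
    congr 1; simp [dlin_apply]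
  rw [h1, norm_inv, norm_expo_fr, Real.exp_neg]

theorem Hc_rapid {L : ℝ} (hL : 0 < L) (lam : Fin n → ℝ) {R : ℝ} {φ : Cinf n} (h : CS R φ) :
    Rapid L lam (Hc L lam φ) := by
  intro p
  obtain ⟨B, hB⟩ := Hc_bound (L := L) (lam := lam) ((Wpol L lam * p) • φ)
  refine Summable.of_nonneg_of_le (fun _ => norm_nonneg _) (fun k => ?_) (summable_wgt.mul_left B)
  have := hB k
  rw [Hc_smul h, map_mul, eval_Wpol hL, mul_left_comm, norm_mul, Complex.norm_real, Real.norm_eq_abs,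
    abs_of_pos (wgt_pos k)] at this
  rw [← div_eq_mul_inv, le_div_iff₀ (wgt_pos k), mul_comm]
  exact this

end fcoef

set_option autoImplicit false
open MvPolynomial Filter Topology

section inversion
variable {n : ℕ}

def toT (s : Fin n → ℝ) : UnitAddTorus (Fin n) := fun i => (s i : UnitAddCircle)

theorem mF_toT (k : Fin n → ℤ) (s : Fin n → ℝ) :
    UnitAddTorus.mFourier k (toT s) = Complex.exp (∑ i, 2 * Real.pi * Complex.I * k i * s i) := by
  rw [Complex.exp_sum]
  simp only [UnitAddTorus.mFourier, ContinuousMap.coe_mk, toT, fourier_coe_apply]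
  simp

theorem expo_fr_eq {L : ℝ} (lam : Fin n → ℝ) (k : Fin n → ℤ) (x : Fin n → ℝ) :
    (expo (fr L lam k)).1 x = Complex.exp (∑ j, (x j : ℂ) * lam j) *
      UnitAddTorus.mFourier k (toT fun i => x i / L) := by
  rw [mF_toT, ← Complex.exp_add, expo_apply, dlin_apply, ← Finset.sum_add_distrib]
  congr 1
  refine Finset.sum_congr rfl fun j _ => ?_
  simp only [fr]
  push_cast; ring

/-- periodization of a function with small support -/
def perT (L : ℝ) (g : (Fin n → ℝ) → ℂ) : UnitAddTorus (Fin n) → ℂ :=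
  fun y => g (fun i => L * (AddCircle.equivIoc (1:ℝ) (-(1/2)) (y i) : ℝ))

theorem perT_continuous {L R : ℝ} (hL : 0 < L) (hR : 2 * R < L) {g : (Fin n → ℝ) → ℂ}
    (hg : Continuous g) (h0 : ∀ x, R < ‖x‖ → g x = 0) : Continuous (perT L g) := by
  rw [continuous_iff_continuousAt]
  intro y
  by_cases hy : ∀ i, y i ≠ ((-(1/2) : ℝ) : UnitAddCircle)
  · apply hg.continuousAt.comp
    rw [continuousAt_pi]
    intro i
    have h1 : ContinuousAt (fun z : UnitAddTorus (Fin n) => AddCircle.equivIoc (1:ℝ) (-(1/2)) (z i)) y :=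
      ContinuousAt.comp (f := fun z : UnitAddTorus (Fin n) => z i) (AddCircle.continuousAt_equivIoc (1:ℝ) (-(1/2)) (hy i)) (continuous_apply i).continuousAt
    exact continuousAt_const.mul (continuous_subtype_val.continuousAt.comp h1)
  · push Not at hy
    obtain ⟨i, hi⟩ := hy
    have hopen : IsOpen {z : UnitAddTorus (Fin n) | R / L < ‖z i‖} :=
      isOpen_lt continuous_const (continuous_norm.comp (continuous_apply i))
    have hmem : y ∈ {z : UnitAddTorus (Fin n) | R / L < ‖z i‖} := by
      simp only [Set.mem_setOf_eq, hi]
      rw [AddCircle.coe_neg, norm_neg, AddCircle.norm_half_period_eq (1:ℝ), div_lt_iff₀ hL]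
      simp; linarith
    have hz : ∀ z ∈ {z : UnitAddTorus (Fin n) | R / L < ‖z i‖}, perT L g z = 0 := by
      intro z hz
      apply h0
      simp only [Set.mem_setOf_eq] at hz
      have h1 : ‖z i‖ ≤ |(AddCircle.equivIoc (1:ℝ) (-(1/2)) (z i) : ℝ)| := by
        conv_lhs => rw [← AddCircle.coe_equivIoc (p := (1:ℝ)) (a := -(1/2)) (y := z i)]
        exact QuotientAddGroup.norm_mk_le_norm
      have h2 : ‖L * (AddCircle.equivIoc (1:ℝ) (-(1/2)) (z i) : ℝ)‖ ≤ _ :=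
        norm_le_pi_norm (fun i => L * (AddCircle.equivIoc (1:ℝ) (-(1/2)) (z i) : ℝ)) i
      refine lt_of_lt_of_le ?_ h2
      rw [norm_mul, Real.norm_eq_abs, Real.norm_eq_abs, abs_of_pos hL]
      rw [div_lt_iff₀ hL] at hz
      nlinarith
    refine ContinuousAt.congr (f := fun _ => 0) continuousAt_const ?_
    filter_upwards [hopen.mem_nhds hmem] with z hz'
    exact (hz z hz').symm

theorem perT_toT {L : ℝ} {g : (Fin n → ℝ) → ℂ} (s : Fin n → ℝ)
    (hs : ∀ i, s i ∈ Set.Ioc (-(1/2) : ℝ) (1/2)) : perT L g (toT s) = g (L • s) := by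
  simp only [perT, toT]
  congr 1; ext i
  rw [AddCircle.equivIoc_coe_of_mem]
  · simp
  · exact ⟨(hs i).1, by have := (hs i).2; linarith⟩

theorem perT_coeff {L R : ℝ} (hL : 0 < L) (hR : 2 * R < L) (lam : Fin n → ℝ) {φ : Cinf n} (h : CS R φ)
    (k : Fin n → ℤ) :
    UnitAddTorus.mFourierCoeff (perT L fun x => Complex.exp (-∑ j, (x j : ℂ) * lam j) * φ.1 x) k =
      Hc L lam φ k := by
  rw [UnitAddTorus.mFourierCoeff_eq_integral _ _ (fun _ => -(1/2))]
  set S : Set (Fin n → ℝ) := {x : Fin n → ℝ | ∀ i, x i ∈ Set.Ioc ((-(1/2) : ℝ)) ((-(1/2) : ℝ) + 1)}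
  have hS : MeasurableSet S := MeasurableSet.univ_pi' fun i => measurableSet_Ioc
  have e1 : ∀ x ∈ S, UnitAddTorus.mFourier (-k) (fun i => (x i : UnitAddCircle)) •
      (perT L fun x => Complex.exp (-∑ j, (x j : ℂ) * lam j) * φ.1 x) (fun i => (x i : UnitAddCircle)) =
      (fun z => (expo (-fr L lam k)).1 z * φ.1 z) (L • x) := by
    intro x hx
    have := perT_toT (L := L) (g := fun x => Complex.exp (-∑ j, (x j : ℂ) * lam j) * φ.1 x) x
      (fun i => by have := hx i; norm_num at this; norm_num; exact this)
    change UnitAddTorus.mFourier (-k) (toT x) • perT L _ (toT x) = _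
    simp only
    rw [this, mF_toT, smul_eq_mul, ← mul_assoc, ← Complex.exp_add, expo_apply, dlin_apply]
    congr 2
    rw [← Finset.sum_neg_distrib, ← Finset.sum_add_distrib]
    refine Finset.sum_congr rfl fun j _ => ?_
    have h1 : (L : ℂ) ≠ 0 := by exact_mod_cast hL.ne'
    simp only [fr, Pi.neg_apply, Pi.smul_apply, smul_eq_mul]
    push_cast
    field_simp
    ring
  rw [MeasureTheory.setIntegral_congr_fun hS e1, MeasureTheory.setIntegral_eq_integral_of_forall_compl_eq_zero]
  · rw [MeasureTheory.Measure.integral_comp_smul MeasureTheory.volume (fun z => (expo (-fr L lam k)).1 z * φ.1 z) L, Hc]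
    simp
  · intro x hx
    simp only
    rw [h (L • x), mul_zero]
    by_contra hc
    apply hx
    intro i
    have h2 : ‖(L • x) i‖ ≤ R := (norm_le_pi_norm _ i).trans (not_lt.1 hc)
    rw [Pi.smul_apply, smul_eq_mul, norm_mul, Real.norm_eq_abs, Real.norm_eq_abs, abs_of_pos hL] at h2
    have h3 : |x i| < 1/2 := by nlinarith
    rw [abs_lt] at h3
    exact ⟨h3.1, by linarith⟩

variable [Module (AA n) (Cinf n)] [GoodMod n]

theorem EE_Hc {L R : ℝ} (hL : 0 < L) (hR : 2 * R < L) (lam : Fin n → ℝ) {φ : Cinf n} (h : CS R φ)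
    (x : Fin n → ℝ) (hx : ∀ i, x i ∈ Set.Ioc (-(L/2)) (L/2)) :
    (EE L lam (Hc L lam φ)).1 x = φ.1 x := by
  have hr := Hc_rapid hL lam h
  set g : (Fin n → ℝ) → ℂ := fun x => Complex.exp (-∑ j, (x j : ℂ) * lam j) * φ.1 x
  have hc : Continuous (perT L g) := by
    apply perT_continuous hL hR
    · have := Cinf.continuous φ
      fun_prop
    · intro x hx; simp [g, h x hx]
  have hco : UnitAddTorus.mFourierCoeff (⇑(⟨perT L g, hc⟩ : C(UnitAddTorus (Fin n), ℂ))) = Hc L lam φ := by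
    ext k; exact perT_coeff hL hR lam h k
  have hsum : Summable (UnitAddTorus.mFourierCoeff (⇑(⟨perT L g, hc⟩ : C(UnitAddTorus (Fin n), ℂ)))) := by
    rw [hco]
    apply Summable.of_norm
    simpa using hr 1
  have key := UnitAddTorus.hasSum_mFourier_series_apply_of_summable hsum (toT fun i => x i / L)
  rw [hco] at key
  have e : (⟨perT L g, hc⟩ : C(UnitAddTorus (Fin n), ℂ)) (toT fun i => x i / L) = g x := by
    change perT L g _ = _
    rw [perT_toT]
    · congr 1; ext i; simp only [Pi.smul_apply, smul_eq_mul]; field_simp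
    · intro i
      have := hx i
      constructor
      · rw [lt_div_iff₀ hL]; linarith [this.1]
      · rw [div_le_iff₀ hL]; linarith [this.2]
  rw [e] at key
  rw [EE_apply1 hr]
  have k2 := key.mul_left (Complex.exp (∑ j, (x j : ℂ) * lam j))
  have e3 : Complex.exp (∑ j, (x j : ℂ) * lam j) * g x = φ.1 x := by
    simp only [g]
    rw [← mul_assoc, ← Complex.exp_add]; simp
  rw [e3] at k2
  rw [← k2.tsum_eq]
  refine tsum_congr fun k => ?_
  rw [expo_fr_eq, smul_eq_mul]; ring

theorem mF_coeff (m l : Fin n → ℤ) :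
    UnitAddTorus.mFourierCoeff (⇑(UnitAddTorus.mFourier m)) l = if m = l then 1 else 0 := by
  classical
  have h1 := congrFun (UnitAddTorus.coe_mFourierBasis (d := Fin n)) m
  have h2 := UnitAddTorus.mFourierBasis_repr (UnitAddTorus.mFourierBasis m) l
  rw [HilbertBasis.repr_self] at h2
  have h3 := UnitAddTorus.mFourierCoeff_toLp (UnitAddTorus.mFourier m) l
  have h4 : UnitAddTorus.mFourierCoeff (↑↑(UnitAddTorus.mFourierBasis m)) l =
    UnitAddTorus.mFourierCoeff (⇑(UnitAddTorus.mFourier m)) l := by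
    rw [← h3, h1]
  rw [← h4, ← h2, lp.single_apply, Pi.single_apply]
  simp only [eq_comm]

theorem uniq_aux (c : (Fin n → ℤ) → ℂ) (hc : Summable fun k => ‖c k‖) (Φ : (Fin n → ℤ) → (Fin n → ℤ))
    (h : ∀ s : Fin n → ℝ, (∀ i, s i ∈ Set.Ioc (-(1/2) : ℝ) (1/2)) →
      ∑' k, c k * UnitAddTorus.mFourier (Φ k) (toT s) = 0) (l : Fin n → ℤ) :
    ∑' k, (if Φ k = l then c k else 0) = 0 := by
  set S : Set (Fin n → ℝ) := {x : Fin n → ℝ | ∀ i, x i ∈ Set.Ioc ((-(1/2) : ℝ)) ((-(1/2) : ℝ) + 1)} with hSdef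
  have hS : MeasurableSet S := MeasurableSet.univ_pi' fun i => measurableSet_Ioc
  have hvol : MeasureTheory.volume S < ⊤ := by
    have : S ⊆ Set.Icc (fun _ => (-(1/2))) (fun _ => (1/2)) := by
      intro x hx
      constructor
      · intro i; exact (hx i).1.le
      · intro i; have := (hx i).2; norm_num at this; simpa using this
    exact (MeasureTheory.measure_mono this).trans_lt (isCompact_Icc.measure_lt_top)
  set F : (Fin n → ℤ) → (Fin n → ℝ) → ℂ := fun k s =>
    c k * (UnitAddTorus.mFourier (-l) (toT s) * UnitAddTorus.mFourier (Φ k) (toT s))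
  have hcont : ∀ k : Fin n → ℤ, Continuous fun s : Fin n → ℝ => UnitAddTorus.mFourier k (toT s) := by
    intro k
    simp_rw [mF_toT]
    fun_prop
  have hnorm : ∀ (k : Fin n → ℤ) y, ‖UnitAddTorus.mFourier k y‖ = 1 := by
    intro k y
    simp only [UnitAddTorus.mFourier, fourier_apply, norm_prod, ContinuousMap.coe_mk]
    exact Finset.prod_eq_one fun i _ => Circle.norm_coe _
  have hFn : ∀ k s, ‖F k s‖ = ‖c k‖ := by
    intro k s; simp only [F, norm_mul, hnorm, mul_one]
  have hintg : ∀ k, MeasureTheory.Integrable (F k) (MeasureTheory.volume.restrict S) := by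
    intro k
    refine MeasureTheory.Measure.integrableOn_of_bounded hvol.ne ?_ (M := ‖c k‖) ?_
    · exact (continuous_const.mul ((hcont _).mul (hcont _))).aestronglyMeasurable
    · exact Eventually.of_forall fun s => (hFn k s).le
  have key := MeasureTheory.hasSum_integral_of_summable_integral_norm hintg (by
    simp_rw [hFn]
    simp only [MeasureTheory.integral_const]
    exact hc.mul_left _)
  have e0 : ∫ a, ∑' k, F k a ∂(MeasureTheory.volume.restrict S) = 0 := by
    rw [MeasureTheory.setIntegral_congr_fun (g := fun _ => 0) hS]
    · simp
    · intro s hs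
      have := h s (fun i => by have := hs i; norm_num at this; norm_num; exact this)
      simp only [F]
      have e : ∀ k, c k * (UnitAddTorus.mFourier (-l) (toT s) * UnitAddTorus.mFourier (Φ k) (toT s)) =
        UnitAddTorus.mFourier (-l) (toT s) * (c k * UnitAddTorus.mFourier (Φ k) (toT s)) := fun k => by ring
      simp_rw [e, tsum_mul_left, this, mul_zero]
  rw [e0] at key
  refine (tsum_congr fun k => ?_).trans key.tsum_eq
  have e2 := UnitAddTorus.mFourierCoeff_eq_integral (⇑(UnitAddTorus.mFourier (Φ k))) l (fun _ => -(1/2))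
  rw [mF_coeff] at e2
  simp only [F]
  rw [MeasureTheory.integral_const_mul]
  simp only [smul_eq_mul] at e2
  change _ = c k * ∫ (x : Fin n → ℝ) in S, UnitAddTorus.mFourier (-l) (fun i => (x i : UnitAddCircle)) *
    UnitAddTorus.mFourier (Φ k) (fun i => (x i : UnitAddCircle))
  rw [hSdef, ← e2]
  split_ifs <;> simp

theorem uniq_mult (c : (Fin n → ℤ) → ℂ) (hc : Summable fun k => ‖c k‖) (Φ : (Fin n → ℤ) → (Fin n → ℤ))
    (h : ∀ s : Fin n → ℝ, (∀ i, s i ∈ Set.Ioc (-(1/2) : ℝ) (1/2)) →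
      ∑' k, c k * UnitAddTorus.mFourier (Φ k) (toT s) = 0) (G : (Fin n → ℤ) → ℂ)
    (hG : Summable fun k => c k * G (Φ k)) :
    ∑' k, c k * G (Φ k) = 0 := by
  rw [← (Equiv.sigmaFiberEquiv Φ).tsum_eq, Summable.tsum_sigma]
  · refine (tsum_congr fun l => ?_).trans tsum_zero
    have h1 := uniq_aux c hc Φ h l
    have e : ∀ k : {k // Φ k = l}, c ((Equiv.sigmaFiberEquiv Φ) ⟨l, k⟩) *
      G (Φ ((Equiv.sigmaFiberEquiv Φ) ⟨l, k⟩)) = c k * G l := by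
      intro k
      simp [Equiv.sigmaFiberEquiv, k.2]
    simp_rw [e, tsum_mul_right]
    have h2 : ∑' k : {k // Φ k = l}, c k = 0 := by
      rw [← h1]
      rw [show (∑' k : {k // Φ k = l}, c k) = ∑' k, Set.indicator {k | Φ k = l} c k from
        tsum_subtype {k | Φ k = l} c]
      refine tsum_congr fun k => ?_
      simp [Set.indicator_apply]
    rw [h2, zero_mul]
  · exact (Equiv.sigmaFiberEquiv Φ).summable_iff.2 hG

end inversion

set_option autoImplicit false
open MvPolynomial Filter Topology

section localsolve
variable {n : ℕ}

theorem eval_congr_supported {s : Set (Fin n)} {p : AA n} (hp : p ∈ supported ℂ s) {u v : Fin n → ℂ}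
    (h : ∀ i ∈ s, u i = v i) : eval u p = eval v p := by
  apply hom_congr_vars
  · ext; simp
  · intro i hi _
    simp only [eval_X]
    exact h i ((mem_supported.1 hp) hi)
  · rfl

/-- polynomial lower bound on the frequency lattice -/
def LB (L : ℝ) (lam : Fin n → ℝ) (c : AA n) : Prop :=
  ∃ (B : ℝ) (m : ℕ), ∀ k, 1 ≤ ‖eval (fr L lam k) c‖ * (B * wgt k ^ m)

theorem LB.ne {L : ℝ} {lam : Fin n → ℝ} {c : AA n} (hc : LB L lam c) (k) : eval (fr L lam k) c ≠ 0 := by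
  obtain ⟨B, m, hW⟩ := hc
  intro h0
  have := hW k
  rw [h0] at this
  norm_num at this

theorem LB.rapid {L : ℝ} (hL : 0 < L) {lam : Fin n → ℝ} {c : AA n} (hc : LB L lam c)
    {h : (Fin n → ℤ) → ℂ} (hr : Rapid L lam h) :
    Rapid L lam (fun k => h k / eval (fr L lam k) c) := by
  have hne := hc.ne
  obtain ⟨B, m, hW⟩ := hc
  intro q
  refine Summable.of_nonneg_of_le (fun _ => norm_nonneg _) (fun k => ?_) (hr (C (B:ℂ) * Wpol L lam ^ m * q))
  rw [map_mul, norm_mul, norm_mul, norm_mul, norm_div, ← mul_assoc]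
  gcongr
  rw [div_le_iff₀ (norm_pos_iff.2 (hne k)), mul_assoc]
  refine le_mul_of_one_le_right (norm_nonneg _) (by
    rw [mul_comm]
    refine (hW k).trans ?_
    gcongr
    rw [map_mul, map_pow, eval_Wpol hL, eval_C, norm_mul, norm_pow, Complex.norm_real, Complex.norm_real,
      Real.norm_eq_abs, Real.norm_eq_abs, abs_of_pos (wgt_pos k)]
    have := pow_pos (wgt_pos k) m
    gcongr
    exact le_abs_self B)

theorem LB.congr {L : ℝ} {lam lam' : Fin n → ℝ} {c : AA n} (hc : LB L lam c) {s : Set (Fin n)}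
    (hs : c ∈ supported ℂ s) (h : ∀ i ∈ s, lam i = lam' i) : LB L lam' c := by
  obtain ⟨B, m, hW⟩ := hc
  refine ⟨B, m, fun k => ?_⟩
  rw [← eval_congr_supported hs (u := fr L lam k)]
  · exact hW k
  · intro i hi; simp [fr, h i hi]

def MonicIn (i : Fin n) (c : AA n) : Prop :=
  ∃ (m : ℕ) (u : ℂ) (d : ℕ → AA n), u ≠ 0 ∧ (∀ f, d f ∈ supported ℂ ({i}ᶜ : Set (Fin n))) ∧
    c = C u * X i ^ m + ∑ f ∈ Finset.range m, d f * X i ^ f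

theorem avoid (M : ℕ) : ∃ ε : ℝ, 0 < ε ∧ ∀ (T : (Fin n → ℤ) → Finset ℝ), (∀ k, (T k).card ≤ M) →
    ∃ s : ℝ, ∀ k, ∀ r ∈ T k, ε / wgt k ≤ |s - r| := by
  classical
  set S := ∑' k : Fin n → ℤ, (wgt k)⁻¹
  have hS : 0 ≤ S := tsum_nonneg fun k => (inv_pos.2 (wgt_pos k)).le
  set ε : ℝ := 1 / (4 * (M + 1) * (S + 1))
  have hε : 0 < ε := by positivity
  refine ⟨ε, hε, fun T hT => ?_⟩
  by_contra hcon
  push Not at hcon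
  set Bd : (Fin n → ℤ) → Set ℝ := fun k => ⋃ r ∈ T k, Metric.ball r (ε / wgt k)
  have hcov : Set.Icc (0:ℝ) 1 ⊆ ⋃ k, Bd k := by
    intro s _
    obtain ⟨k, r, hr, h⟩ := hcon s
    simp only [Bd, Set.mem_iUnion, Metric.mem_ball, Real.dist_eq]
    exact ⟨k, r, hr, h⟩
  have hB : ∀ k, MeasureTheory.volume (Bd k) ≤ ENNReal.ofReal (M * (2 * (ε / wgt k))) := by
    intro k
    refine (MeasureTheory.measure_biUnion_finset_le _ _).trans ?_
    simp only [Real.volume_ball, Finset.sum_const, nsmul_eq_mul]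
    rw [ENNReal.ofReal_mul (p := (M:ℝ)) (by positivity), ENNReal.ofReal_natCast]
    gcongr
    exact hT k
  have hsum : Summable fun k : Fin n → ℤ => (M * (2 * (ε / wgt k)) : ℝ) := by
    have := (summable_wgt (n := n)).mul_left (M * (2 * ε))
    refine this.congr fun k => ?_
    rw [div_eq_mul_inv]; ring
  have h1 : (1 : ENNReal) ≤ ENNReal.ofReal (M * (2 * ε) * S) := by
    calc (1 : ENNReal) = MeasureTheory.volume (Set.Icc (0:ℝ) 1) := by simp
      _ ≤ ∑' k, MeasureTheory.volume (Bd k) := (MeasureTheory.measure_mono hcov).trans (MeasureTheory.measure_iUnion_le _)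
      _ ≤ ∑' k, ENNReal.ofReal (M * (2 * (ε / wgt k))) := ENNReal.tsum_le_tsum hB
      _ = ENNReal.ofReal (∑' k : Fin n → ℤ, M * (2 * (ε / wgt k))) := by
        rw [ENNReal.ofReal_tsum_of_nonneg _ hsum]
        intro k; have := wgt_pos k; positivity
      _ = _ := by
        congr 1
        rw [← tsum_mul_left]
        congr 1; ext k; rw [div_eq_mul_inv]; ring
  rw [← ENNReal.ofReal_one, ENNReal.ofReal_le_ofReal_iff (by positivity)] at h1
  have h2 : M * (2 * ε) * S = (2 * M * S) / (4 * (M + 1) * (S + 1)) := by simp only [ε]; ring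
  rw [h2, le_div_iff₀ (by positivity)] at h1
  have : (0:ℝ) ≤ M := by positivity
  nlinarith [mul_nonneg this hS]

theorem LB_exists {L : ℝ} (lam0 : Fin n → ℝ) (i : Fin n) {ι : Type*} [Fintype ι] (c : ι → AA n)
    (hc : ∀ a, MonicIn i (c a)) : ∃ s : ℝ, ∀ a, LB L (lam0 + Pi.single i s) (c a) := by
  classical
  choose m u d hu hd hcd using hc
  set P : ι → (Fin n → ℤ) → Polynomial ℂ := fun a k =>
    Polynomial.X ^ (m a) + ∑ f ∈ Finset.range (m a), Polynomial.C (eval (fr L lam0 k) (d a f) / u a) * Polynomial.X ^ f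
  have hPdeg : ∀ a k, (∑ f ∈ Finset.range (m a), Polynomial.C (eval (fr L lam0 k) (d a f) / u a) * Polynomial.X ^ f).degree < ((m a : ℕ) : WithBot ℕ) := by
    intro a k
    refine (Polynomial.degree_sum_le _ _).trans_lt ?_
    rw [Finset.sup_lt_iff (by exact WithBot.bot_lt_coe _)]
    intro f hf
    refine (Polynomial.degree_C_mul_X_pow_le _ _).trans_lt ?_
    exact_mod_cast Finset.mem_range.1 hf
  have hPm : ∀ a k, (P a k).Monic := fun a k => Polynomial.monic_X_pow_add (hPdeg a k)
  have hPd : ∀ a k, (P a k).natDegree = m a := by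
    intro a k
    apply Polynomial.natDegree_eq_of_degree_eq_some
    simp only [P]
    rw [Polynomial.degree_add_eq_left_of_degree_lt] <;> simp [hPdeg a k]
  obtain ⟨ε, hε, hav⟩ := avoid (n := n) (∑ a, m a)
  obtain ⟨s, hs⟩ := hav (fun k => Finset.univ.biUnion fun a =>
    ((P a k).roots.toFinset.image fun r => (r - fr L lam0 k i).re)) (by
      intro k
      refine Finset.card_biUnion_le.trans (Finset.sum_le_sum fun a _ => ?_)
      refine Finset.card_image_le.trans ?_
      refine (Multiset.toFinset_card_le _).trans ?_
      exact (Polynomial.card_roots' _).trans (hPd a k).le)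
  refine ⟨s, fun a => ⟨(‖u a‖ * ε ^ (m a))⁻¹, m a, fun k => ?_⟩⟩
  have hw := wgt_pos k
  have hfi : fr L (lam0 + Pi.single i s) k i = fr L lam0 k i + s := by
    simp [fr]; ring
  have hev : eval (fr L (lam0 + Pi.single i s) k) (c a) = u a * (P a k).eval (fr L lam0 k i + s) := by
    rw [hcd a]
    simp only [P, map_add, map_mul, map_pow, map_sum, eval_C, eval_X, hfi, Polynomial.eval_add,
      Polynomial.eval_pow, Polynomial.eval_X, Polynomial.eval_finset_sum, Polynomial.eval_mul, Polynomial.eval_C,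
      mul_add, Finset.mul_sum]
    congr 1
    refine Finset.sum_congr rfl fun f _ => ?_
    rw [eval_congr_supported (hd a f) (v := fr L lam0 k)]
    · field_simp [hu a]
    · intro j hj
      have hj' : j ≠ i := hj
      simp [fr, hj']
  have hlow : (ε / wgt k) ^ (m a) ≤ ‖(P a k).eval (fr L lam0 k i + s)‖ := by
    rw [(IsAlgClosed.splits (P a k)).eval_eq_prod_roots_of_monic (hPm a k)]
    have hcard : Multiset.card (P a k).roots = m a := by
      rw [← hPd a k]; exact ((IsAlgClosed.splits (P a k)).natDegree_eq_card_roots).symm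
    have hall : ∀ r ∈ (P a k).roots, ε / wgt k ≤ ‖fr L lam0 k i + s - r‖ := by
      intro r hr
      refine (hs k ((r - fr L lam0 k i).re) ?_).trans ?_
      · simp only [Finset.mem_biUnion, Finset.mem_image, Finset.mem_univ, true_and, Multiset.mem_toFinset]
        exact ⟨a, r, hr, rfl⟩
      · refine le_trans (le_of_eq ?_) (Complex.abs_re_le_norm _)
        congr 1; simp; ring
    rw [← hcard]
    generalize (P a k).roots = R at hall
    induction R using Multiset.induction_on with
    | empty => simp
    | cons r R ih =>
      rw [Multiset.map_cons, Multiset.prod_cons, norm_mul, Multiset.card_cons, pow_succ']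
      apply mul_le_mul (hall r (by simp)) (ih fun r hr => hall r (by simp [hr])) (by positivity) (norm_nonneg _)
  rw [hev, norm_mul]
  have hu' : 0 < ‖u a‖ := norm_pos_iff.2 (hu a)
  calc (1:ℝ) = ‖u a‖ * (ε / wgt k) ^ m a * ((‖u a‖ * ε ^ m a)⁻¹ * wgt k ^ m a) := by
        rw [div_pow]; field_simp
    _ ≤ _ := by gcongr

variable [Module (AA n) (Cinf n)] [GoodMod n]

theorem EE_div {L : ℝ} (hL : 0 < L) {lam : Fin n → ℝ} {c : AA n} (hc : LB L lam c)
    {h : (Fin n → ℤ) → ℂ} (hr : Rapid L lam h) :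
    c • EE L lam (fun k => h k / eval (fr L lam k) c) = EE L lam h := by
  rw [EE_smul (hc.rapid hL hr)]
  congr 1; ext k
  rw [div_mul_cancel₀ _ (hc.ne k)]

theorem EE_local {L R : ℝ} (hL : 0 < L) (hR : 2 * R < L) {lam : Fin n → ℝ} {φ : Cinf n} (h : CS R φ)
    {c : AA n} (hc : LB L lam c) (j : Fin n) (hcj : c ∈ supported ℂ ({j}ᶜ : Set (Fin n)))
    {N : ℝ} (hN : 2 * N ≤ L) (h0 : ∀ x : Fin n → ℝ, |x j| < N → φ.1 x = 0) (x : Fin n → ℝ) (hx : |x j| < N) :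
    (EE L lam (fun k => Hc L lam φ k / eval (fr L lam k) c)).1 x = 0 := by
  have hr := Hc_rapid hL lam h
  have hr' := hc.rapid hL hr
  rw [EE_apply1 hr']
  set Φ : (Fin n → ℤ) → (Fin n → ℤ) := fun k => Function.update k j 0
  set t := x j
  set ck : (Fin n → ℤ) → ℂ := fun k => Hc L lam φ k * Complex.exp (t * fr L lam k j)
  set G : (Fin n → ℤ) → ℂ := fun l => (eval (fr L lam l) c)⁻¹ *
    Complex.exp (∑ i, if i = j then 0 else (x i : ℂ) * fr L lam l i)
  have hEv : ∀ k, eval (fr L lam (Φ k)) c = eval (fr L lam k) c := by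
    intro k
    apply eval_congr_supported hcj
    intro i hi
    have hi' : i ≠ j := hi
    simp [fr, Φ, hi']
  have e1 : ∀ k, Hc L lam φ k / eval (fr L lam k) c * (expo (fr L lam k)).1 x = ck k * G (Φ k) := by
    intro k
    have : (expo (fr L lam k)).1 x = Complex.exp (t * fr L lam k j) *
        Complex.exp (∑ i, if i = j then 0 else (x i : ℂ) * fr L lam (Φ k) i) := by
      rw [expo_apply, ← Complex.exp_add, dlin_apply]
      congr 1
      have e2 : (t : ℂ) * fr L lam k j = ∑ i, if i = j then (x i : ℂ) * fr L lam k i else 0 := by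
        rw [Finset.sum_ite_eq']; simp [t]
      rw [e2, ← Finset.sum_add_distrib]
      refine Finset.sum_congr rfl fun i _ => ?_
      by_cases hi : i = j
      · simp [hi]
      · simp [hi, fr, Φ]
    simp only [ck, G, hEv]
    rw [this, div_eq_mul_inv]; ring
  simp_rw [e1]
  have hnt : ∀ k, ‖Complex.exp (t * fr L lam k j)‖ = Real.exp (t * lam j) := by
    intro k
    rw [Complex.norm_exp]
    congr 1
    have : (2 * Real.pi * Complex.I * k j / L + lam j : ℂ) =
      ((2 * Real.pi * k j / L : ℝ) : ℂ) * Complex.I + (lam j : ℝ) := by push_cast; ring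
    simp only [fr]
    rw [this]; simp
  apply uniq_mult
  · simp only [ck, norm_mul, hnt]
    have := (hr 1).mul_right (Real.exp (t * lam j))
    simpa using this
  · intro s hs
    set x' : Fin n → ℝ := Function.update (L • s) j t
    have hx' : φ.1 x' = 0 := h0 x' (by simpa [x'] using hx)
    have hE := EE_Hc hL hR lam h x' (by
      intro i
      by_cases hi : i = j
      · subst hi
        simp only [x', Function.update_self]
        rw [abs_lt] at hx
        exact ⟨by linarith [hx.1], by linarith [hx.2]⟩
      · simp only [x', Function.update_of_ne hi, Pi.smul_apply, smul_eq_mul]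
        have := hs i
        exact ⟨by nlinarith [this.1], by nlinarith [this.2]⟩)
    rw [hx', EE_apply1 hr] at hE
    have e3 : ∀ k, Hc L lam φ k * (expo (fr L lam k)).1 x' =
        Complex.exp (∑ i, if i = j then 0 else (L : ℂ) * s i * lam i) * (ck k * UnitAddTorus.mFourier (Φ k) (toT s)) := by
      intro k
      have : (expo (fr L lam k)).1 x' = Complex.exp (t * fr L lam k j) *
        (Complex.exp (∑ i, if i = j then 0 else (L : ℂ) * s i * lam i) * UnitAddTorus.mFourier (Φ k) (toT s)) := by
        rw [expo_apply, mF_toT, ← Complex.exp_add, ← Complex.exp_add, dlin_apply]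
        congr 1
        have e2 : (t : ℂ) * fr L lam k j = ∑ i, if i = j then (x i : ℂ) * fr L lam k i else 0 := by
          rw [Finset.sum_ite_eq']; simp [t]
        rw [e2, ← Finset.sum_add_distrib, ← Finset.sum_add_distrib]
        refine Finset.sum_congr rfl fun i _ => ?_
        have hL' : (L : ℂ) ≠ 0 := by exact_mod_cast hL.ne'
        by_cases hi : i = j
        · subst hi; simp [x', Φ, t]
        · simp only [hi, fr, Φ, x', Function.update_of_ne hi, if_false, Pi.smul_apply, smul_eq_mul]
          push_cast
          field_simp
          ring
      rw [this]; simp only [ck]; ring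
    simp_rw [e3, tsum_mul_left] at hE
    exact (mul_eq_zero.1 hE).resolve_left (Complex.exp_ne_zero _)
  · refine (hr'.summable x).congr fun k => ?_
    rw [e1]

end localsolve

set_option autoImplicit false
open MvPolynomial Filter Topology

section stages
variable {n : ℕ}

/-- product cutoff -/
def chiN (N : ℕ) : Cinf n :=
  ⟨fun x => ∏ j, (kapC N j).1 x, by
    show ContDiff ℝ (⊤ : ℕ∞) _
    exact contDiff_prod fun j _ => Cinf.contDiff (kapC N j)⟩

theorem chiN_apply (N : ℕ) (x : Fin n → ℝ) : (chiN N : Cinf n).1 x = ∏ j, (kapC N j).1 x := rfl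

theorem chiN_one (N : ℕ) (x : Fin n → ℝ) (hx : ∀ j, |x j| ≤ N + 1) : (chiN N : Cinf n).1 x = 1 := by
  rw [chiN_apply]; exact Finset.prod_eq_one fun j _ => kapC_one N j x (hx j)

theorem chiN_CS (N : ℕ) (z : Cinf n) : CS ((N:ℝ)+2) (mulC (chiN N) z) := by
  intro x hx
  obtain ⟨j, hj⟩ : ∃ j, (N:ℝ)+2 < |x j| := by
    by_contra! hcon
    refine absurd ((pi_norm_le_iff_of_nonneg (by positivity)).2 (fun j => ?_)) hx.not_ge
    simpa using hcon j
  rw [Cinf.mul_apply, chiN_apply, Finset.prod_eq_zero (Finset.mem_univ j) (kapC_zero N j x hj.le), zero_mul]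

theorem ball_abs {N : ℝ} {x : Fin n → ℝ} (hx : x ∈ Metric.ball (0 : Fin n → ℝ) N) (j) : |x j| < N := by
  rw [mem_ball_zero_iff] at hx
  exact (norm_le_pi_norm x j).trans_lt hx

theorem split_sum (N : ℕ) {R : ℝ} {e : Cinf n} (he : CS R e) (s : Finset (Fin n)) :
    ∃ f : Fin n → Cinf n, (∀ j, CS R (f j)) ∧ (∀ j, ∀ x : Fin n → ℝ, |x j| < N + 1 → (f j).1 x = 0) ∧
      ∀ x, ∑ j ∈ s, (f j).1 x = e.1 x - (∏ j ∈ s, (kapC N j).1 x) * e.1 x := by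
  classical
  induction s using Finset.induction_on with
  | empty => exact ⟨0, fun _ _ _ => rfl, fun _ _ _ => rfl, fun x => by simp⟩
  | insert a s ha ih =>
    obtain ⟨f, h1, h2, h3⟩ := ih
    set p : Cinf n := ⟨fun x => ∏ j ∈ s, (kapC N j).1 x, by
      show ContDiff ℝ (⊤ : ℕ∞) _
      exact contDiff_prod fun j _ => Cinf.contDiff (kapC N j)⟩ with hp
    set g : Cinf n := mulC p e - mulC (mulC (kapC N a) p) e with hg
    have hgx : ∀ x, g.1 x = (∏ j ∈ s, (kapC N j).1 x) * e.1 x - (kapC N a).1 x * (∏ j ∈ s, (kapC N j).1 x) * e.1 x := by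
      intro x; rfl
    refine ⟨Function.update f a g, fun j => ?_, fun j x hx => ?_, fun x => ?_⟩
    · by_cases hj : j = a
      · subst hj; rw [Function.update_self]
        exact (he.mul _).sub (he.mul _)
      · rw [Function.update_of_ne hj]; exact h1 j
    · by_cases hj : j = a
      · subst hj; rw [Function.update_self, hgx, kapC_one N j x hx.le]; ring
      · rw [Function.update_of_ne hj]; exact h2 j x hx
    · rw [Finset.sum_insert ha, Finset.prod_insert ha, Function.update_self, hgx,
        Finset.sum_congr rfl (g := fun j => (f j).1 x), h3]
      · ring
      · intro j hj
        rw [Function.update_of_ne (by rintro rfl; exact ha hj)]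

variable [Module (AA n) (Cinf n)] [GoodMod n]

theorem stage1_local {s : Fin n} {a : AA n} (ha : MonicIn s a) (w : Cinf n) (N : ℕ) :
    ∃ y : Cinf n, ∀ x ∈ Metric.ball (0 : Fin n → ℝ) (N:ℝ), (a • y).1 x = w.1 x := by
  set L : ℝ := 2 * (N + 2) + 1
  have hL : 0 < L := by positivity
  obtain ⟨t, ht⟩ := LB_exists (L := L) (0 : Fin n → ℝ) s (fun _ : Unit => a) (fun _ => ha)
  have hc := ht ()
  set lam := (0 : Fin n → ℝ) + Pi.single s t
  have hcs := chiN_CS N w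
  have hr := Hc_rapid hL lam hcs
  refine ⟨EE L lam (fun k => Hc L lam (mulC (chiN N) w) k / eval (fr L lam k) a), fun x hx => ?_⟩
  have hxa := ball_abs hx
  rw [EE_div hL hc hr, EE_Hc hL (by simp only [L]; linarith) lam hcs, Cinf.mul_apply, chiN_one, one_mul]
  · intro j; linarith [hxa j]
  · intro i
    have := abs_lt.1 (hxa i)
    have hN : (0:ℝ) ≤ N := by positivity
    simp only [L]
    exact ⟨by linarith [this.1], by linarith [this.2]⟩

theorem stage2_local {s last : Fin n} {a b : AA n} {c α β : Fin n → AA n}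
    (ha : MonicIn s a) (ha' : a ∈ supported ℂ ({last}ᶜ : Set (Fin n)))
    (hc : ∀ j, j ≠ last → c j = α j * a + β j * b)
    (hc1 : ∀ j, j ≠ last → c j ∈ supported ℂ ({j}ᶜ : Set (Fin n)))
    (hc2 : ∀ j, j ≠ last → MonicIn last (c j)) (z : Cinf n) (hz : a • z = 0) (N : ℕ) :
    ∃ y : Cinf n, ∀ x ∈ Metric.ball (0 : Fin n → ℝ) (N:ℝ), (a • y).1 x = 0 ∧ (b • y).1 x = z.1 x := by
  classical
  set L : ℝ := 2 * (N + 3) + 1 with hLdef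
  have hL : 0 < L := by positivity
  obtain ⟨t, ht⟩ := LB_exists (L := L) (0 : Fin n → ℝ) s (fun _ : Unit => a) (fun _ => ha)
  obtain ⟨t', ht'⟩ := LB_exists (L := L) ((0 : Fin n → ℝ) + Pi.single s t) last
    (fun j : {j // j ≠ last} => c j) (fun j => hc2 j j.2)
  set lam := (0 : Fin n → ℝ) + Pi.single s t + Pi.single last t'
  have LBa : LB L lam a := (ht ()).congr ha' (by
    intro i hi
    have : i ≠ last := hi
    simp [lam, this])
  have LBc : ∀ j, j ≠ last → LB L lam (c j) := fun j hj => ht' ⟨j, hj⟩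
  set φ := mulC (chiN (N+1)) z with hφ
  have hφcs : CS ((N:ℝ)+3) φ := by
    have := chiN_CS (N+1) z
    push_cast at this
    convert this using 1; ring
  set e := a • φ with he
  have hecs : CS ((N:ℝ)+3) e := hφcs.smul a
  obtain ⟨f, f1, f2, f3⟩ := split_sum N hecs (Finset.univ.erase last)
  have hR : 2 * ((N:ℝ)+3) < L := by rw [hLdef]; linarith
  -- e is the sum
  have hez : ∀ x, (∏ j ∈ Finset.univ.erase last, (kapC N j).1 x) * e.1 x = 0 := by
    intro x
    by_cases hx : ∀ j, j ≠ last → |x j| < N + 2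
    · have hU : IsOpen {x : Fin n → ℝ | ∀ j, j ≠ last → |x j| < N + 2} := by
        simp only [Set.setOf_forall]
        refine isOpen_iInter_of_finite fun j => isOpen_iInter_of_finite fun _ => ?_
        exact isOpen_lt (continuous_apply j).abs continuous_const
      have hz1 : ∀ x ∈ {x : Fin n → ℝ | ∀ j, j ≠ last → |x j| < N + 2}, φ.1 x = (mulC (kapC (N+1) last) z).1 x := by
        intro x hx
        rw [hφ, Cinf.mul_apply, Cinf.mul_apply, chiN_apply, Finset.prod_eq_single last]
        · intro j _ hj
          apply kapC_one
          have := hx j hj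
          push_cast; linarith
        · simp
      have h2 := smul_congr_on hU hz1 a x hx
      rw [he, h2, smul_mul_of_supported (s := ({last}ᶜ : Set (Fin n))) _ ha', hz]
      · simp
      · intro j hj; exact X_smul_kapC _ _ _ hj
    · push Not at hx
      obtain ⟨j, hj, hx⟩ := hx
      rw [Finset.prod_eq_zero (i := j) (by simp [hj]) (kapC_zero N j x hx), zero_mul]
  have hsum : ∑ j ∈ Finset.univ.erase last, f j = e := by
    apply Cinf.ext'; intro x
    rw [Cinf.sum_apply, f3, hez, sub_zero]
  have hr : ∀ j, Rapid L lam (Hc L lam (f j)) := fun j => Hc_rapid hL lam (f1 j)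
  set v : Fin n → Cinf n := fun j => EE L lam
    (fun k => Hc L lam (f j) k / eval (fr L lam k) a / eval (fr L lam k) (c j)) with hv
  have v1 : ∀ j, j ≠ last → c j • v j = EE L lam (fun k => Hc L lam (f j) k / eval (fr L lam k) a) :=
    fun j hj => EE_div hL (LBc j hj) (LBa.rapid hL (hr j))
  have v2 : ∀ j, j ≠ last → a • v j = EE L lam (fun k => Hc L lam (f j) k / eval (fr L lam k) (c j)) := by
    intro j hj
    rw [← EE_div hL LBa ((LBc j hj).rapid hL (hr j))]
    simp only [hv, div_right_comm]
  have hball : ∀ x ∈ Metric.ball (0 : Fin n → ℝ) (N:ℝ), ∀ j, j ≠ last → (a • v j).1 x = 0 := by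
    intro x hx j hj
    rw [v2 j hj]
    refine EE_local hL hR (f1 j) (LBc j hj) j (hc1 j hj) (N := N + 1) (by rw [hLdef]; linarith) (f2 j) x ?_
    linarith [ball_abs hx j]
  have hball' : ∀ x ∈ Metric.ball (0 : Fin n → ℝ) (N:ℝ), ∀ j, j ≠ last → ∀ p : AA n, (p • a • v j).1 x = 0 :=
    fun x hx j hj p => smul_zero_on Metric.isOpen_ball (fun x hx => hball x hx j hj) p x hx
  refine ⟨∑ j ∈ Finset.univ.erase last, β j • v j, fun x hx => ⟨?_, ?_⟩⟩
  · rw [Finset.smul_sum, Cinf.sum_apply]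
    refine Finset.sum_eq_zero fun j hj => ?_
    rw [smul_comm]
    exact hball' x hx j (Finset.ne_of_mem_erase hj) _
  · have h1 : ∀ j ∈ Finset.univ.erase last, (b • β j • v j).1 x =
        (EE L lam (fun k => Hc L lam (f j) k / eval (fr L lam k) a)).1 x := by
      intro j hj
      have hj' := Finset.ne_of_mem_erase hj
      have h2 : b • β j • v j = c j • v j - α j • a • v j := by
        rw [hc j hj', add_smul, mul_smul, mul_smul, add_sub_cancel_left, smul_comm]
      rw [h2, Cinf.sub_apply, hball' x hx j hj', sub_zero, v1 j hj']
    rw [Finset.smul_sum, Cinf.sum_apply, Finset.sum_congr rfl h1, ← Cinf.sum_apply,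
      ← EE_sum _ (fun j _ => LBa.rapid hL (hr j))]
    have h3 : (fun k => ∑ j ∈ Finset.univ.erase last, Hc L lam (f j) k / eval (fr L lam k) a) = Hc L lam φ := by
      ext k
      rw [← Finset.sum_div, ← Hc_sum _ (fun j _ => f1 j), hsum, he, Hc_smul hφcs, mul_div_cancel_right₀ _ (LBa.ne k)]
    have hxa := ball_abs hx
    rw [h3, EE_Hc hL hR lam hφcs, hφ, Cinf.mul_apply, chiN_one, one_mul]
    · intro j; push_cast; linarith [hxa j]
    · intro i
      have := abs_lt.1 (hxa i)
      have hN : (0:ℝ) ≤ N := by positivity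
      rw [hLdef]
      exact ⟨by linarith [this.1], by linarith [this.2]⟩

end stages

set_option autoImplicit false
open MvPolynomial Filter Topology

section bounds
variable {n : ℕ} [Module (AA n) (Cinf n)] [GoodMod n]

/-- bounds for all derivatives on a set -/
def Bdd (U : Set (Fin n → ℝ)) (b : ℕ → ℝ) (f : Cinf n) : Prop :=
  ∀ (m : Fin n →₀ ℕ), ∀ x ∈ U, ‖((monomial m (1:ℂ) : AA n) • f).1 x‖ ≤ b m.degree

theorem Bdd.mono {U : Set (Fin n → ℝ)} {b b' : ℕ → ℝ} {f : Cinf n} (h : Bdd U b f) (hb : ∀ k, b k ≤ b' k) :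
    Bdd U b' f := fun m x hx => (h m x hx).trans (hb _)

theorem Bdd.add {U : Set (Fin n → ℝ)} {b b' : ℕ → ℝ} {f g : Cinf n} (h : Bdd U b f) (h' : Bdd U b' g) :
    Bdd U (fun k => b k + b' k) (f + g) := by
  intro m x hx
  rw [smul_add, Cinf.add_apply]
  exact (norm_add_le _ _).trans (add_le_add (h m x hx) (h' m x hx))

theorem Bdd.sum {U : Set (Fin n → ℝ)} {ι : Type*} (s : Finset ι) {b : ι → ℕ → ℝ} {f : ι → Cinf n}
    (h : ∀ i ∈ s, Bdd U (b i) (f i)) : Bdd U (fun k => ∑ i ∈ s, b i k) (∑ i ∈ s, f i) := by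
  intro m x hx
  rw [Finset.smul_sum, Cinf.sum_apply]
  exact (norm_sum_le _ _).trans (Finset.sum_le_sum fun i hi => h i hi m x hx)

theorem Bdd.csmul {U : Set (Fin n → ℝ)} {b : ℕ → ℝ} {f : Cinf n} (h : Bdd U b f) (c : ℂ) :
    Bdd U (fun k => ‖c‖ * b k) (c • f) := by
  intro m x hx
  rw [smul_csmul, Cinf.csmul_apply, norm_mul]
  exact mul_le_mul_of_nonneg_left (h m x hx) (norm_nonneg _)

def l1 (p : AA n) : ℝ := ∑ m ∈ p.support, ‖coeff m p‖

theorem l1_nonneg (p : AA n) : 0 ≤ l1 p := Finset.sum_nonneg fun _ _ => norm_nonneg _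

theorem Bdd.smul {U : Set (Fin n → ℝ)} {b : ℕ → ℝ} (hb : Monotone b) {f : Cinf n} (h : Bdd U b f)
    (p : AA n) {e : ℕ} (he : p.totalDegree ≤ e) : Bdd U (fun k => l1 p * b (k + e)) (p • f) := by
  intro m x hx
  have h1 : (monomial m (1:ℂ) : AA n) • p • f =
      ∑ m' ∈ p.support, coeff m' p • ((monomial (m + m') (1:ℂ) : AA n) • f) := by
    conv_lhs => rw [p.as_sum]
    rw [Finset.sum_smul, Finset.smul_sum]
    refine Finset.sum_congr rfl fun m' _ => ?_
    rw [smul_smul, monomial_mul, one_mul, monomial_smul]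
  rw [h1, Cinf.sum_apply]
  refine (norm_sum_le _ _).trans ?_
  simp only [l1]
  rw [Finset.sum_mul]
  refine Finset.sum_le_sum fun m' hm' => ?_
  rw [Cinf.csmul_apply, norm_mul]
  refine mul_le_mul_of_nonneg_left ((h _ x hx).trans (hb ?_)) (norm_nonneg _)
  rw [map_add]
  have := le_totalDegree hm'
  rw [Finsupp.degree]
  exact Nat.add_le_add_left (this.trans he) _

theorem Bdd.apply {U : Set (Fin n → ℝ)} {b : ℕ → ℝ} {f : Cinf n} (h : Bdd U b f) {x} (hx : x ∈ U) :
    ‖f.1 x‖ ≤ b 0 := by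
  have := h 0 x hx
  simpa [show (monomial (0 : Fin n →₀ ℕ) (1:ℂ) : AA n) = 1 from rfl] using this

end bounds

/-- factorial growth -/
def gb (r : ℝ) (κ0 : ℕ) (k : ℕ) : ℝ := ((k + κ0).factorial : ℝ) / r ^ k

theorem gb_nonneg {r : ℝ} (hr : 0 < r) (κ0 k : ℕ) : 0 ≤ gb r κ0 k := by unfold gb; positivity

theorem gb_mono {r : ℝ} (hr : 0 < r) {κ0 : ℕ} (h : r ≤ κ0) : Monotone (gb r κ0) := by
  apply monotone_nat_of_le_succ
  intro k
  rw [gb, gb, div_le_div_iff₀ (by positivity) (by positivity), show k + 1 + κ0 = (k + κ0) + 1 by ring,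
    Nat.factorial_succ, pow_succ]
  push_cast
  have : r ≤ k + κ0 + 1 := by have : (0:ℝ) ≤ k := by positivity
                              linarith
  have h2 : (0:ℝ) < (k + κ0).factorial := by positivity
  calc ((k + κ0).factorial : ℝ) * (r ^ k * r) = (((k + κ0).factorial : ℝ) * r ^ k) * r := by ring
    _ ≤ (((k + κ0).factorial : ℝ) * r ^ k) * (k + κ0 + 1) := by gcongr
    _ = _ := by ring

theorem gb_geom {C r : ℝ} (hC : 0 ≤ C) (hr : 0 < r) (h : 4 * C ≤ r) (κ0 W : ℕ) :
    ∃ B, 0 ≤ B ∧ ∀ k, C ^ k * gb r κ0 (k + W) / (k.factorial : ℝ) ≤ B * (1/2)^k := by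
  refine ⟨2 ^ (W + κ0) * ((W + κ0).factorial : ℝ) / r ^ W, by positivity, fun k => ?_⟩
  have h1 : ((k + W + κ0).factorial : ℝ) ≤ 2 ^ (k + W + κ0) * (k.factorial * (W + κ0).factorial) := by
    have := Nat.choose_le_two_pow (k + W + κ0) k
    have h2 := Nat.choose_mul_factorial_mul_factorial (n := k + W + κ0) (k := k) (by omega)
    rw [show k + W + κ0 - k = W + κ0 by omega] at h2
    have h3 : (k + W + κ0).factorial ≤ 2 ^ (k + W + κ0) * (k.factorial * (W + κ0).factorial) := by
      rw [← h2, mul_assoc]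
      exact Nat.mul_le_mul_right _ this
    exact_mod_cast h3
  have h2 : (C / r) ^ k ≤ (1/4)^k := by
    apply pow_le_pow_left₀ (by positivity)
    rw [div_le_iff₀ hr]; linarith
  unfold gb
  calc C ^ k * (((k + W + κ0).factorial : ℝ) / r ^ (k + W)) / (k.factorial : ℝ)
      ≤ C ^ k * ((2 ^ (k + W + κ0) * (k.factorial * (W + κ0).factorial)) / r ^ (k + W)) / (k.factorial : ℝ) := by gcongr
    _ = (2 ^ (W + κ0) * ((W + κ0).factorial : ℝ) / r ^ W) * (2 ^ k * (C / r) ^ k) := by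
        have : (k.factorial : ℝ) ≠ 0 := by positivity
        rw [div_pow]; field_simp; ring
    _ ≤ (2 ^ (W + κ0) * ((W + κ0).factorial : ℝ) / r ^ W) * (2 ^ k * (1/4) ^ k) := by gcongr
    _ = _ := by
      congr 1
      rw [← mul_pow]; norm_num

section evol
variable {n : ℕ} [Module (AA n) (Cinf n)] [GoodMod n] {κ : Type} [Fintype κ]

def MM (M : Matrix κ κ (AA n)) (F : κ → Cinf n) : κ → Cinf n := fun c => ∑ c', M c c' • F c'

theorem MM_add (M : Matrix κ κ (AA n)) (F G : κ → Cinf n) : MM M (F + G) = MM M F + MM M G := by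
  ext1 c; simp [MM, smul_add, Finset.sum_add_distrib]

theorem MM_csmul (M : Matrix κ κ (AA n)) (a : ℂ) (F : κ → Cinf n) : MM M (a • F) = a • MM M F := by
  ext1 c; simp [MM, smul_csmul, Finset.smul_sum]

theorem MM_smul (M : Matrix κ κ (AA n)) (p : AA n) (F : κ → Cinf n) : MM M (p • F) = p • MM M F := by
  ext1 c; simp only [MM, Pi.smul_apply, Finset.smul_sum]
  exact Finset.sum_congr rfl fun c' _ => smul_comm _ _ _

theorem MM_sum (M : Matrix κ κ (AA n)) {ι : Type*} (s : Finset ι) (F : ι → κ → Cinf n) :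
    MM M (∑ i ∈ s, F i) = ∑ i ∈ s, MM M (F i) := by
  classical
  induction s using Finset.induction_on with
  | empty => ext1 c; simp [MM]
  | insert a s ha ih => rw [Finset.sum_insert ha, Finset.sum_insert ha, MM_add, ih]

theorem MM_mul (M M' : Matrix κ κ (AA n)) (F : κ → Cinf n) : MM (M * M') F = MM M (MM M' F) := by
  ext1 c
  simp only [MM, Matrix.mul_apply, Finset.sum_smul, Finset.smul_sum, mul_smul]
  exact Finset.sum_comm

variable (D : Finset (Fin n)) (M : Fin n → Matrix κ κ (AA n))

def LF (σ : Fin n → ℝ) (F : κ → Cinf n) : κ → Cinf n := ∑ i ∈ D, (σ i : ℂ) • MM (M i) F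

theorem LF_add (σ : Fin n → ℝ) (F G : κ → Cinf n) : LF D M σ (F + G) = LF D M σ F + LF D M σ G := by
  simp only [LF, MM_add, smul_add, Finset.sum_add_distrib]

theorem LF_smul (σ : Fin n → ℝ) (p : AA n) (F : κ → Cinf n) : LF D M σ (p • F) = p • LF D M σ F := by
  simp only [LF, MM_smul, Finset.smul_sum]
  refine Finset.sum_congr rfl fun i _ => ?_
  ext1 c; simp [smul_csmul]

theorem LF_sum (σ : Fin n → ℝ) {ι : Type*} (s : Finset ι) (F : ι → κ → Cinf n) :
    LF D M σ (∑ i ∈ s, F i) = ∑ i ∈ s, LF D M σ (F i) := by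
  simp only [LF, MM_sum, Finset.smul_sum]
  exact Finset.sum_comm

theorem LF_csmul (σ : Fin n → ℝ) (a : ℂ) (F : κ → Cinf n) : LF D M σ (a • F) = a • LF D M σ F := by
  simp only [LF, MM_csmul, Finset.smul_sum]
  exact Finset.sum_congr rfl fun i _ => smul_comm _ _ _

theorem LFk_add (σ : Fin n → ℝ) (k : ℕ) (F G : κ → Cinf n) :
    (LF D M σ)^[k] (F + G) = (LF D M σ)^[k] F + (LF D M σ)^[k] G := by
  induction k generalizing F G with
  | zero => rfl
  | succ k ih => rw [Function.iterate_succ_apply, LF_add, ih]; rfl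

theorem LFk_csmul (σ : Fin n → ℝ) (k : ℕ) (a : ℂ) (F : κ → Cinf n) :
    (LF D M σ)^[k] (a • F) = a • (LF D M σ)^[k] F := by
  induction k generalizing F with
  | zero => rfl
  | succ k ih => rw [Function.iterate_succ_apply, LF_csmul, ih]; rfl

theorem LFk_smul (σ : Fin n → ℝ) (k : ℕ) (p : AA n) (F : κ → Cinf n) :
    (LF D M σ)^[k] (p • F) = p • (LF D M σ)^[k] F := by
  induction k generalizing F with
  | zero => rfl
  | succ k ih => rw [Function.iterate_succ_apply, LF_smul, ih]; rfl

theorem LFk_sum (σ : Fin n → ℝ) (k : ℕ) {ι : Type*} (s : Finset ι) (F : ι → κ → Cinf n) :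
    (LF D M σ)^[k] (∑ i ∈ s, F i) = ∑ i ∈ s, (LF D M σ)^[k] (F i) := by
  induction k generalizing F with
  | zero => rfl
  | succ k ih => simp only [Function.iterate_succ_apply, LF_sum, ih]

/-- the total size of the coefficients -/
def CM (N : ℝ) : ℝ := ∑ i ∈ D, N * ∑ c, ∑ c', l1 (M i c c')

theorem CM_nonneg {N : ℝ} (hN : 0 ≤ N) : 0 ≤ CM D M N :=
  Finset.sum_nonneg fun _ _ => mul_nonneg hN (Finset.sum_nonneg fun _ _ => Finset.sum_nonneg fun _ _ => l1_nonneg _)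

theorem LFk_bdd (w : κ → ℕ) (hw : ∀ i ∈ D, ∀ c c', M i c c' ≠ 0 → (M i c c').totalDegree + w c' ≤ w c + 1)
    {N : ℝ} (hN : 0 ≤ N) {σ : Fin n → ℝ} (hσ : ∀ i, |σ i| ≤ N) {U : Set (Fin n → ℝ)} {b : ℕ → ℝ} (hb : Monotone b)
    (hb0 : ∀ k, 0 ≤ b k)
    {F : κ → Cinf n} (hF : ∀ c, Bdd U b (F c)) (k : ℕ) (c : κ) :
    Bdd U (fun j => CM D M N ^ k * b (j + (k + w c))) (((LF D M σ)^[k] F) c) := by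
  induction k generalizing c with
  | zero => exact (hF c).mono fun j => by simpa using hb (by omega)
  | succ k ih =>
    rw [Function.iterate_succ_apply']
    set G := (LF D M σ)^[k] F
    have hCM := CM_nonneg D M hN
    have h1 : ∀ i ∈ D, ∀ c', Bdd U (fun j => l1 (M i c c') * (CM D M N ^ k * b (j + (k + 1 + w c)))) (M i c c' • G c') := by
      intro i hi c'
      by_cases h0 : M i c c' = 0
      · rw [h0, zero_smul]
        intro m x hx
        rw [smul_zero]
        simpa using mul_nonneg (l1_nonneg _) (mul_nonneg (pow_nonneg hCM k) (hb0 _))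
      · refine ((ih c').smul ?_ (M i c c') le_rfl).mono ?_
        · intro j j' hj
          exact mul_le_mul_of_nonneg_left (hb (by omega)) (pow_nonneg hCM k)
        · intro j
          refine mul_le_mul_of_nonneg_left (mul_le_mul_of_nonneg_left (hb ?_) (pow_nonneg hCM k)) (l1_nonneg _)
          have := hw i hi c c' h0
          omega
    have h2 := Bdd.sum D (fun i hi => (Bdd.sum Finset.univ (fun c' _ => h1 i hi c')).csmul (σ i : ℂ))
    have e : LF D M σ G c = ∑ i ∈ D, (σ i : ℂ) • ∑ c', M i c c' • G c' := by
      rw [LF, Finset.sum_apply]; rfl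
    rw [e]
    refine h2.mono fun j => ?_
    simp only [← Finset.sum_mul, ← mul_assoc]
    rw [pow_succ']
    simp only [mul_assoc]
    refine mul_le_mul_of_nonneg_right ?_ (mul_nonneg (pow_nonneg hCM k) (hb0 _))
    unfold CM
    refine Finset.sum_le_sum fun i _ => ?_
    have : ‖(σ i : ℂ)‖ ≤ N := by simpa using hσ i
    refine mul_le_mul this ?_ (Finset.sum_nonneg fun _ _ => l1_nonneg _) hN
    exact Finset.single_le_sum (f := fun c => ∑ c', l1 (M i c c')) (fun c _ => Finset.sum_nonneg fun _ _ => l1_nonneg _) (Finset.mem_univ c)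

end evol

set_option autoImplicit false
open MvPolynomial Filter Topology

section evol2
variable {n : ℕ} (D : Finset (Fin n))

/-- scaling of the coordinates in `D` -/
def iot (θ : ℝ) (x : Fin n → ℝ) : Fin n → ℝ := fun j => if j ∈ D then θ * x j else x j

def iotL (θ : ℝ) : (Fin n → ℝ) →L[ℝ] (Fin n → ℝ) :=
  ContinuousLinearMap.pi fun j => (if j ∈ D then θ else 1) • ContinuousLinearMap.proj j

theorem iotL_apply (θ : ℝ) (x : Fin n → ℝ) : iotL D θ x = iot D θ x := by
  ext j
  simp only [iotL, iot, ContinuousLinearMap.coe_pi', ContinuousLinearMap.smul_apply, ContinuousLinearMap.proj_apply, smul_eq_mul]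
  split_ifs <;> simp

theorem iot_one (x : Fin n → ℝ) : iot D 1 x = x := by
  ext j; simp [iot]

theorem iot_mem {θ : ℝ} (h0 : 0 ≤ θ) (h1 : θ ≤ 1) {N : ℝ} {x : Fin n → ℝ} (hx : x ∈ Metric.ball (0 : Fin n → ℝ) N) :
    iot D θ x ∈ Metric.ball (0 : Fin n → ℝ) N := by
  rw [mem_ball_zero_iff] at hx ⊢
  refine lt_of_le_of_lt ?_ hx
  refine (pi_norm_le_iff_of_nonneg (norm_nonneg _)).2 fun j => ?_
  refine le_trans ?_ (norm_le_pi_norm x j)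
  simp only [iot]
  split_ifs
  · rw [norm_mul, Real.norm_eq_abs θ, abs_of_nonneg h0]
    exact mul_le_of_le_one_left (norm_nonneg _) h1
  · exact le_rfl

def resD (f : Cinf n) : Cinf n := ⟨fun x => f.1 (iotL D 0 x), by
  show ContDiff ℝ (⊤ : ℕ∞) _
  exact (Cinf.contDiff f).comp (iotL D 0).contDiff⟩

theorem resD_apply (f : Cinf n) (x) : (resD D f).1 x = f.1 (iot D 0 x) := by
  rw [← iotL_apply]; rfl

def coord (i : Fin n) : Cinf n := ⟨fun x => (x i : ℂ), by
  show ContDiff ℝ (⊤ : ℕ∞) _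
  exact Complex.ofRealCLM.contDiff.comp (contDiff_apply ℝ ℝ i)⟩

theorem coord_apply (i : Fin n) (x) : (coord i : Cinf n).1 x = (x i : ℂ) := rfl

variable [Module (AA n) (Cinf n)] [GoodMod n]

theorem fderiv_eq_sum (f : Cinf n) (x v : Fin n → ℝ) :
    fderiv ℝ f.1 x v = ∑ i, (v i : ℂ) * ((X i : AA n) • f).1 x := by
  rw [dlin_eq (fderiv ℝ f.1 x), dlin_apply]
  refine Finset.sum_congr rfl fun i _ => ?_
  rw [X_smul_apply]

theorem X_smul_resD_mem (f : Cinf n) {i : Fin n} (hi : i ∈ D) : (X i : AA n) • resD D f = 0 := by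
  apply Cinf.ext'; intro x
  rw [X_smul_apply]
  have h : HasFDerivAt (resD D f).1 ((fderiv ℝ f.1 (iotL D 0 x)).comp (iotL D 0)) x :=
    ((Cinf.differentiable f) _).hasFDerivAt.comp x (iotL D 0).hasFDerivAt
  rw [h.fderiv, ContinuousLinearMap.comp_apply, iotL_apply D 0 (Pi.single i 1)]
  have : iot D 0 (Pi.single i 1 : Fin n → ℝ) = 0 := by
    ext j
    simp only [iot, Pi.zero_apply]
    split_ifs with hj
    · simp
    · rw [Pi.single_eq_of_ne]; rintro rfl; exact hj hi
  rw [this]; simp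

theorem X_smul_resD (f : Cinf n) {i : Fin n} (hi : i ∉ D) : (X i : AA n) • resD D f = resD D ((X i : AA n) • f) := by
  apply Cinf.ext'; intro x
  rw [X_smul_apply]
  have h : HasFDerivAt (resD D f).1 ((fderiv ℝ f.1 (iotL D 0 x)).comp (iotL D 0)) x :=
    ((Cinf.differentiable f) _).hasFDerivAt.comp x (iotL D 0).hasFDerivAt
  rw [h.fderiv, ContinuousLinearMap.comp_apply, iotL_apply D 0 (Pi.single i 1)]
  have : iot D 0 (Pi.single i 1 : Fin n → ℝ) = Pi.single i 1 := by
    ext j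
    simp only [iot]
    split_ifs with hj
    · rw [Pi.single_eq_of_ne]
      · simp
      · rintro rfl; exact hi hj
    · rfl
  rw [this, resD_apply, X_smul_apply, iotL_apply]

theorem smul_resD (f : Cinf n) {q : AA n} (hq : q ∈ supported ℂ ((D : Set (Fin n))ᶜ)) :
    q • resD D f = resD D (q • f) := by
  rw [supported] at hq
  induction hq using Algebra.adjoin_induction generalizing f with
  | mem p hp =>
    obtain ⟨i, hi, rfl⟩ := hp
    exact X_smul_resD D f (by simpa using hi)
  | algebraMap c =>
    rw [algebraMap_eq, C_smul, C_smul]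
    apply Cinf.ext'; intro x; rfl
  | add p q _ _ hp hq =>
    rw [add_smul, add_smul, hp, hq]
    apply Cinf.ext'; intro x; rfl
  | mul p q _ _ hp hq =>
    rw [mul_smul, mul_smul, hq, hp]

theorem hasDerivAt_iot (f : Cinf n) (x : Fin n → ℝ) (θ : ℝ) :
    HasDerivAt (fun θ => f.1 (iot D θ x)) (∑ i ∈ D, (x i : ℂ) * ((X i : AA n) • f).1 (iot D θ x)) θ := by
  have h1 : HasDerivAt (fun θ => iot D θ x) (fun j => if j ∈ D then x j else 0) θ := by
    rw [hasDerivAt_pi]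
    intro j
    simp only [iot]
    split_ifs
    · simpa using (hasDerivAt_id θ).mul_const (x j)
    · exact hasDerivAt_const _ _
  have h2 := ((Cinf.differentiable f) (iot D θ x)).hasFDerivAt.comp_hasDerivAt θ h1
  refine h2.congr_deriv ?_
  rw [fderiv_eq_sum, ← Finset.sum_subset (Finset.subset_univ D)]
  · exact Finset.sum_congr rfl fun i hi => by simp [hi]
  · intro i _ hi; simp [hi]

theorem X_smul_coord (i j : Fin n) : (X i : AA n) • coord j = if i = j then ⟨fun _ => 1, show ContDiff ℝ (⊤ : ℕ∞) _ from contDiff_const⟩ else 0 := by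
  apply Cinf.ext'; intro x
  rw [X_smul_apply]
  have h : HasFDerivAt (coord j : Cinf n).1 (Complex.ofRealCLM.comp (ContinuousLinearMap.proj (R := ℝ) (φ := fun _ : Fin n => ℝ) j)) x :=
    (Complex.ofRealCLM.comp (ContinuousLinearMap.proj (R := ℝ) (φ := fun _ : Fin n => ℝ) j)).hasFDerivAt
  rw [h.fderiv]
  by_cases hij : i = j
  · subst hij; simp
  · simp [hij, Pi.single_apply, Ne.symm hij]

variable {κ : Type} [Fintype κ] (M : Fin n → Matrix κ κ (AA n))

def mulF (i : Fin n) (F : κ → Cinf n) : κ → Cinf n := fun c => mulC (coord i) (F c)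

variable {D M}

theorem mulF_sum_apply {ι : Type*} (s : Finset ι) (i : Fin n) (F : ι → κ → Cinf n) :
    mulF i (∑ j ∈ s, F j) = ∑ j ∈ s, mulF i (F j) := by
  ext1 c; apply Cinf.ext'; intro x
  simp [mulF, Finset.mul_sum]

theorem MM_mulF {i : Fin n} (hi : i ∈ D) {K : Matrix κ κ (AA n)}
    (hK : ∀ c c', K c c' ∈ supported ℂ ((D : Set (Fin n))ᶜ)) (F : κ → Cinf n) :
    MM K (mulF i F) = mulF i (MM K F) := by
  ext1 c
  simp only [MM, mulF]
  have : ∀ c', K c c' • mulC (coord i) (F c') = mulC (coord i) (K c c' • F c') := by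
    intro c'
    apply smul_mul_of_supported _ (hK c c')
    intro j hj
    rw [X_smul_coord, if_neg]
    rintro rfl; exact hj hi
  simp only [this]
  apply Cinf.ext'; intro x; simp [Finset.mul_sum]

theorem X_mulF (i j : Fin n) (F : κ → Cinf n) :
    (X i : AA n) • mulF j F = (if i = j then F else 0) + mulF j ((X i : AA n) • F) := by
  ext1 c
  simp only [mulF, Pi.smul_apply, Pi.add_apply]
  rw [X_smul_mul, X_smul_coord]
  apply Cinf.ext'; intro x
  by_cases h : i = j <;> simp [h]

variable (D M)

def TT (Φ : κ → Cinf n) : ℕ → κ → Cinf n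
  | 0 => fun c => resD D (Φ c)
  | k+1 => ((1:ℂ) / (k+1)) • ∑ i ∈ D, mulF i (MM (M i) (TT Φ k))

variable {D M}

theorem MM_TT (hM : ∀ i ∈ D, ∀ c c', M i c c' ∈ supported ℂ ((D : Set (Fin n))ᶜ)) (Φ : κ → Cinf n) (k : ℕ) {i : Fin n} (hi : i ∈ D) :
    ((k:ℂ)+1) • MM (M i) (TT D M Φ (k+1)) = ∑ j ∈ D, mulF j (MM (M i) (MM (M j) (TT D M Φ k))) := by
  rw [TT, MM_csmul, smul_smul, mul_one_div_cancel (by exact_mod_cast Nat.succ_ne_zero k), one_smul, MM_sum]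
  exact Finset.sum_congr rfl fun j hj => MM_mulF hj (hM i hi) _

theorem X_TT (hM : ∀ i ∈ D, ∀ c c', M i c c' ∈ supported ℂ ((D : Set (Fin n))ᶜ))
    (hcomm : ∀ i ∈ D, ∀ j ∈ D, M i * M j = M j * M i) (Φ : κ → Cinf n) (k : ℕ) {i : Fin n} (hi : i ∈ D) :
    (X i : AA n) • TT D M Φ 0 = 0 ∧ (X i : AA n) • TT D M Φ (k+1) = MM (M i) (TT D M Φ k) := by
  have h0 : (X i : AA n) • TT D M Φ 0 = 0 := by
    ext1 c; exact X_smul_resD_mem D _ hi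
  refine ⟨h0, ?_⟩
  have key : ∀ k, (X i : AA n) • TT D M Φ (k+1) = ((1:ℂ) / (k+1)) • (MM (M i) (TT D M Φ k) +
      ∑ j ∈ D, mulF j (MM (M j) ((X i : AA n) • TT D M Φ k))) := by
    intro k
    rw [TT]
    have e1 : (X i : AA n) • ((1:ℂ) / (k+1)) • ∑ j ∈ D, mulF j (MM (M j) (TT D M Φ k)) =
      ((1:ℂ) / (k+1)) • ∑ j ∈ D, (X i : AA n) • mulF j (MM (M j) (TT D M Φ k)) := by
      ext1 c; simp [smul_csmul, Finset.smul_sum]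
    rw [e1]
    congr 1
    simp only [X_mulF, Finset.sum_add_distrib, MM_smul]
    rw [Finset.sum_ite_eq, if_pos hi]
  induction k with
  | zero =>
    rw [key, h0]
    have : ∀ j, mulF j (MM (M j) (0 : κ → Cinf n)) = 0 := by
      intro j; ext1 c; apply Cinf.ext'; intro x; simp [mulF, MM]
    simp [this]
  | succ k ih =>
    rw [key, ih]
    have : ∑ j ∈ D, mulF j (MM (M j) (MM (M i) (TT D M Φ k))) = ((k:ℂ)+1) • MM (M i) (TT D M Φ (k+1)) := by
      rw [MM_TT hM Φ k hi]
      refine Finset.sum_congr rfl fun j hj => ?_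
      rw [← MM_mul, ← MM_mul, hcomm i hi j hj]
    rw [this]
    nth_rw 1 [← one_smul ℂ (MM (M i) (TT D M Φ (k+1)))]
    rw [← add_smul, smul_smul]
    have h2 : (1:ℂ) / (((k+1 : ℕ):ℂ) + 1) * (1 + (k + 1)) = 1 := by
      push_cast
      rw [one_div, add_comm (1:ℂ)]
      exact inv_mul_cancel₀ (by exact_mod_cast Nat.succ_ne_zero (k+1))
    rw [h2, one_smul]

theorem smul_TT_apply (hM : ∀ i ∈ D, ∀ c c', M i c c' ∈ supported ℂ ((D : Set (Fin n))ᶜ)) (Φ : κ → Cinf n) (k : ℕ) {q : AA n} (hq : q ∈ supported ℂ ((D : Set (Fin n))ᶜ)) (c : κ) (x) :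
    (q • TT D M Φ k c).1 x = (1 / (k.factorial : ℂ)) * (q • (LF D M x)^[k] Φ c).1 (iot D 0 x) := by
  induction k generalizing q c with
  | zero => simp [TT, smul_resD D _ hq, resD_apply]
  | succ k ih =>
    rw [Function.iterate_succ_apply']
    have e1 : (q • TT D M Φ (k+1) c).1 x = ((1:ℂ)/(k+1)) * ∑ i ∈ D, (x i : ℂ) * ∑ c', ((q * M i c c') • TT D M Φ k c').1 x := by
      rw [TT, Pi.smul_apply, smul_csmul, Cinf.csmul_apply, Finset.sum_apply, Finset.smul_sum, Cinf.sum_apply]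
      congr 1
      refine Finset.sum_congr rfl fun i hi => ?_
      rw [mulF, smul_mul_of_supported (s := ((D : Set (Fin n))ᶜ)) _ hq, Cinf.mul_apply, coord_apply]
      · congr 1
        rw [MM, Finset.smul_sum, Cinf.sum_apply]
        simp only [mul_smul]
      · intro j hj
        rw [X_smul_coord, if_neg]
        rintro rfl; exact hj hi
    rw [e1]
    have e2 : ∀ i ∈ D, ∀ c', ((q * M i c c') • TT D M Φ k c').1 x =
        (1 / (k.factorial : ℂ)) * ((q * M i c c') • (LF D M x)^[k] Φ c').1 (iot D 0 x) :=
      fun i hi c' => ih (Subalgebra.mul_mem _ hq (hM i hi c c')) c'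
    rw [Finset.sum_congr rfl (fun i hi => by rw [Finset.sum_congr rfl (fun c' _ => e2 i hi c')])]
    set G := (LF D M x)^[k] Φ
    have e3 : (q • LF D M x G c).1 (iot D 0 x) =
        ∑ i ∈ D, (x i : ℂ) * ∑ c', ((q * M i c c') • G c').1 (iot D 0 x) := by
      rw [LF, Finset.sum_apply, Finset.smul_sum, Cinf.sum_apply]
      refine Finset.sum_congr rfl fun i hi => ?_
      rw [Pi.smul_apply, smul_csmul, Cinf.csmul_apply, MM, Finset.smul_sum, Cinf.sum_apply]
      simp only [mul_smul]
    rw [e3, Nat.factorial_succ]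
    simp only [Finset.mul_sum]
    refine Finset.sum_congr rfl fun i _ => Finset.sum_congr rfl fun c' _ => ?_
    push_cast
    have : (k.factorial : ℂ) ≠ 0 := by exact_mod_cast k.factorial_ne_zero
    have : (k:ℂ)+1 ≠ 0 := by exact_mod_cast Nat.succ_ne_zero k
    field_simp

end evol2

set_option autoImplicit false
open MvPolynomial Filter Topology

section evol3
variable {n : ℕ} {D : Finset (Fin n)} [Module (AA n) (Cinf n)] [GoodMod n]
  {κ : Type} [Fintype κ] {M : Fin n → Matrix κ κ (AA n)}

theorem LFk_est (w : κ → ℕ) (hw : ∀ i ∈ D, ∀ c c', M i c c' ≠ 0 → (M i c c').totalDegree + w c' ≤ w c + 1)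
    {N : ℝ} (hN : 0 ≤ N) {r : ℝ} (hr : 0 < r) (h4 : 4 * CM D M N ≤ r) {κ0 : ℕ} (hκ : r ≤ κ0) (q : AA n) (c : κ) :
    ∃ B, 0 ≤ B ∧ ∀ (σ : Fin n → ℝ), (∀ i, |σ i| ≤ N) → ∀ (U : Set (Fin n → ℝ)) (A : ℝ), 0 ≤ A →
      ∀ F : κ → Cinf n, (∀ c, Bdd U (fun k => A * gb r κ0 k) (F c)) → ∀ x ∈ U, ∀ k : ℕ,
        ‖(q • (LF D M σ)^[k] F c).1 x‖ / (k.factorial : ℝ) ≤ A * (B * (1/2)^k) := by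
  obtain ⟨B, hB, h⟩ := gb_geom (CM_nonneg D M hN) hr h4 κ0 (w c + q.totalDegree)
  refine ⟨l1 q * B, mul_nonneg (l1_nonneg q) hB, fun σ hσ U A hA F hF x hx k => ?_⟩
  have hm : Monotone fun k => A * gb r κ0 k := fun i j hij => mul_le_mul_of_nonneg_left (gb_mono hr hκ hij) hA
  have h1 := LFk_bdd D M w hw hN hσ hm (fun k => mul_nonneg hA (gb_nonneg hr κ0 k)) hF k c
  have h2 := (h1.smul (fun i j hij => mul_le_mul_of_nonneg_left (hm (by omega)) (pow_nonneg (CM_nonneg D M hN) k)) q le_rfl).apply hx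
  have h3 := h k
  have hk : (0:ℝ) < k.factorial := by positivity
  calc _ ≤ (l1 q * (CM D M N ^ k * (A * gb r κ0 (0 + q.totalDegree + (k + w c))))) / (k.factorial : ℝ) := by
        gcongr
    _ = A * (l1 q * (CM D M N ^ k * gb r κ0 (k + (w c + q.totalDegree)) / (k.factorial : ℝ))) := by
        rw [show 0 + q.totalDegree + (k + w c) = k + (w c + q.totalDegree) by ring]; ring
    _ ≤ A * (l1 q * (B * (1/2)^k)) := by
        refine mul_le_mul_of_nonneg_left (mul_le_mul_of_nonneg_left h3 (l1_nonneg q)) hA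
    _ = _ := by ring

/-- entire bounds -/
def EntB (Φ : κ → Cinf n) : Prop := ∀ r : ℝ, 0 < r → ∃ A, 0 ≤ A ∧ ∀ c, Bdd Set.univ (fun k => A * gb r 0 k) (Φ c)

theorem gb_shift {r : ℝ} (hr : 0 < r) (κ0 k : ℕ) : gb r 0 k ≤ gb r κ0 k := by
  unfold gb
  gcongr
  omega

theorem TT_decay (hM : ∀ i ∈ D, ∀ c c', M i c c' ∈ supported ℂ ((D : Set (Fin n))ᶜ))
    (hcomm : ∀ i ∈ D, ∀ j ∈ D, M i * M j = M j * M i)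
    (w : κ → ℕ) (hw : ∀ i ∈ D, ∀ c c', M i c c' ≠ 0 → (M i c c').totalDegree + w c' ≤ w c + 1)
    {Φ : κ → Cinf n} (hΦ : EntB Φ) (N : ℕ) (p : AA n) : ∀ (q : AA n), q ∈ supported ℂ ((D : Set (Fin n))ᶜ) → ∀ c : κ,
    ∃ C : ℝ, ∃ k0 : ℕ, ∀ k ≥ k0, ∀ x ∈ Metric.ball (0 : Fin n → ℝ) (N:ℝ),
      ‖((p * q) • TT D M Φ k c).1 x‖ ≤ C * (1/2)^k := by
  have hN : (0:ℝ) ≤ N := by positivity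
  induction p using act_induction with
  | h1 =>
    intro q hq c
    set r : ℝ := 4 * CM D M N + 1
    have hr : 0 < r := by have := CM_nonneg D M hN; positivity
    obtain ⟨B, hB, h⟩ := LFk_est (D := D) (M := M) w hw hN hr (by simp only [r]; linarith) (Nat.le_ceil r) q c
    obtain ⟨A, hA, hΦ⟩ := hΦ r hr
    refine ⟨A * B, 0, fun k _ x hx => ?_⟩
    have := h x (fun i => (ball_abs hx i).le) Set.univ A hA Φ
      (fun c => (hΦ c).mono fun k => mul_le_mul_of_nonneg_left (gb_shift hr _ k) hA) (iot D 0 x) trivial k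
    rw [one_mul, smul_TT_apply hM Φ k hq, norm_mul, mul_assoc, norm_div, norm_one, Complex.norm_natCast]
    rwa [one_div_mul_eq_div]
  | hadd p p' hp hp' =>
    intro q hq c
    obtain ⟨C, k0, h⟩ := hp q hq c
    obtain ⟨C', k0', h'⟩ := hp' q hq c
    refine ⟨C + C', max k0 k0', fun k hk x hx => ?_⟩
    rw [add_mul, add_smul, Cinf.add_apply, add_mul]
    exact (norm_add_le _ _).trans (add_le_add (h k (by omega) x hx) (h' k (by omega) x hx))
  | hC a p hp =>
    intro q hq c
    obtain ⟨C, k0, h⟩ := hp q hq c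
    refine ⟨‖a‖ * C, k0, fun k hk x hx => ?_⟩
    rw [mul_assoc, C_mul_smul, Cinf.csmul_apply, norm_mul, mul_assoc]
    exact mul_le_mul_of_nonneg_left (h k hk x hx) (norm_nonneg _)
  | hXm i p hp =>
    intro q hq c
    by_cases hi : i ∈ D
    · have h1 := fun c' => hp (q * M i c c') (Subalgebra.mul_mem _ hq (hM i hi c c')) c'
      choose C k0 h using h1
      refine ⟨∑ c', 2 * C c', (∑ c', k0 c') + 1, fun k hk x hx => ?_⟩
      obtain ⟨k, rfl⟩ : ∃ k', k = k' + 1 := ⟨k - 1, by omega⟩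
      have hX := congrFun (X_TT hM hcomm Φ k hi).2 c
      rw [Pi.smul_apply] at hX
      rw [show X i * p * q = (p * q) * X i by ring, mul_smul, hX, MM, Finset.smul_sum, Cinf.sum_apply, Finset.sum_mul]
      refine (norm_sum_le _ _).trans (Finset.sum_le_sum fun c' _ => ?_)
      have hk' : k0 c' ≤ k := by
        have := Finset.single_le_sum (f := k0) (fun _ _ => Nat.zero_le _) (Finset.mem_univ c')
        omega
      have := h c' k hk' x hx
      rw [smul_smul, mul_assoc]
      refine this.trans (le_of_eq ?_)
      rw [pow_succ]; ring
    · obtain ⟨C, k0, h⟩ := hp (X i * q) (Subalgebra.mul_mem _ (X_mem_supported.2 (by simpa using hi)) hq) c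
      refine ⟨C, k0, fun k hk x hx => ?_⟩
      have := h k hk x hx
      rwa [show X i * p * q = p * (X i * q) by ring]

theorem exists_V (hM : ∀ i ∈ D, ∀ c c', M i c c' ∈ supported ℂ ((D : Set (Fin n))ᶜ))
    (hcomm : ∀ i ∈ D, ∀ j ∈ D, M i * M j = M j * M i)
    (w : κ → ℕ) (hw : ∀ i ∈ D, ∀ c c', M i c c' ≠ 0 → (M i c c').totalDegree + w c' ≤ w c + 1)
    {Φ : κ → Cinf n} (hΦ : EntB Φ) : ∃ V : κ → Cinf n, (∀ i ∈ D, ∀ c, (X i : AA n) • V c = ∑ c', M i c c' • V c') ∧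
      ∀ (p : AA n) c x, Tendsto (fun K => (p • ∑ k ∈ Finset.range K, TT D M Φ k c).1 x) atTop (𝓝 ((p • V c).1 x)) := by
  have h1 : ∀ c, ∃ V : Cinf n, ∀ (p : AA n) x,
      Tendsto (fun K => (p • ∑ k ∈ Finset.range K, TT D M Φ k c).1 x) atTop (𝓝 ((p • V).1 x)) := by
    intro c
    apply cinf_limit
    intro p N
    obtain ⟨C, k0, h⟩ := TT_decay hM hcomm w hw hΦ N p 1 (Subalgebra.one_mem _) c
    apply ucs_of_geom (C := C) (k0 := k0)
    intro k hk x hx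
    rw [Finset.sum_range_succ, smul_add, Cinf.add_apply, add_sub_cancel_left]
    simpa using h k hk x hx
  choose V hV using h1
  refine ⟨V, fun i hi c => ?_, fun p c x => hV c p x⟩
  apply Cinf.ext'; intro x
  have h2 := (hV c (X i) x).comp (tendsto_add_atTop_nat 1)
  refine tendsto_nhds_unique h2 ?_
  rw [Cinf.sum_apply]
  refine (tendsto_finsetSum _ fun c' _ => hV c' (M i c c') x).congr fun K => ?_
  rw [Function.comp_apply, Finset.sum_range_succ', smul_add, ← Cinf.sum_apply]
  have e0 : (X i : AA n) • TT D M Φ 0 c = 0 := congrFun (X_TT hM hcomm Φ 0 hi).1 c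
  have e1 : ∀ k, (X i : AA n) • TT D M Φ (k+1) c = ∑ c', M i c c' • TT D M Φ k c' :=
    fun k => congrFun (X_TT hM hcomm Φ k hi).2 c
  rw [e0, add_zero, Finset.smul_sum]
  simp only [e1, Finset.smul_sum]
  rw [Finset.sum_comm]

theorem LF_transport (σ : Fin n → ℝ) (Φ : κ → Cinf n) (q : AA n) (c : κ) (k : ℕ) (y) :
    ∑ i ∈ D, (σ i : ℂ) * ((X i : AA n) • q • (LF D M σ)^[k] Φ c).1 y =
      (q • (LF D M σ)^[k+1] Φ c).1 y +
      (q • (LF D M σ)^[k] (∑ i ∈ D, (σ i : ℂ) • ((X i : AA n) • Φ - MM (M i) Φ)) c).1 y := by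
  have h1 : ∑ i ∈ D, (σ i : ℂ) • ((X i : AA n) • Φ) = LF D M σ Φ + ∑ i ∈ D, (σ i : ℂ) • ((X i : AA n) • Φ - MM (M i) Φ) := by
    rw [LF, ← Finset.sum_add_distrib]
    refine Finset.sum_congr rfl fun i _ => ?_
    rw [← smul_add, add_sub_cancel]
  have h2 := congrArg (fun F => (q • (LF D M σ)^[k] F c).1 y) h1
  simp only [LFk_add, ← Function.iterate_succ_apply, Pi.add_apply, smul_add, Cinf.add_apply] at h2
  rw [← h2, LFk_sum, Finset.sum_apply, Finset.smul_sum, Cinf.sum_apply]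
  refine Finset.sum_congr rfl fun i _ => ?_
  rw [LFk_csmul, LFk_smul, Pi.smul_apply, smul_csmul, Cinf.csmul_apply, Pi.smul_apply, smul_comm]

def aco (k : ℕ) (θ : ℝ) : ℂ := (((1 - θ) ^ k / (k.factorial : ℝ) : ℝ) : ℂ)

theorem aco_deriv (k : ℕ) (θ : ℝ) : HasDerivAt (aco (k+1)) (-aco k θ) θ := by
  have h : HasDerivAt (fun θ : ℝ => (1 - θ) ^ (k+1) / ((k+1).factorial : ℝ)) (-((1 - θ) ^ k / (k.factorial : ℝ))) θ := by
    have := (((hasDerivAt_id θ).const_sub 1).pow (k+1)).div_const ((k+1).factorial : ℝ)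
    refine this.congr_deriv ?_
    rw [Nat.factorial_succ]
    have h1 : (k.factorial : ℝ) ≠ 0 := by positivity
    have h2 : (k:ℝ) + 1 ≠ 0 := by positivity
    push_cast
    simp only [id, Nat.add_sub_cancel]
    field_simp
  have := h.ofReal_comp
  refine this.congr_deriv ?_
  simp [aco]

theorem norm_aco_le (k : ℕ) {θ : ℝ} (h0 : 0 ≤ θ) (h1 : θ ≤ 1) : ‖aco k θ‖ ≤ 1 / (k.factorial : ℝ) := by
  rw [aco, Complex.norm_real, Real.norm_eq_abs, abs_of_nonneg (div_nonneg (pow_nonneg (by linarith) k) (by positivity))]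
  gcongr
  exact pow_le_one₀ (by linarith) (by linarith)

theorem duhamel_deriv (x : Fin n → ℝ) (Φ : κ → Cinf n) (q : AA n) (c : κ) (K : ℕ) (θ : ℝ) :
    HasDerivAt (fun θ => ∑ k ∈ Finset.range (K+1), aco k θ * (q • (LF D M x)^[k] Φ c).1 (iot D θ x))
      (aco K θ * (q • (LF D M x)^[K+1] Φ c).1 (iot D θ x) + ∑ k ∈ Finset.range (K+1), aco k θ *
        (q • (LF D M x)^[k] (∑ i ∈ D, (x i : ℂ) • ((X i : AA n) • Φ - MM (M i) Φ)) c).1 (iot D θ x)) θ := by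
  have hb : ∀ k, HasDerivAt (fun θ => (q • (LF D M x)^[k] Φ c).1 (iot D θ x)) _ θ :=
    fun k => hasDerivAt_iot D (q • (LF D M x)^[k] Φ c) x θ
  simp only [LF_transport] at hb
  induction K with
  | zero =>
    have := hb 0
    simpa [aco] using this
  | succ K ih =>
    have := ih.add ((aco_deriv K θ).mul (hb (K+1)))
    have e : (fun θ => ∑ k ∈ Finset.range (K+1+1), aco k θ * (q • (LF D M x)^[k] Φ c).1 (iot D θ x)) =
      (fun θ => ∑ k ∈ Finset.range (K+1), aco k θ * (q • (LF D M x)^[k] Φ c).1 (iot D θ x)) +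
      (aco (K+1) * fun θ => (q • (LF D M x)^[K+1] Φ c).1 (iot D θ x)) := by
      ext θ; rw [Finset.sum_range_succ]; rfl
    rw [e]
    refine this.congr_deriv ?_
    rw [Finset.sum_range_succ _ (K+1)]
    ring

set_option maxHeartbeats 1000000 in
theorem duhamel_est (hM : ∀ i ∈ D, ∀ c c', M i c c' ∈ supported ℂ ((D : Set (Fin n))ᶜ))
    (w : κ → ℕ) (hw : ∀ i ∈ D, ∀ c c', M i c c' ≠ 0 → (M i c c').totalDegree + w c' ≤ w c + 1)
    (N : ℕ) {r : ℝ} (hr : 0 < r) (h4 : 4 * CM D M N ≤ r) (q : AA n) (hq : q ∈ supported ℂ ((D : Set (Fin n))ᶜ)) (c : κ) :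
    ∃ B, 0 ≤ B ∧ ∀ (Φ V : κ → Cinf n), EntB Φ →
      (∀ (p : AA n) c x, Tendsto (fun K => (p • ∑ k ∈ Finset.range K, TT D M Φ k c).1 x) atTop (𝓝 ((p • V c).1 x))) →
      ∀ η, 0 ≤ η → (∀ i ∈ D, ∀ c, Bdd (Metric.ball (0 : Fin n → ℝ) (N:ℝ)) (fun k => η * gb r 0 k)
        ((X i : AA n) • Φ c - ∑ c', M i c c' • Φ c')) →
      ∀ x ∈ Metric.ball (0 : Fin n → ℝ) (N:ℝ), ‖(q • Φ c - q • V c).1 x‖ ≤ η * B := by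
  have hN : (0:ℝ) ≤ N := by positivity
  obtain ⟨B, hB, hest⟩ := LFk_est (D := D) (M := M) w hw hN hr h4 (Nat.le_ceil r) q c
  refine ⟨2 * (D.card * N) * B, by positivity, fun Φ V hΦ hV η hη hE x hx => ?_⟩
  obtain ⟨A, hA, hΦ⟩ := hΦ r hr
  set ê : κ → Cinf n := ∑ i ∈ D, (x i : ℂ) • ((X i : AA n) • Φ - MM (M i) Φ) with hê
  have hxN : ∀ i, |x i| ≤ N := fun i => (ball_abs hx i).le
  have hêB : ∀ c, Bdd (Metric.ball (0 : Fin n → ℝ) (N:ℝ)) (fun k => (D.card * N * η) * gb r ⌈r⌉₊ k) (ê c) := by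
    intro c
    have e : ê c = ∑ i ∈ D, (x i : ℂ) • ((X i : AA n) • Φ c - ∑ c', M i c c' • Φ c') := by
      rw [hê, Finset.sum_apply]; rfl
    rw [e]
    refine (Bdd.sum D fun i hi => (hE i hi c).csmul (x i : ℂ)).mono fun k => ?_
    have h1 : ∀ i ∈ D, ‖(x i : ℂ)‖ * (η * gb r 0 k) ≤ N * (η * gb r ⌈r⌉₊ k) := by
      intro i _
      have : ‖(x i : ℂ)‖ ≤ N := by simpa using hxN i
      exact mul_le_mul this (mul_le_mul_of_nonneg_left (gb_shift hr _ k) hη) (mul_nonneg hη (gb_nonneg hr _ _)) hN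
    refine (Finset.sum_le_sum h1).trans (le_of_eq ?_)
    rw [Finset.sum_const, nsmul_eq_mul]; ring
  have hF := hest x hxN Set.univ A hA Φ (fun c => (hΦ c).mono fun k => mul_le_mul_of_nonneg_left (gb_shift hr _ k) hA)
  have hEe := hest x hxN (Metric.ball (0 : Fin n → ℝ) (N:ℝ)) (D.card * N * η) (by positivity) ê hêB
  have key : ∀ K : ℕ, ‖(q • Φ c).1 x - (q • ∑ k ∈ Finset.range (K+1), TT D M Φ k c).1 x‖ ≤
      ((K+1:ℕ):ℝ) * (1/2)^(K+1) * (A * B) + η * (2 * (D.card * N) * B) := by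
    intro K
    have hd := fun θ => duhamel_deriv (D := D) (M := M) x Φ q c K θ
    have hbd : ∀ θ ∈ Set.Ico (0:ℝ) 1, ‖aco K θ * (q • (LF D M x)^[K+1] Φ c).1 (iot D θ x) + ∑ k ∈ Finset.range (K+1), aco k θ *
        (q • (LF D M x)^[k] ê c).1 (iot D θ x)‖ ≤ ((K+1:ℕ):ℝ) * (1/2)^(K+1) * (A * B) + η * (2 * (D.card * N) * B) := by
      intro θ hθ
      refine (norm_add_le _ _).trans (add_le_add ?_ ?_)
      · rw [norm_mul]
        have h1 := hF (iot D θ x) trivial (K+1)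
        have h2 : ‖aco K θ‖ ≤ ((K+1:ℕ):ℝ) / ((K+1).factorial : ℝ) := by
          refine (norm_aco_le K hθ.1 hθ.2.le).trans (le_of_eq ?_)
          rw [Nat.factorial_succ]
          push_cast
          have : (K.factorial : ℝ) ≠ 0 := by positivity
          have : (K:ℝ) + 1 ≠ 0 := by positivity
          field_simp
        calc _ ≤ ((K+1:ℕ):ℝ) / ((K+1).factorial : ℝ) * ‖(q • (LF D M x)^[K+1] Φ c).1 (iot D θ x)‖ := by gcongr
          _ = ((K+1:ℕ):ℝ) * (‖(q • (LF D M x)^[K+1] Φ c).1 (iot D θ x)‖ / ((K+1).factorial : ℝ)) := by ring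
          _ ≤ ((K+1:ℕ):ℝ) * (A * (B * (1/2)^(K+1))) := by gcongr
          _ = _ := by ring
      · refine (norm_sum_le _ _).trans ?_
        have h1 : ∀ k ∈ Finset.range (K+1), ‖aco k θ * (q • (LF D M x)^[k] ê c).1 (iot D θ x)‖ ≤
            D.card * N * η * (B * (1/2)^k) := by
          intro k _
          refine le_trans ?_ (hEe (iot D θ x) (iot_mem D hθ.1 hθ.2.le hx) k)
          rw [norm_mul, div_eq_mul_one_div, mul_comm]
          exact mul_le_mul_of_nonneg_left (norm_aco_le k hθ.1 hθ.2.le) (norm_nonneg _)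
        refine (Finset.sum_le_sum h1).trans ?_
        rw [← Finset.mul_sum, ← Finset.mul_sum]
        have h2 : ∑ k ∈ Finset.range (K+1), (1/2 : ℝ)^k ≤ 2 := by
          have := Summable.sum_le_tsum (Finset.range (K+1)) (fun k _ => by positivity) summable_geometric_two
          rwa [tsum_geometric_two] at this
        calc _ ≤ D.card * N * η * (B * 2) := by gcongr
          _ = _ := by ring
    have hmv := norm_image_sub_le_of_norm_deriv_le_segment_01' (fun θ _ => (hd θ).hasDerivWithinAt) hbd
    have e1 : ∑ k ∈ Finset.range (K+1), aco k 1 * (q • (LF D M x)^[k] Φ c).1 (iot D 1 x) = (q • Φ c).1 x := by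
      rw [Finset.sum_eq_single 0]
      · simp [aco, iot_one]
      · intro k _ hk; simp [aco, hk]
      · simp
    have e0 : ∑ k ∈ Finset.range (K+1), aco k 0 * (q • (LF D M x)^[k] Φ c).1 (iot D 0 x) =
        (q • ∑ k ∈ Finset.range (K+1), TT D M Φ k c).1 x := by
      rw [Finset.smul_sum, Cinf.sum_apply]
      refine Finset.sum_congr rfl fun k _ => ?_
      rw [smul_TT_apply hM Φ k hq]
      simp [aco]
    simp only [e1, e0] at hmv
    exact hmv
  have t1 : Tendsto (fun K : ℕ => ‖(q • Φ c).1 x - (q • ∑ k ∈ Finset.range (K+1), TT D M Φ k c).1 x‖) atTop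
      (𝓝 ‖(q • Φ c).1 x - (q • V c).1 x‖) :=
    (tendsto_const_nhds.sub ((hV q c x).comp (tendsto_add_atTop_nat 1))).norm
  have t2 : Tendsto (fun K : ℕ => ((K+1:ℕ):ℝ) * (1/2)^(K+1) * (A * B) + η * (2 * (D.card * N) * B)) atTop
      (𝓝 (0 * (A * B) + η * (2 * (D.card * N) * B))) := by
    refine Tendsto.add (Tendsto.mul_const _ ?_) tendsto_const_nhds
    have := tendsto_self_mul_const_pow_of_lt_one (r := 1/2) (by norm_num) (by norm_num)
    exact this.comp (tendsto_add_atTop_nat 1)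
  have := le_of_tendsto_of_tendsto' t1 t2 key
  rw [Cinf.sub_apply]
  simpa using this

end evol3

set_option autoImplicit false
open MvPolynomial Filter Topology

section convol
variable {n : ℕ} [Module (AA n) (Cinf n)] [GoodMod n]

/-- reflected translate -/
def rfl' (x : Fin n → ℝ) (φ : Cinf n) : Cinf n :=
  ⟨fun t => φ.1 (x - t), show ContDiff ℝ (⊤ : ℕ∞) _ from
    (Cinf.contDiff φ).comp (contDiff_const.sub contDiff_id)⟩

theorem rfl'_apply (x : Fin n → ℝ) (φ : Cinf n) (t) : (rfl' x φ).1 t = φ.1 (x - t) := rfl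

theorem CS.rfl' {R : ℝ} {φ : Cinf n} (h : CS R φ) (x : Fin n → ℝ) : CS (R + ‖x‖) (rfl' x φ) := by
  intro t ht
  rw [rfl'_apply]
  apply h
  have := norm_sub_norm_le t x
  rw [norm_sub_rev] at this
  linarith

theorem X_smul_rfl' (x : Fin n → ℝ) (φ : Cinf n) (i : Fin n) :
    (X i : AA n) • rfl' x φ = - rfl' x ((X i : AA n) • φ) := by
  apply Cinf.ext'
  intro t
  refine X_smul_of_hasFDerivAt _ _ (fun j => - ((X j : AA n) • φ).1 (x - t)) ?_ i
  have h1 : HasFDerivAt (fun t : Fin n → ℝ => x - t) (-(ContinuousLinearMap.id ℝ (Fin n → ℝ))) t :=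
    (hasFDerivAt_id t).const_sub x
  have h2 := (Cinf.hasFDerivAt φ (x - t)).comp t h1
  refine HasFDerivAt.congr_fderiv h2 ?_
  ext y
  simp [dlin_apply]

theorem conv_exists (K : Cinf n) {R : ℝ} {φ : Cinf n} (h : CS R φ) :
    ∃ u : Cinf n, ∀ (p : AA n) x, (p • u).1 x = ∫ t, K.1 t * (p • φ).1 (x - t) := by
  have hintg (p : AA n) (x : Fin n → ℝ) : MeasureTheory.Integrable fun t => K.1 t * (p • φ).1 (x - t) :=
    ((h.smul p).rfl' x).integrable K
  refine family_cinf _ ?_ ?_ ?_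
  · intro p q x
    rw [← MeasureTheory.integral_add (hintg p x) (hintg q x)]
    congr 1; ext t
    simp [add_smul, mul_add]
  · intro c p x
    rw [← MeasureTheory.integral_const_mul]
    congr 1; ext t
    simp [mul_smul]; ring
  · intro p x
    have hL : MeasureTheory.LocallyIntegrable K.1 (MeasureTheory.volume : MeasureTheory.Measure (Fin n → ℝ)) :=
      (Cinf.continuous K).locallyIntegrable
    have hc : HasCompactSupport (p • φ).1 := (h.smul p).hcs
    have h1 := hc.hasFDerivAt_convolution_right (𝕜 := ℝ) (ContinuousLinearMap.mul ℝ ℂ) hL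
      ((Cinf.contDiff (p • φ)).of_le (by exact_mod_cast le_top)) x
    refine HasFDerivAt.congr_fderiv h1 ?_
    rw [dlin_eq (MeasureTheory.convolution _ _ _ _ _)]
    congr 1
    ext j
    rw [MeasureTheory.convolution_precompR_apply _ hL (hc.fderiv ℝ)
      ((Cinf.contDiff (p • φ)).continuous_fderiv (by simp))]
    simp only [MeasureTheory.convolution, ContinuousLinearMap.mul_apply', mul_smul, X_smul_apply]

theorem conv_ibp (K : Cinf n) {R : ℝ} {φ : Cinf n} (h : CS R φ) (p : AA n) (x) :
    ∫ t, K.1 t * (p • φ).1 (x - t) = ∫ t, (p • K).1 t * φ.1 (x - t) := by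
  have hintg (K : Cinf n) {R : ℝ} {φ : Cinf n} (h : CS R φ) (x : Fin n → ℝ) :
    MeasureTheory.Integrable fun t => K.1 t * φ.1 (x - t) :=
    (h.rfl' x).integrable K
  induction p using act_induction generalizing K with
  | h1 => simp
  | hadd p q hp hq =>
    simp only [add_smul, Cinf.add_apply, mul_add, add_mul]
    rw [MeasureTheory.integral_add, MeasureTheory.integral_add, hp, hq]
    · exact hintg _ h x
    · exact hintg _ h x
    · exact hintg _ (h.smul _) x
    · exact hintg _ (h.smul _) x
  | hC c p hp =>
    simp only [mul_smul, C_smul, Cinf.csmul_apply, mul_left_comm _ c, mul_assoc]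
    rw [MeasureTheory.integral_const_mul, MeasureTheory.integral_const_mul, hp]
  | hXm i p hp =>
    have hX' (f : Cinf n) (x) : fderiv ℝ f.1 x (Pi.single i 1) = ((X i : AA n) • f).1 x := by
      rw [X_smul_apply]
    have h' : CS (R + ‖x‖) (rfl' x (p • φ)) := (h.smul p).rfl' x
    have key := integral_mul_fderiv_eq_neg_fderiv_mul_of_integrable (μ := MeasureTheory.volume) (f := K.1)
      (g := (rfl' x (p • φ)).1)
      (v := Pi.single i 1) (by simp only [hX']; exact h'.integrable _)
      (by simp only [hX']; exact (h'.smul _).integrable _) (h'.integrable _)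
      (fun x _ => Cinf.differentiable _ x) (fun x _ => Cinf.differentiable _ x)
    simp only [hX', X_smul_rfl', Cinf.neg_apply, rfl'_apply, mul_neg, MeasureTheory.integral_neg, neg_inj] at key
    rw [mul_comm (X i) p, mul_smul p (X i) K, ← hp, mul_comm p, ← key]
    simp only [mul_smul]

end convol

set_option autoImplicit false
open MvPolynomial Filter Topology

section gauss
variable {n : ℕ}

def gF (ν : ℝ) (z : ℂ) : ℂ := Complex.exp (-(ν:ℂ) * z^2)

theorem gF_contDiff (ν : ℝ) (k : WithTop ℕ∞) : ContDiff ℂ k (gF ν) := by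
  unfold gF; fun_prop

def gE (ν : ℝ) (m : ℕ) (x : ℝ) : ℂ := iteratedDeriv m (gF ν) (x : ℂ)

theorem gE_hasDerivAt (ν : ℝ) (m : ℕ) (x : ℝ) : HasDerivAt (gE ν m) (gE ν (m+1) x) x := by
  have h : HasDerivAt (iteratedDeriv m (gF ν)) (iteratedDeriv (m+1) (gF ν) (x:ℂ)) (x:ℂ) := by
    rw [iteratedDeriv_succ]
    exact ((gF_contDiff ν ⊤).differentiable_iteratedDeriv m (WithTop.coe_lt_top _) _).hasDerivAt
  exact h.comp_ofReal

theorem gE_zero (ν x : ℝ) : gE ν 0 x = (Real.exp (-ν * x^2) : ℝ) := by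
  simp [gE, gF]

theorem gE_bound {ν : ℝ} (hν : 0 ≤ ν) {r : ℝ} (hr : 0 < r) (m : ℕ) (x : ℝ) :
    ‖gE ν m x‖ ≤ m.factorial * Real.exp (ν * r^2 - ν * (max (|x| - r) 0)^2) / r^m := by
  refine Complex.norm_iteratedDeriv_le_of_forall_mem_sphere_norm_le m hr
    ((gF_contDiff ν 1).differentiable (by simp)).diffContOnCl fun z hz => ?_
  rw [gF, Complex.norm_exp]
  apply Real.exp_le_exp.2
  have h1 : (-(ν:ℂ) * z^2).re = -ν * (z.re^2 - z.im^2) := by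
    simp [pow_two]
  rw [h1]
  have hz' : ‖z - x‖ = r := by simpa [dist_eq_norm] using hz
  have him : |z.im| ≤ r := by
    have := Complex.abs_im_le_norm (z - x)
    simpa [hz'] using this
  have hre : |z.re - x| ≤ r := by
    have := Complex.abs_re_le_norm (z - x)
    simpa [hz'] using this
  have h2 : max (|x| - r) 0 ≤ |z.re| := by
    apply max_le _ (abs_nonneg _)
    have := abs_sub_abs_le_abs_sub x z.re
    rw [abs_sub_comm] at this
    linarith
  have h3 : (max (|x| - r) 0)^2 ≤ z.re^2 := by
    rw [← sq_abs z.re]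
    exact pow_le_pow_left₀ (le_max_right _ _) h2 2
  have h4 : z.im^2 ≤ r^2 := by
    rw [← sq_abs z.im]
    exact pow_le_pow_left₀ (abs_nonneg _) him 2
  nlinarith

def GGf (ν : ℝ) (m : Fin n →₀ ℕ) (x : Fin n → ℝ) : ℂ := ∏ j, gE ν (m j) (x j)

theorem GGf_hasFDerivAt (ν : ℝ) (m : Fin n →₀ ℕ) (x : Fin n → ℝ) :
    HasFDerivAt (GGf ν m) (dlin fun j => GGf ν (m + Finsupp.single j 1) x) x := by
  classical
  have h (j : Fin n) : HasFDerivAt (fun x : Fin n → ℝ => gE ν (m j) (x j))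
      ((ContinuousLinearMap.proj j : (Fin n → ℝ) →L[ℝ] ℝ).smulRight (gE ν (m j + 1) (x j))) x := by
    have h1 := (gE_hasDerivAt ν (m j) (x j)).hasFDerivAt
    have h2 : HasFDerivAt (fun x : Fin n → ℝ => x j) (ContinuousLinearMap.proj j : (Fin n → ℝ) →L[ℝ] ℝ) x :=
      (ContinuousLinearMap.proj j : (Fin n → ℝ) →L[ℝ] ℝ).hasFDerivAt
    refine HasFDerivAt.congr_fderiv (HasFDerivAt.comp (g := gE ν (m j)) x h1 h2) ?_
    ext y; simp
  have h3 := HasFDerivAt.finsetProd (u := Finset.univ) (x := x) (fun j _ => h j)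
  refine HasFDerivAt.congr_fderiv h3 ?_
  ext y
  rw [dlin_apply]
  simp only [ContinuousLinearMap.sum_apply, ContinuousLinearMap.smul_apply, ContinuousLinearMap.smulRight_apply,
    ContinuousLinearMap.proj_apply, smul_eq_mul, Complex.real_smul]
  refine Finset.sum_congr rfl fun j _ => ?_
  rw [GGf, ← Finset.mul_prod_erase _ _ (Finset.mem_univ j)]
  simp only [Finsupp.add_apply, Finsupp.single_eq_same]
  have e : ∏ i ∈ Finset.univ.erase j, gE ν (m i + (Finsupp.single j 1 : Fin n →₀ ℕ) i) (x i) =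
      ∏ i ∈ Finset.univ.erase j, gE ν (m i) (x i) := by
    refine Finset.prod_congr rfl fun i hi => ?_
    rw [Finsupp.single_eq_of_ne (Finset.ne_of_mem_erase hi), add_zero]
  rw [e]; ring

def GG (ν : ℝ) (m : Fin n →₀ ℕ) : Cinf n := ⟨GGf ν m, show ContDiff ℝ (⊤ : ℕ∞) _ from
  smooth_family (fun m => GGf ν m) (fun j m => m + Finsupp.single j 1) (GGf_hasFDerivAt ν) m⟩

variable [Module (AA n) (Cinf n)] [GoodMod n]

theorem X_smul_GG (ν : ℝ) (m : Fin n →₀ ℕ) (i : Fin n) :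
    (X i : AA n) • GG ν m = GG ν (m + Finsupp.single i 1) := by
  apply Cinf.ext'
  intro t
  exact X_smul_of_hasFDerivAt (GG ν m) t (fun j => GGf ν (m + Finsupp.single j 1) t) (GGf_hasFDerivAt ν m t) i

theorem monomial_smul_GG (ν : ℝ) (m m' : Fin n →₀ ℕ) :
    (monomial m (1:ℂ) : AA n) • GG ν m' = GG ν (m' + m) := by
  induction m using Finsupp.induction_linear generalizing m' with
  | zero => simp
  | add f g hf hg =>
    rw [← one_mul (1:ℂ), ← monomial_mul, mul_smul, hg, hf, add_assoc, add_comm g f]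
  | single i a =>
    induction a generalizing m' with
    | zero => simp
    | succ a ih =>
      rw [Finsupp.single_add, ← one_mul (1:ℂ), ← monomial_mul, mul_smul]
      change _ • (X i : AA n) • _ = _
      rw [X_smul_GG, ih, add_assoc, add_comm (Finsupp.single i 1)]

theorem GG_bound {ν : ℝ} (hν : 0 ≤ ν) {r : ℝ} (hr : 0 < r) (m : Fin n →₀ ℕ) (x : Fin n → ℝ) :
    ‖(GG ν m).1 x‖ ≤ gb r 0 m.degree * Real.exp (∑ j, (ν * r^2 - ν * (max (|x j| - r) 0)^2)) := by
  change ‖GGf ν m x‖ ≤ _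
  rw [GGf, norm_prod]
  refine (Finset.prod_le_prod (fun _ _ => norm_nonneg _) fun j _ => gE_bound hν hr (m j) (x j)).trans ?_
  rw [Finset.prod_div_distrib, Finset.prod_mul_distrib, ← Real.exp_sum, Finset.prod_pow_eq_pow_sum]
  have hd : m.degree = ∑ j, m j := Finsupp.degree_eq_sum m
  rw [gb, hd, mul_div_right_comm]
  gcongr
  have := Nat.le_of_dvd (Nat.factorial_pos _) (Nat.prod_factorial_dvd_factorial_sum (Finset.univ : Finset (Fin n)) fun j => m j)
  exact_mod_cast this

theorem GG_bound1 {ν : ℝ} (hν : 0 ≤ ν) {r : ℝ} (hr : 0 < r) (m : Fin n →₀ ℕ) (x : Fin n → ℝ) :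
    ‖(GG ν m).1 x‖ ≤ gb r 0 m.degree * Real.exp (n * (ν * r^2)) := by
  refine (GG_bound hν hr m x).trans ?_
  refine mul_le_mul_of_nonneg_left (Real.exp_le_exp.2 ?_) (gb_nonneg hr _ _)
  rw [Finset.sum_sub_distrib]
  have : 0 ≤ ∑ j, ν * (max (|x j| - r) 0)^2 := Finset.sum_nonneg fun j _ => by positivity
  simp at this ⊢
  exact this

theorem GG_bound2 {ν : ℝ} (hν : 0 ≤ ν) {r : ℝ} (hr : 0 < r) (m : Fin n →₀ ℕ) (x : Fin n → ℝ) (hx : (n+2) * r ≤ ‖x‖) :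
    ‖(GG ν m).1 x‖ ≤ gb r 0 m.degree * Real.exp (- (ν * r^2)) := by
  refine (GG_bound hν hr m x).trans ?_
  refine mul_le_mul_of_nonneg_left (Real.exp_le_exp.2 ?_) (gb_nonneg hr _ _)
  rw [Finset.sum_sub_distrib]
  obtain ⟨j, hj⟩ : ∃ j, (n+2)*r ≤ |x j| := by
    by_contra! hcon
    have := (pi_norm_lt_iff (x := x) (by positivity)).2 hcon
    linarith
  have h1 : ν * (max (|x j| - r) 0)^2 ≤ ∑ j, ν * (max (|x j| - r) 0)^2 :=
    Finset.single_le_sum (f := fun j => ν * (max (|x j| - r) 0)^2) (fun j _ => by positivity) (Finset.mem_univ j)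
  have h2 : ((n+1)*r)^2 ≤ (max (|x j| - r) 0)^2 := by
    apply pow_le_pow_left₀ (by positivity)
    exact le_max_of_le_left (by linarith)
  have h3 : ν * ((n+1)*r)^2 ≤ ν * (max (|x j| - r) 0)^2 := by gcongr
  have h4 : ν * r^2 * (n + 1) ≤ ν * ((n+1)*r)^2 := by
    have : 0 ≤ ν * r^2 * ((n+1) * n) := by positivity
    nlinarith
  simp only [Finset.sum_const, Finset.card_univ, Fintype.card_fin, nsmul_eq_mul]
  linarith

theorem GG_zero (ν : ℝ) (x : Fin n → ℝ) : (GG ν (0 : Fin n →₀ ℕ)).1 x = (∏ j, Real.exp (-ν * (x j)^2) : ℝ) := by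
  change GGf ν 0 x = _
  rw [GGf]
  push_cast
  refine Finset.prod_congr rfl fun j _ => ?_
  exact (gE_zero ν (x j)).trans (by push_cast; rfl)

theorem gauss_integrable {ν : ℝ} (hν : 0 < ν) :
    MeasureTheory.Integrable fun x : Fin n → ℝ => ∏ j, Real.exp (-ν * (x j)^2) :=
  MeasureTheory.Integrable.fintype_prod (f := fun (_ : Fin n) (y : ℝ) => Real.exp (-ν * y^2))
    (fun _ => integrable_exp_neg_mul_sq hν)

theorem gauss_integral (ν : ℝ) :
    ∫ x : Fin n → ℝ, ∏ j, Real.exp (-ν * (x j)^2) = √(Real.pi / ν)^n := by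
  have := MeasureTheory.integral_fintype_prod_volume_eq_pow (ι := Fin n) (fun y : ℝ => Real.exp (-ν * y^2))
  rw [this, integral_gaussian]; simp

end gauss

set_option autoImplicit false
open MvPolynomial Filter Topology

section gaussop
variable {n : ℕ} [Module (AA n) (Cinf n)] [GoodMod n]

def cg (n : ℕ) (ν : ℝ) : ℝ := √(ν / Real.pi)^n

theorem cg_nonneg (ν : ℝ) : 0 ≤ cg n ν := by unfold cg; positivity

/-- the Gaussian kernel -/
def KG (ν : ℝ) : Cinf n := (cg n ν : ℂ) • GG ν 0

theorem monomial_smul_KG (ν : ℝ) (m : Fin n →₀ ℕ) :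
    (monomial m (1:ℂ) : AA n) • (KG ν : Cinf n) = (cg n ν : ℂ) • GG ν m := by
  rw [KG, smul_csmul, monomial_smul_GG, zero_add]

theorem KG_apply (ν : ℝ) (x : Fin n → ℝ) : (KG ν : Cinf n).1 x = ((cg n ν * ∏ j, Real.exp (-ν * (x j)^2) : ℝ) : ℂ) := by
  rw [KG, Cinf.csmul_apply, GG_zero]; push_cast; rfl

open Classical in
def TG (ν : ℝ) (φ : Cinf n) : Cinf n :=
  if h : ∃ R, CS R φ then Classical.choose (conv_exists (KG ν) (Classical.choose_spec h)) else 0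

theorem TG_spec (ν : ℝ) {R : ℝ} {φ : Cinf n} (h : CS R φ) (p : AA n) (x) :
    (p • TG ν φ).1 x = ∫ t, (KG ν : Cinf n).1 t * (p • φ).1 (x - t) := by
  have h' : ∃ R, CS R φ := ⟨R, h⟩
  rw [TG, dif_pos h']
  exact Classical.choose_spec (conv_exists (KG ν) (Classical.choose_spec h')) p x

theorem TG_spec1 (ν : ℝ) {R : ℝ} {φ : Cinf n} (h : CS R φ) (x) :
    (TG ν φ).1 x = ∫ t, (KG ν : Cinf n).1 t * φ.1 (x - t) := by
  simpa using TG_spec ν h 1 x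

theorem TG_spec' (ν : ℝ) {R : ℝ} {φ : Cinf n} (h : CS R φ) (p : AA n) (x) :
    (p • TG ν φ).1 x = ∫ t, (p • (KG ν : Cinf n)).1 (x - t) * φ.1 t := by
  rw [TG_spec ν h, conv_ibp _ h,
    ← MeasureTheory.integral_sub_left_eq_self (fun t => (p • (KG ν : Cinf n)).1 t * φ.1 (x - t)) _ x]
  simp

theorem TG_int (K : Cinf n) {R : ℝ} {φ : Cinf n} (h : CS R φ) (x) :
    MeasureTheory.Integrable fun t => K.1 t * φ.1 (x - t) := (h.rfl' x).integrable K

theorem TG_smul (ν : ℝ) {R : ℝ} {φ : Cinf n} (h : CS R φ) (p : AA n) : p • TG ν φ = TG ν (p • φ) := by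
  apply Cinf.ext'
  intro x
  rw [TG_spec ν h, TG_spec1 ν (h.smul p)]

theorem TG_sub (ν : ℝ) {R : ℝ} {φ ψ : Cinf n} (h : CS R φ) (h' : CS R ψ) :
    TG ν (φ - ψ) = TG ν φ - TG ν ψ := by
  apply Cinf.ext'
  intro x
  rw [Cinf.sub_apply, TG_spec1 ν h, TG_spec1 ν h', TG_spec1 ν (h.sub h'),
    ← MeasureTheory.integral_sub (TG_int _ h x) (TG_int _ h' x)]
  congr 1; ext t
  simp; ring

theorem TG_sum (ν : ℝ) {R : ℝ} {ι : Type*} (s : Finset ι) {φ : ι → Cinf n} (h : ∀ i, CS R (φ i)) :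
    TG ν (∑ i ∈ s, φ i) = ∑ i ∈ s, TG ν (φ i) := by
  apply Cinf.ext'
  intro x
  rw [Cinf.sum_apply, TG_spec1 ν (CS.sum s fun i _ => h i), Finset.sum_congr rfl fun i _ => TG_spec1 ν (h i) x,
    ← MeasureTheory.integral_finsetSum _ fun i _ => TG_int _ (h i) x]
  congr 1; ext t
  simp [Finset.mul_sum]

theorem CS.integrable_norm {R : ℝ} {φ : Cinf n} (h : CS R φ) :
    MeasureTheory.Integrable fun t => ‖φ.1 t‖ := by
  have h1 : MeasureTheory.Integrable φ.1 := (Cinf.continuous φ).integrable_of_hasCompactSupport h.hcs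
  exact h1.norm

theorem TG_est {ν : ℝ} {R : ℝ} {φ : Cinf n} (h : CS R φ) (m : Fin n →₀ ℕ) (x) (B : ℝ)
    (hB : ∀ t, φ.1 t ≠ 0 → ‖(GG ν m).1 (x - t)‖ ≤ B) :
    ‖((monomial m (1:ℂ) : AA n) • TG ν φ).1 x‖ ≤ cg n ν * B * ∫ t, ‖φ.1 t‖ := by
  rw [TG_spec' ν h, monomial_smul_KG, ← MeasureTheory.integral_const_mul]
  refine MeasureTheory.norm_integral_le_of_norm_le (h.integrable_norm.const_mul _) (Eventually.of_forall fun t => ?_)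
  by_cases h0 : φ.1 t = 0
  · simp [h0]
  · rw [Cinf.csmul_apply, norm_mul, norm_mul, Complex.norm_real, Real.norm_eq_abs, abs_of_nonneg (cg_nonneg ν)]
    have := hB t h0
    gcongr
    exact cg_nonneg ν

theorem TG_entB {κ : Type} [Fintype κ] {ν : ℝ} (hν : 0 ≤ ν) {R : ℝ} {Z : κ → Cinf n} (h : ∀ c, CS R (Z c)) :
    EntB fun c => TG ν (Z c) := by
  intro r hr
  refine ⟨∑ c, cg n ν * Real.exp (n * (ν * r^2)) * ∫ t, ‖(Z c).1 t‖, ?_, fun c m x _ => ?_⟩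
  · exact Finset.sum_nonneg fun c _ => mul_nonneg (mul_nonneg (cg_nonneg _) (Real.exp_nonneg _))
      (MeasureTheory.integral_nonneg fun _ => norm_nonneg _)
  · refine (TG_est (h c) m x _ fun t _ => GG_bound1 hν hr m (x - t)).trans ?_
    have h1 : cg n ν * Real.exp (n * (ν * r^2)) * ∫ t, ‖(Z c).1 t‖ ≤
        ∑ c, cg n ν * Real.exp (n * (ν * r^2)) * ∫ t, ‖(Z c).1 t‖ :=
      Finset.single_le_sum (f := fun c => cg n ν * Real.exp (n * (ν * r^2)) * ∫ t, ‖(Z c).1 t‖)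
        (fun c _ => mul_nonneg (mul_nonneg (cg_nonneg _) (Real.exp_nonneg _))
      (MeasureTheory.integral_nonneg fun _ => norm_nonneg _)) (Finset.mem_univ c)
    calc _ = (cg n ν * Real.exp (n * (ν * r^2)) * ∫ t, ‖(Z c).1 t‖) * gb r 0 m.degree := by ring
      _ ≤ _ := mul_le_mul_of_nonneg_right h1 (gb_nonneg hr _ _)

theorem TG_small {ν : ℝ} (hν : 0 ≤ ν) {R : ℝ} {φ : Cinf n} (h : CS R φ) {r N : ℝ} (hr : 0 < r)
    (h0 : ∀ x ∈ Metric.ball (0 : Fin n → ℝ) (N + (n+2)*r), φ.1 x = 0) :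
    Bdd (Metric.ball (0 : Fin n → ℝ) N) (fun k => (cg n ν * Real.exp (-(ν * r^2)) * ∫ t, ‖φ.1 t‖) * gb r 0 k) (TG ν φ) := by
  intro m x hx
  refine (TG_est h m x _ fun t ht => GG_bound2 hν hr m (x - t) ?_).trans (le_of_eq (by ring))
  by_contra! hcon
  apply ht
  apply h0
  rw [mem_ball_zero_iff] at hx ⊢
  have := norm_sub_norm_le t x
  rw [norm_sub_rev] at this
  linarith

theorem cg_tendsto {r : ℝ} (hr : 0 < r) : Tendsto (fun ν : ℝ => cg n ν * Real.exp (-(ν * r^2))) atTop (𝓝 0) := by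
  have h1 := tendsto_rpow_mul_exp_neg_mul_atTop_nhds_zero (n:ℝ) (r^2) (by positivity)
  refine squeeze_zero' (Eventually.of_forall fun ν => mul_nonneg (cg_nonneg ν) (Real.exp_nonneg _)) ?_ h1
  filter_upwards [eventually_ge_atTop 1] with ν hν
  rw [Real.rpow_natCast, neg_mul, mul_comm ν]
  refine mul_le_mul_of_nonneg_right ?_ (Real.exp_nonneg _)
  unfold cg
  refine pow_le_pow_left₀ (by positivity) ?_ n
  have h2 : ν / Real.pi ≤ ν^2 := by
    rw [div_le_iff₀ Real.pi_pos]
    nlinarith [Real.pi_gt_three]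
  calc √(ν/Real.pi) ≤ √(ν^2) := Real.sqrt_le_sqrt h2
    _ = ν := Real.sqrt_sq (by linarith)

theorem cg_mul {ν : ℝ} (hν : 0 < ν) : cg n ν * √(Real.pi / ν)^n = 1 := by
  unfold cg
  rw [← mul_pow, ← Real.sqrt_mul (by positivity)]
  have := Real.pi_pos
  have : ν / Real.pi * (Real.pi / ν) = 1 := by field_simp
  simp [this]

theorem KG_moment {ν : ℝ} (hν : 0 < ν) (t : Fin n → ℝ) :
    (cg n ν * ∏ j, Real.exp (-ν * (t j)^2)) * ‖t‖ ≤
      (√(2/ν) * cg n ν) * ∏ j, Real.exp (-(ν/2) * (t j)^2) := by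
  have h0 : ‖t‖ ≤ √(2/ν) * Real.exp (ν / 2 * ‖t‖^2) := by
    set s := √(ν/2) * ‖t‖ with hs
    have h1 : s^2 = ν/2 * ‖t‖^2 := by rw [hs, mul_pow, Real.sq_sqrt (by positivity)]
    have h2 : √(2/ν) * √(ν/2) = 1 := by
      rw [← Real.sqrt_mul (by positivity)]
      have : 2/ν * (ν/2) = 1 := by field_simp
      simp [this]
    have h3 : s ≤ Real.exp (s^2) := by
      have := Real.add_one_le_exp (s^2)
      nlinarith [sq_nonneg (s - 1)]
    calc ‖t‖ = √(2/ν) * s := by rw [hs, ← mul_assoc, h2, one_mul]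
      _ ≤ _ := by rw [← h1]; gcongr
  have h1 : ‖t‖^2 ≤ ∑ j, (t j)^2 := by
    have hS : 0 ≤ ∑ j, (t j)^2 := Finset.sum_nonneg fun j _ => sq_nonneg _
    have : ‖t‖ ≤ √(∑ j, (t j)^2) := by
      refine (pi_norm_le_iff_of_nonneg (Real.sqrt_nonneg _)).2 fun j => ?_
      rw [Real.norm_eq_abs]
      exact Real.abs_le_sqrt (Finset.single_le_sum (f := fun j => (t j)^2) (fun j _ => sq_nonneg _) (Finset.mem_univ j))
    calc ‖t‖^2 ≤ (√(∑ j, (t j)^2))^2 := pow_le_pow_left₀ (norm_nonneg _) this 2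
      _ = _ := Real.sq_sqrt hS
  rw [← Real.exp_sum, ← Real.exp_sum, ← Finset.mul_sum, ← Finset.mul_sum]
  have h2 : Real.exp (-ν * ∑ j, (t j)^2) * Real.exp (ν/2*‖t‖^2) ≤ Real.exp (-(ν/2) * ∑ j, (t j)^2) := by
    rw [← Real.exp_add]
    apply Real.exp_le_exp.2
    nlinarith
  calc _ ≤ (cg n ν * Real.exp (-ν * ∑ j, (t j)^2)) * (√(2/ν) * Real.exp (ν / 2 * ‖t‖^2)) := by
        exact mul_le_mul_of_nonneg_left h0 (mul_nonneg (cg_nonneg _) (Real.exp_nonneg _))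
    _ = (√(2/ν) * cg n ν) * (Real.exp (-ν * ∑ j, (t j)^2) * Real.exp (ν/2*‖t‖^2)) := by ring
    _ ≤ _ := mul_le_mul_of_nonneg_left h2 (mul_nonneg (Real.sqrt_nonneg _) (cg_nonneg _))

theorem TG_approx {R : ℝ} {φ : Cinf n} (h : CS R φ) : ∃ L, 0 ≤ L ∧ ∀ ν, 0 < ν → ∀ x,
    ‖(TG ν φ).1 x - φ.1 x‖ ≤ L * √(2/ν) := by
  obtain ⟨C, hC⟩ := ContDiff.lipschitzWith_of_hasCompactSupport h.hcs (Cinf.contDiff φ) (by simp)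
  refine ⟨C * √2^n, by positivity, fun ν hν x => ?_⟩
  have hK : MeasureTheory.Integrable (KG ν : Cinf n).1 := by
    have := ((gauss_integrable (n := n) hν).const_mul (cg n ν)).ofReal (𝕜 := ℂ)
    refine this.congr (Eventually.of_forall fun t => ?_)
    exact (KG_apply ν t).symm
  have h1 : ∫ t, (KG ν : Cinf n).1 t = 1 := by
    simp only [KG_apply]
    rw [integral_complex_ofReal, MeasureTheory.integral_const_mul, gauss_integral, cg_mul hν]
    simp
  have h2 : φ.1 x = ∫ t, (KG ν : Cinf n).1 t * φ.1 x := by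
    rw [MeasureTheory.integral_mul_const, h1, one_mul]
  rw [TG_spec1 ν h, h2, ← MeasureTheory.integral_sub (TG_int _ h x) (hK.mul_const _)]
  have h3 : C * √2^n * √(2/ν) = ∫ t : Fin n → ℝ, C * ((√(2/ν) * cg n ν) * ∏ j, Real.exp (-(ν/2) * (t j)^2)) := by
    rw [MeasureTheory.integral_const_mul, MeasureTheory.integral_const_mul, gauss_integral]
    have : √(Real.pi / (ν/2))^n = √2^n * √(Real.pi/ν)^n := by
      rw [← mul_pow, ← Real.sqrt_mul (by positivity)]
      congr 2; field_simp
    rw [this]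
    linear_combination (-(C:ℝ) * √2^n * √(2/ν)) * cg_mul (n := n) hν
  rw [h3]
  refine MeasureTheory.norm_integral_le_of_norm_le (((gauss_integrable (by positivity)).const_mul _).const_mul _)
    (Eventually.of_forall fun t => ?_)
  have h4 : ‖φ.1 (x - t) - φ.1 x‖ ≤ C * ‖t‖ := by
    have := hC.dist_le_mul (x - t) x
    simpa [dist_eq_norm] using this
  have h5 : 0 ≤ cg n ν * ∏ j, Real.exp (-ν * (t j)^2) := mul_nonneg (cg_nonneg _) (by positivity)
  calc ‖(KG ν : Cinf n).1 t * φ.1 (x - t) - (KG ν : Cinf n).1 t * φ.1 x‖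
      = (cg n ν * ∏ j, Real.exp (-ν * (t j)^2)) * ‖φ.1 (x - t) - φ.1 x‖ := by
        rw [← mul_sub, norm_mul, KG_apply, Complex.norm_real, Real.norm_eq_abs, abs_of_nonneg h5]
    _ ≤ (cg n ν * ∏ j, Real.exp (-ν * (t j)^2)) * (C * ‖t‖) := mul_le_mul_of_nonneg_left h4 h5
    _ = C * ((cg n ν * ∏ j, Real.exp (-ν * (t j)^2)) * ‖t‖) := by ring
    _ ≤ _ := mul_le_mul_of_nonneg_left (KG_moment hν t) C.2

end gaussop

set_option autoImplicit false
open MvPolynomial Filter Topology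

section dens
variable {n : ℕ} {D : Finset (Fin n)} [Module (AA n) (Cinf n)] [GoodMod n]
  {κ : Type} [Fintype κ] {M : Fin n → Matrix κ κ (AA n)}

theorem red_q (hM : ∀ i ∈ D, ∀ c c', M i c c' ∈ supported ℂ ((D : Set (Fin n))ᶜ)) (q : AA n) :
    ∃ W : κ → κ → AA n, (∀ c c', W c c' ∈ supported ℂ ((D : Set (Fin n))ᶜ)) ∧
      ∀ (U : Set (Fin n → ℝ)), IsOpen U → ∀ F : κ → Cinf n,
        (∀ i ∈ D, ∀ c, ∀ x ∈ U, ((X i : AA n) • F c).1 x = (∑ c', M i c c' • F c').1 x) →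
        ∀ c, ∀ x ∈ U, (q • F c).1 x = (∑ c', W c c' • F c').1 x := by
  classical
  induction q using act_induction with
  | h1 =>
    refine ⟨fun c c' => if c = c' then 1 else 0, fun c c' => ?_, fun U hU F hF c x hx => ?_⟩
    · beta_reduce
      split_ifs
      · exact Subalgebra.one_mem _
      · exact Subalgebra.zero_mem _
    · simp [ite_smul]
  | hadd p q hp hq =>
    obtain ⟨W, hW, h⟩ := hp
    obtain ⟨W', hW', h'⟩ := hq
    refine ⟨fun c c' => W c c' + W' c c', fun c c' => Subalgebra.add_mem _ (hW c c') (hW' c c'), fun U hU F hF c x hx => ?_⟩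
    rw [add_smul, Cinf.add_apply, h U hU F hF c x hx, h' U hU F hF c x hx, ← Cinf.add_apply, ← Finset.sum_add_distrib]
    simp only [add_smul]
  | hC a p hp =>
    obtain ⟨W, hW, h⟩ := hp
    refine ⟨fun c c' => C a * W c c', fun c c' => Subalgebra.mul_mem _ (Subalgebra.algebraMap_mem _ a) (hW c c'), fun U hU F hF c x hx => ?_⟩
    simp only [mul_smul, ← Finset.smul_sum]
    rw [C_smul, C_smul, Cinf.csmul_apply, Cinf.csmul_apply, h U hU F hF c x hx]
  | hXm i p hp =>
    obtain ⟨W, hW, h⟩ := hp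
    by_cases hi : i ∈ D
    · refine ⟨fun c c' => ∑ c'', W c c'' * M i c'' c', fun c c' => Subalgebra.sum_mem _ fun c'' _ =>
        Subalgebra.mul_mem _ (hW c c'') (hM i hi c'' c'), fun U hU F hF c x hx => ?_⟩
      rw [mul_comm, mul_smul]
      have h1 : ∀ x ∈ U, ((X i : AA n) • F c).1 x = (∑ c', M i c c' • F c').1 x := hF i hi c
      have h2 : ∀ x ∈ U, ((X i : AA n) • p • F c).1 x = ((X i : AA n) • ∑ c', W c c' • F c').1 x :=
        smul_congr_on hU (h U hU F hF c) _
      rw [smul_comm, h2 x hx, Finset.smul_sum]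
      have h3 : ∀ c', ((X i : AA n) • W c c' • F c').1 x = (W c c' • ∑ c'', M i c' c'' • F c'').1 x := by
        intro c'
        rw [smul_comm]
        exact smul_congr_on hU (hF i hi c') _ x hx
      rw [Cinf.sum_apply, Finset.sum_congr rfl fun c' _ => h3 c', ← Cinf.sum_apply]
      congr 2
      simp only [Finset.smul_sum, smul_smul, Finset.sum_smul]
      rw [Finset.sum_comm]
    · refine ⟨fun c c' => X i * W c c', fun c c' => Subalgebra.mul_mem _ ?_ (hW c c'), fun U hU F hF c x hx => ?_⟩
      · exact X_mem_supported.2 (by simpa using hi)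
      · simp only [mul_smul, ← Finset.smul_sum]
        exact smul_congr_on hU (h U hU F hF c) _ x hx

theorem density (hM : ∀ i ∈ D, ∀ c c', M i c c' ∈ supported ℂ ((D : Set (Fin n))ᶜ))
    (hcomm : ∀ i ∈ D, ∀ j ∈ D, M i * M j = M j * M i)
    (w : κ → ℕ) (hw : ∀ i ∈ D, ∀ c c', M i c c' ≠ 0 → (M i c c').totalDegree + w c' ≤ w c + 1) (N : ℕ) :
    ∃ N' : ℕ, ∀ Y : κ → Cinf n,
      (∀ i ∈ D, ∀ c, ∀ x ∈ Metric.ball (0 : Fin n → ℝ) (N':ℝ), ((X i : AA n) • Y c).1 x = (∑ c', M i c c' • Y c').1 x) →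
      ∀ (Q : Finset (AA n)) (ε : ℝ), 0 < ε → ∃ V : κ → Cinf n,
        (∀ i ∈ D, ∀ c, (X i : AA n) • V c = ∑ c', M i c c' • V c') ∧
        ∀ q ∈ Q, ∀ c, ∀ x ∈ Metric.ball (0 : Fin n → ℝ) (N:ℝ), ‖(q • Y c - q • V c).1 x‖ ≤ ε := by
  classical
  have hCM := CM_nonneg D M (Nat.cast_nonneg N : (0:ℝ) ≤ N)
  set r := 4 * CM D M N + 1 with hrdef
  have hr : 0 < r := by positivity
  have h4 : 4 * CM D M N ≤ r := by linarith
  refine ⟨⌈(N:ℝ) + (n+2)*r⌉₊, fun Y hY Q ε hε => ?_⟩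
  set N' := ⌈(N:ℝ) + (n+2)*r⌉₊ with hN'
  have hNN' : (N:ℝ) + (n+2)*r ≤ N' := Nat.le_ceil _
  have hsub0 : Metric.ball (0 : Fin n → ℝ) ((N:ℝ) + (n+2)*r) ⊆ Metric.ball 0 (N':ℝ) := Metric.ball_subset_ball hNN'
  have hsub : Metric.ball (0 : Fin n → ℝ) (N:ℝ) ⊆ Metric.ball 0 (N':ℝ) :=
    Metric.ball_subset_ball (by have : 0 ≤ (n+2)*r := by positivity
                                linarith)
  set Z : κ → Cinf n := fun c => mulC (chiN N') (Y c) with hZ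
  have hZCS : ∀ c, CS ((N':ℝ)+2) (Z c) := fun c => chiN_CS N' (Y c)
  have hZY : ∀ c, ∀ x ∈ Metric.ball (0 : Fin n → ℝ) (N':ℝ), (Z c).1 x = (Y c).1 x := by
    intro c x hx
    rw [hZ, Cinf.mul_apply, chiN_one N' x fun j => by linarith [ball_abs hx j], one_mul]
  set ψ : Fin n → κ → Cinf n := fun i c => (X i : AA n) • Z c - ∑ c', M i c c' • Z c' with hψ
  have hψCS : ∀ i c, CS ((N':ℝ)+2) (ψ i c) := fun i c =>
    ((hZCS c).smul _).sub (CS.sum _ fun c' _ => (hZCS c').smul _)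
  have hψ0 : ∀ i ∈ D, ∀ c, ∀ x ∈ Metric.ball (0 : Fin n → ℝ) ((N:ℝ) + (n+2)*r), (ψ i c).1 x = 0 := by
    intro i hi c x hx
    have hx' := hsub0 hx
    rw [hψ, Cinf.sub_apply, Cinf.sum_apply, smul_congr_on Metric.isOpen_ball (hZY c) _ x hx',
      Finset.sum_congr rfl fun c' _ => smul_congr_on Metric.isOpen_ball (hZY c') _ x hx', hY i hi c x hx', Cinf.sum_apply, sub_self]
  have hTGψ : ∀ ν i c, (X i : AA n) • TG ν (Z c) - ∑ c', M i c c' • TG ν (Z c') = TG ν (ψ i c) := by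
    intro ν i c
    rw [hψ, TG_sub ν ((hZCS c).smul _) (CS.sum _ fun c' _ => (hZCS c').smul _), TG_sum ν _ (fun c' => (hZCS c').smul _),
      TG_smul ν (hZCS c)]
    simp only [TG_smul ν (hZCS _)]
  set S : ℝ := ∑ i, ∑ c, ∫ t, ‖(ψ i c).1 t‖ with hS
  have hint0 : ∀ i c, 0 ≤ ∫ t, ‖(ψ i c).1 t‖ := fun i c => MeasureTheory.integral_nonneg fun _ => norm_nonneg _
  have hS0 : 0 ≤ S := Finset.sum_nonneg fun i _ => Finset.sum_nonneg fun c _ => hint0 i c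
  have hψS : ∀ i c, ∫ t, ‖(ψ i c).1 t‖ ≤ S := fun i c =>
    (Finset.single_le_sum (f := fun c => ∫ t, ‖(ψ i c).1 t‖) (fun c _ => hint0 i c) (Finset.mem_univ c)).trans
    (Finset.single_le_sum (f := fun i => ∑ c, ∫ t, ‖(ψ i c).1 t‖)
      (fun i _ => Finset.sum_nonneg fun c _ => hint0 i c) (Finset.mem_univ i))
  have hE : ∀ ν, 0 ≤ ν → ∀ i ∈ D, ∀ c, Bdd (Metric.ball (0 : Fin n → ℝ) (N:ℝ))
      (fun k => (cg n ν * Real.exp (-(ν * r^2)) * S) * gb r 0 k)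
        ((X i : AA n) • TG ν (Z c) - ∑ c', M i c c' • TG ν (Z c')) := by
    intro ν hν i hi c
    rw [hTGψ]
    refine (TG_small hν (hψCS i c) hr (hψ0 i hi c)).mono fun k => ?_
    refine mul_le_mul_of_nonneg_right ?_ (gb_nonneg hr _ _)
    exact mul_le_mul_of_nonneg_left (hψS i c) (mul_nonneg (cg_nonneg _) (Real.exp_nonneg _))
  have key : ∀ q ∈ Q, ∀ c : κ, ∀ᶠ ν : ℝ in atTop, ∀ V : κ → Cinf n,
      (∀ i ∈ D, ∀ c, (X i : AA n) • V c = ∑ c', M i c c' • V c') →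
      (∀ (p : AA n) c x, Tendsto (fun K => (p • ∑ k ∈ Finset.range K, TT D M (fun c => TG ν (Z c)) k c).1 x) atTop (𝓝 ((p • V c).1 x))) →
      ∀ x ∈ Metric.ball (0 : Fin n → ℝ) (N:ℝ), ‖(q • Y c - q • V c).1 x‖ ≤ ε := by
    intro q _ c
    obtain ⟨W, hW, hred⟩ := red_q hM q
    choose L hL0 hL using fun c' => TG_approx ((hZCS c').smul (W c c'))
    choose B hB0 hB using fun c' => duhamel_est hM w hw N hr h4 (W c c') (hW c c') c'
    have hsq : Tendsto (fun ν : ℝ => √(2/ν)) atTop (𝓝 0) := by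
      have h1 : Tendsto (fun ν : ℝ => 2/ν) atTop (𝓝 0) := tendsto_const_nhds.div_atTop tendsto_id
      have h2 := (Real.continuous_sqrt.tendsto 0).comp h1
      rw [Real.sqrt_zero] at h2
      exact h2
    have hlim : Tendsto (fun ν : ℝ => ∑ c', (L c' * √(2/ν) + (cg n ν * Real.exp (-(ν * r^2)) * S) * B c')) atTop (𝓝 0) := by
      have : Tendsto (fun ν : ℝ => ∑ c', (L c' * √(2/ν) + (cg n ν * Real.exp (-(ν * r^2)) * S) * B c')) atTop
          (𝓝 (∑ c', (L c' * 0 + (0 * S) * B c'))) :=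
        tendsto_finsetSum _ fun c' _ => (hsq.const_mul _).add (((cg_tendsto hr).mul_const _).mul_const _)
      simpa using this
    filter_upwards [hlim.eventually_le_const hε, eventually_gt_atTop 0] with ν hν1 hν V hV hVt x hx
    refine le_trans ?_ hν1
    have h1 := hred _ Metric.isOpen_ball Y hY c x (hsub hx)
    have h2 := hred Set.univ isOpen_univ V (fun i hi c x _ => by rw [hV i hi c]) c x (Set.mem_univ _)
    rw [Cinf.sub_apply, h1, h2, Cinf.sum_apply, Cinf.sum_apply, ← Finset.sum_sub_distrib]
    refine (norm_sum_le _ _).trans (Finset.sum_le_sum fun c' _ => ?_)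
    have h3 := hL c' ν hν x
    have h4' := hB c' _ V (TG_entB hν.le hZCS) hVt _ (mul_nonneg (mul_nonneg (cg_nonneg _) (Real.exp_nonneg _)) hS0)
      (hE ν hν.le) x hx
    rw [← smul_congr_on Metric.isOpen_ball (hZY c') (W c c') x (hsub hx)]
    rw [← TG_smul ν (hZCS c')] at h3
    rw [Cinf.sub_apply] at h4'
    have e : (W c c' • Z c').1 x - (W c c' • V c').1 x =
      -((W c c' • TG ν (Z c')).1 x - (W c c' • Z c').1 x) + ((W c c' • TG ν (Z c')).1 x - (W c c' • V c').1 x) := by ring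
    rw [e]
    refine (norm_add_le _ _).trans (add_le_add ?_ h4')
    rw [norm_neg]; exact h3
  have key2 : ∀ᶠ ν : ℝ in atTop, 0 ≤ ν ∧ ∀ q ∈ Q, ∀ c : κ, ∀ V : κ → Cinf n,
      (∀ i ∈ D, ∀ c, (X i : AA n) • V c = ∑ c', M i c c' • V c') →
      (∀ (p : AA n) c x, Tendsto (fun K => (p • ∑ k ∈ Finset.range K, TT D M (fun c => TG ν (Z c)) k c).1 x) atTop (𝓝 ((p • V c).1 x))) →
      ∀ x ∈ Metric.ball (0 : Fin n → ℝ) (N:ℝ), ‖(q • Y c - q • V c).1 x‖ ≤ ε := by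
    refine (eventually_ge_atTop 0).and ?_
    rw [Filter.eventually_all_finset]
    intro q hq
    rw [Filter.eventually_all]
    exact key q hq
  obtain ⟨ν, hν, h⟩ := key2.exists
  obtain ⟨V, hV, hVt⟩ := exists_V hM hcomm w hw (TG_entB hν hZCS)
  exact ⟨V, hV, fun q hq c x hx => h q hq c V hV hVt x hx⟩

end dens

set_option autoImplicit false
open MvPolynomial Filter Topology

section comp
variable {n : ℕ}

/-- monic of degree `q` in `X i`, with variables in `T`, of total degree at most `q` -/
def HD (i : Fin n) (T : Set (Fin n)) (q : ℕ) (a : AA n) (α : ℕ → AA n) : Prop :=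
  a = X i ^ q + ∑ f ∈ Finset.range q, α f * X i ^ f ∧
    ∀ f < q, α f ∈ supported ℂ (T \ {i}) ∧ (α f).totalDegree + f ≤ q

/-- companion matrix -/
def cmpM (q : ℕ) (α : ℕ → AA n) : Matrix (Fin q) (Fin q) (AA n) := fun c c' =>
  if c.1 + 1 < q then (if c'.1 = c.1 + 1 then 1 else 0) else - α c'.1

theorem cmp_poly {i : Fin n} {T : Set (Fin n)} {q : ℕ} {a : AA n} {α : ℕ → AA n} (h : HD i T q a α) (c : Fin q) :
    X i * X i ^ c.1 = ∑ c', cmpM q α c c' * X i ^ c'.1 + (if c.1 + 1 = q then a else 0) := by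
  unfold cmpM
  by_cases hc : c.1 + 1 < q
  · rw [if_neg hc.ne]
    simp only [if_pos hc]
    rw [Finset.sum_eq_single (⟨c.1 + 1, hc⟩ : Fin q)]
    · simp [pow_succ']
    · intro c' _ hc'
      rw [if_neg, zero_mul]
      exact fun h => hc' (Fin.ext h)
    · simp
  · have hc1 : c.1 + 1 = q := by omega
    rw [if_pos hc1]
    simp only [if_neg hc]
    rw [h.1, Finset.sum_range, ← pow_succ', hc1]
    simp

theorem cmp_mem {i : Fin n} {T : Set (Fin n)} {q : ℕ} {a : AA n} {α : ℕ → AA n} (h : HD i T q a α) (c c' : Fin q) :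
    cmpM q α c c' ∈ supported ℂ (T \ {i}) := by
  unfold cmpM
  split_ifs
  · exact Subalgebra.one_mem _
  · exact Subalgebra.zero_mem _
  · exact Subalgebra.neg_mem _ (h.2 c' c'.2).1

theorem cmp_deg {i : Fin n} {T : Set (Fin n)} {q : ℕ} {a : AA n} {α : ℕ → AA n} (h : HD i T q a α) (c c' : Fin q)
    (h0 : cmpM q α c c' ≠ 0) : (cmpM q α c c').totalDegree + c'.1 ≤ c.1 + 1 := by
  unfold cmpM at h0 ⊢
  split_ifs at h0 ⊢ with h1 h2
  · rw [totalDegree_one]; omega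
  · exact absurd rfl h0
  · rw [totalDegree_neg]
    have := (h.2 c' c'.2).2
    have := c.2
    omega

theorem HD.monicIn {i : Fin n} {T : Set (Fin n)} {q : ℕ} {a : AA n} {α : ℕ → AA n} (h : HD i T q a α) : MonicIn i a := by
  refine ⟨q, 1, fun f => if f < q then α f else 0, one_ne_zero, fun f => ?_, ?_⟩
  · beta_reduce
    split_ifs with hf
    · exact supported_mono (fun x hx => hx.2) (h.2 f hf).1
    · exact Subalgebra.zero_mem _
  · rw [h.1, map_one, one_mul]
    congr 1
    refine Finset.sum_congr rfl fun f hf => ?_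
    beta_reduce
    rw [if_pos (Finset.mem_range.1 hf)]

variable [Module (AA n) (Cinf n)] [GoodMod n]

theorem cmp_fwd {i : Fin n} {T : Set (Fin n)} {q : ℕ} {a : AA n} {α : ℕ → AA n} (h : HD i T q a α) {U : Set (Fin n → ℝ)}
    (hU : IsOpen U) {y : Cinf n} (hy : ∀ x ∈ U, (a • y).1 x = 0) (c : Fin q) (p : AA n) :
    ∀ x ∈ U, ((X i : AA n) • (p * X i ^ c.1) • y).1 x = (∑ c', cmpM q α c c' • (p * X i ^ c'.1) • y).1 x := by
  intro x hx
  have h1 : (X i : AA n) • (p * X i ^ c.1) • y = ∑ c', cmpM q α c c' • (p * X i ^ c'.1) • y + p • ((if c.1 + 1 = q then a else 0) • y) := by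
    have := congrArg (fun z => (p * z) • y) (cmp_poly h c)
    simp only [mul_add, add_smul, Finset.mul_sum, Finset.sum_smul] at this
    simp only [smul_smul]
    rw [mul_left_comm, this]
    congr 1
    refine Finset.sum_congr rfl fun c' _ => ?_
    rw [mul_left_comm]
  rw [h1, Cinf.add_apply, smul_zero_on hU _ p x hx, add_zero]
  intro x hx
  split_ifs
  · exact hy x hx
  · simp

theorem cmp_bwd {i : Fin n} {T : Set (Fin n)} {q : ℕ} (hq : 0 < q) {a : AA n} {α : ℕ → AA n} (h : HD i T q a α)
    {V : Fin q → Cinf n} (hV : ∀ c, (X i : AA n) • V c = ∑ c', cmpM q α c c' • V c') : a • V ⟨0, hq⟩ = 0 := by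
  have h1 : ∀ f (hf : f < q), (X i ^ f : AA n) • V ⟨0, hq⟩ = V ⟨f, hf⟩ := by
    intro f
    induction f with
    | zero => intro hf; simp
    | succ f ih =>
      intro hf
      rw [pow_succ', mul_smul, ih (by omega), hV]
      rw [Finset.sum_eq_single (⟨f+1, hf⟩ : Fin q)]
      · simp [cmpM, hf]
      · intro c' _ hc'
        have : c'.1 ≠ f + 1 := fun h => hc' (Fin.ext h)
        simp [cmpM, hf, this]
      · simp
  obtain ⟨q', rfl⟩ : ∃ q', q = q' + 1 := ⟨q - 1, by omega⟩
  rw [h.1, add_smul, pow_succ', mul_smul, h1 q' (by omega), hV, Finset.sum_smul, Finset.sum_range, ← Finset.sum_add_distrib]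
  refine Finset.sum_eq_zero fun c' _ => ?_
  rw [mul_smul, h1 c'.1 c'.2]
  simp [cmpM]

theorem stage1 {i : Fin n} {T : Set (Fin n)} {q : ℕ} (hq : 0 < q) {a : AA n} {α : ℕ → AA n} (h : HD i T q a α) (w : Cinf n) :
    ∃ y : Cinf n, a • y = w := by
  have := mittag_leffler (fun _ : Unit => a) (fun _ => w) ?_ ?_
  · obtain ⟨y, hy⟩ := this
    exact ⟨y, hy ()⟩
  · intro N
    obtain ⟨y, hy⟩ := stage1_local h.monicIn w N
    exact ⟨y, fun _ => hy⟩
  · intro N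
    obtain ⟨N', hN'⟩ := density (D := {i}) (M := fun _ => cmpM q α)
      (fun j hj c c' => supported_mono (fun x hx => by simpa using hx.2) (cmp_mem h c c')) (fun _ _ _ _ => rfl)
      (fun c => c.1) (fun j hj c c' h0 => cmp_deg h c c' h0) N
    refine ⟨N', fun y hy Q ε hε => ?_⟩
    obtain ⟨V, hV, hVa⟩ := hN' (fun c => (1 * X i ^ c.1 : AA n) • y) (fun j hj c x hx => by
      rw [Finset.mem_singleton] at hj
      subst hj
      exact cmp_fwd h Metric.isOpen_ball (hy ()) c 1 x hx) Q ε hε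
    refine ⟨V ⟨0, hq⟩, fun _ => cmp_bwd hq h (hV i (by simp)), fun p hp x hx => ?_⟩
    simpa using hVa p hp ⟨0, hq⟩ x hx

theorem stage2 {s last : Fin n} (hsl : s ≠ last) {q q' : ℕ} (hq : 0 < q) (hq' : 0 < q') {a b : AA n} {αa αb : ℕ → AA n}
    (ha : HD s {last}ᶜ q a αa) (ha' : a ∈ supported ℂ ({last}ᶜ : Set (Fin n))) (hb : HD last {s}ᶜ q' b αb)
    {c α β : Fin n → AA n}
    (hc : ∀ j, j ≠ last → c j = α j * a + β j * b)
    (hc1 : ∀ j, j ≠ last → c j ∈ supported ℂ ({j}ᶜ : Set (Fin n)))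
    (hc2 : ∀ j, j ≠ last → MonicIn last (c j)) (z : Cinf n) (hz : a • z = 0) :
    ∃ y : Cinf n, a • y = 0 ∧ b • y = z := by
  classical
  have := mittag_leffler (fun t : Bool => if t then a else b) (fun t => if t then 0 else z) ?_ ?_
  · obtain ⟨y, hy⟩ := this
    exact ⟨y, by simpa using hy true, by simpa using hy false⟩
  · intro N
    obtain ⟨y, hy⟩ := stage2_local ha.monicIn ha' hc hc1 hc2 z hz N
    refine ⟨y, fun t x hx => ?_⟩
    cases t
    · simpa using (hy x hx).2
    · simpa using (hy x hx).1
  · intro N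
    have hTa : ∀ x ∈ ({last}ᶜ \ {s} : Set (Fin n)), x ∈ ((({s, last} : Finset (Fin n)) : Set (Fin n)))ᶜ := by
      intro x hx; simp at hx ⊢; tauto
    have hTb : ∀ x ∈ ({s}ᶜ \ {last} : Set (Fin n)), x ∈ ((({s, last} : Finset (Fin n)) : Set (Fin n)))ᶜ := by
      intro x hx; simp at hx ⊢; tauto
    set Ma := Matrix.kroneckerMap (· * ·) (cmpM q αa) (1 : Matrix (Fin q') (Fin q') (AA n)) with hMa
    set Mb := Matrix.kroneckerMap (· * ·) (1 : Matrix (Fin q) (Fin q) (AA n)) (cmpM q' αb) with hMb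
    have hMas : ∀ (F : Fin q × Fin q' → Cinf n) u v, ∑ c', Ma (u,v) c' • F c' = ∑ u', cmpM q αa u u' • F (u', v) := by
      intro F u v
      rw [Fintype.sum_prod_type]
      refine Finset.sum_congr rfl fun u' _ => ?_
      rw [Finset.sum_eq_single v]
      · simp [hMa]
      · intro v' _ hv'
        simp [hMa, Matrix.one_apply_ne hv'.symm]
      · simp
    have hMbs : ∀ (F : Fin q × Fin q' → Cinf n) u v, ∑ c', Mb (u,v) c' • F c' = ∑ v', cmpM q' αb v v' • F (u, v') := by
      intro F u v
      rw [Fintype.sum_prod_type, Finset.sum_eq_single u]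
      · simp [hMb]
      · intro u' _ hu'
        simp [hMb, Matrix.one_apply_ne hu'.symm]
      · simp
    have hcom : Ma * Mb = Mb * Ma := by
      have e1 := Matrix.mul_kronecker_mul (cmpM q αa) (1 : Matrix (Fin q) (Fin q) (AA n)) (1 : Matrix (Fin q') (Fin q') (AA n)) (cmpM q' αb)
      have e2 := Matrix.mul_kronecker_mul (1 : Matrix (Fin q) (Fin q) (AA n)) (cmpM q αa) (cmpM q' αb) (1 : Matrix (Fin q') (Fin q') (AA n))
      simp only [one_mul, mul_one] at e1 e2
      exact e1.symm.trans e2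
    obtain ⟨N', hN'⟩ := density (D := {s, last}) (κ := Fin q × Fin q')
      (M := fun i => if i = s then Ma else Mb) (by
        intro i hi c c'
        simp only [Finset.mem_insert, Finset.mem_singleton] at hi
        by_cases his : i = s
        · simp only [if_pos his]
          refine Subalgebra.mul_mem _ (supported_mono hTa (cmp_mem ha _ _)) ?_
          rw [Matrix.one_apply]; split_ifs
          · exact Subalgebra.one_mem _
          · exact Subalgebra.zero_mem _
        · simp only [if_neg his]
          refine Subalgebra.mul_mem _ ?_ (supported_mono hTb (cmp_mem hb _ _))
          rw [Matrix.one_apply]; split_ifs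
          · exact Subalgebra.one_mem _
          · exact Subalgebra.zero_mem _)
      (by
        intro i hi j hj
        split_ifs
        · rfl
        · exact hcom
        · exact hcom.symm
        · rfl)
      (fun c => c.1.1 + c.2.1) (by
        rintro i hi ⟨u, v⟩ ⟨u', v'⟩ h0
        by_cases his : i = s
        · simp only [if_pos his] at h0 ⊢
          have hv : v = v' := by
            by_contra hv
            simp [hMa, Matrix.one_apply_ne hv] at h0
          subst hv
          simp only [hMa, Matrix.kroneckerMap_apply, Matrix.one_apply_eq, mul_one] at h0 ⊢
          have := cmp_deg ha u u' h0
          omega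
        · simp only [if_neg his] at h0 ⊢
          have hu : u = u' := by
            by_contra hu
            simp [hMb, Matrix.one_apply_ne hu] at h0
          subst hu
          simp only [hMb, Matrix.kroneckerMap_apply, Matrix.one_apply_eq, one_mul] at h0 ⊢
          have := cmp_deg hb v v' h0
          omega) N
    refine ⟨N', fun y hy Q ε hε => ?_⟩
    have hya : ∀ x ∈ Metric.ball (0 : Fin n → ℝ) (N':ℝ), (a • y).1 x = 0 := by simpa using hy true
    have hyb : ∀ x ∈ Metric.ball (0 : Fin n → ℝ) (N':ℝ), (b • y).1 x = 0 := by simpa using hy false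
    obtain ⟨V, hV, hVa⟩ := hN' (fun c => (X last ^ c.2.1 * X s ^ c.1.1 : AA n) • y) (by
      rintro i hi ⟨u, v⟩ x hx
      simp only [Finset.mem_insert, Finset.mem_singleton] at hi
      by_cases his : i = s
      · simp only [if_pos his]
        rw [hMas, his]
        exact cmp_fwd ha Metric.isOpen_ball hya u _ x hx
      · simp only [if_neg his]
        have hil : i = last := hi.resolve_left his
        rw [hMbs, hil]
        have := cmp_fwd hb Metric.isOpen_ball hyb v (X s ^ u.1) x hx
        simpa only [mul_comm (X s ^ u.1 : AA n)] using this) Q ε hε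
    refine ⟨V (⟨0, hq⟩, ⟨0, hq'⟩), fun t => ?_, fun p hp x hx => ?_⟩
    · cases t
      · simp only [Bool.false_eq_true, if_false]
        refine cmp_bwd (V := fun v => V (⟨0, hq⟩, v)) hq' hb fun v => ?_
        have := hV last (by simp) (⟨0, hq⟩, v)
        simp only [if_neg hsl.symm] at this
        rw [this, hMbs]
      · simp only [if_true]
        refine cmp_bwd (V := fun u => V (u, ⟨0, hq'⟩)) hq ha fun u => ?_
        have := hV s (by simp) (u, ⟨0, hq'⟩)
        simp only [if_true] at this
        rw [this, hMas]
    · simpa using hVa p hp (⟨0, hq⟩, ⟨0, hq'⟩) x hx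

theorem controllable_main {ℓ k : ℕ} (P : Matrix (Fin ℓ) (Fin k) (AA n))
    {s last : Fin n} (hsl : s ≠ last) {q q' : ℕ} (hq : 0 < q) (hq' : 0 < q') {a b : AA n} {αa αb : ℕ → AA n}
    (Qa Qb : Matrix (Fin k) (Fin ℓ) (AA n))
    (hQa : P * Qa = a • (1 : Matrix (Fin ℓ) (Fin ℓ) (AA n))) (hQb : P * Qb = b • (1 : Matrix (Fin ℓ) (Fin ℓ) (AA n)))
    (ha : HD s {last}ᶜ q a αa) (ha' : a ∈ supported ℂ ({last}ᶜ : Set (Fin n))) (hb : HD last {s}ᶜ q' b αb)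
    {c α β : Fin n → AA n}
    (hc : ∀ j, j ≠ last → c j = α j * a + β j * b)
    (hc1 : ∀ j, j ≠ last → c j ∈ supported ℂ ({j}ᶜ : Set (Fin n)))
    (hc2 : ∀ j, j ≠ last → MonicIn last (c j)) : IsControllable (system P) := by
  refine controllable_of_div P Qa a hQa fun f hf => ?_
  choose g0 hg0 using fun j => stage1 hq ha (f j)
  have hz : ∀ i, a • ∑ j, P i j • g0 j = 0 := by
    intro i
    rw [Finset.smul_sum, ← hf i]
    refine Finset.sum_congr rfl fun j _ => ?_
    rw [smul_comm, hg0]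
  choose z hz1 hz2 using fun i => stage2 hsl hq hq' ha ha' hb hc hc1 hc2 _ (hz i)
  refine ⟨fun j => g0 j - ∑ i, Qb j i • z i, fun i => ?_, fun j => ?_⟩
  · simp only [smul_sub, Finset.sum_sub_distrib]
    rw [sub_eq_zero, ← hz2 i]
    simp only [Finset.smul_sum, smul_smul]
    rw [Finset.sum_comm]
    simp only [← Finset.sum_smul]
    have h1 : ∀ i', ∑ j, P i j * Qb j i' = (b • (1 : Matrix (Fin ℓ) (Fin ℓ) (AA n))) i i' := by
      intro i'; rw [← hQb, Matrix.mul_apply]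
    simp only [h1, Matrix.smul_apply, Matrix.one_apply, smul_eq_mul, mul_ite, mul_one, mul_zero, ite_smul, zero_smul]
    simp
  · rw [smul_sub, hg0, Finset.smul_sum, Finset.sum_eq_zero, sub_zero]
    intro i _
    rw [smul_comm, hz1, smul_zero]

theorem controllable_one {ℓ k : ℕ} (P : Matrix (Fin ℓ) (Fin k) (AA n)) (Q : Matrix (Fin k) (Fin ℓ) (AA n))
    (hQ : P * Q = 1) : IsControllable (system P) :=
  controllable_of_div P Q 1 (by rw [hQ, one_smul]) fun f hf => ⟨f, hf, fun j => one_smul _ _⟩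

end comp

set_option autoImplicit false
open MvPolynomial Filter Topology

section univ

/-- the degree of the multipliers -/
def Edeg (ℓ d : ℕ) : ℕ := d * ℓ + 1

def LM {R : Type} [CommRing R] {ℓ k d : ℕ} (p : Fin ℓ → Fin k → ℕ → R) :
    Matrix (Fin ℓ × Fin (Edeg ℓ d + d + 1)) (Fin k × Fin (Edeg ℓ d + 1)) R :=
  fun a b => if b.2.1 ≤ a.2.1 then p a.1 b.1 (a.2.1 - b.2.1) else 0

def pzero {ℓ k : ℕ} (d : ℕ) (r : Fin ℓ) (c : Fin k) (q : ℕ) : ℂ :=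
  (if c.1 = r.1 ∧ q = 0 then 1 else 0) + (if c.1 = r.1 + 1 ∧ q = d then 1 else 0)

theorem LM_pzero {ℓ k d : ℕ} (hlk : ℓ < k) (H : ℕ → ℕ → ℂ) (hH : ∀ c j, Edeg ℓ d < j → H c j = 0) (r : Fin ℓ)
    (m : Fin (Edeg ℓ d + d + 1)) :
    ((LM (d := d) (pzero (k := k) d)).mulVec fun b => H b.1.1 b.2.1) (r, m) =
      H r.1 m.1 + (if d ≤ m.1 then H (r.1+1) (m.1 - d) else 0) := by
  rw [Matrix.mulVec, dotProduct]
  have h1 : ∀ b : Fin k × Fin (Edeg ℓ d + 1), LM (d := d) (pzero (k := k) d) (r, m) b * H b.1.1 b.2.1 =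
      (if b.1.1 = r.1 ∧ b.2.1 = m.1 then H r.1 m.1 else 0) +
      (if b.1.1 = r.1 + 1 ∧ b.2.1 + d = m.1 then H (r.1+1) (m.1 - d) else 0) := by
    rintro ⟨c, j⟩
    simp only [LM, pzero]
    by_cases hj : j.1 ≤ m.1
    · rw [if_pos hj, add_mul]
      congr 1
      · by_cases h : c.1 = r.1 ∧ j.1 = m.1
        · rw [if_pos h, if_pos ⟨h.1, by omega⟩, one_mul, h.1, h.2]
        · rw [if_neg h, if_neg (fun h' => h ⟨h'.1, by omega⟩), zero_mul]
      · by_cases h : c.1 = r.1 + 1 ∧ j.1 + d = m.1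
        · rw [if_pos h, if_pos ⟨h.1, by omega⟩, one_mul, h.1, ← h.2, Nat.add_sub_cancel]
        · rw [if_neg h, if_neg (fun h' => h ⟨h'.1, by omega⟩), zero_mul]
    · rw [if_neg hj, if_neg (by omega), if_neg (by omega)]; simp
  rw [Finset.sum_congr rfl fun b _ => h1 b, Finset.sum_add_distrib]
  congr 1
  · by_cases hm : m.1 ≤ Edeg ℓ d
    · rw [Finset.sum_eq_single ((⟨r.1, by omega⟩, ⟨m.1, by omega⟩) : Fin k × Fin (Edeg ℓ d + 1))]
      · simp
      · rintro ⟨c, j⟩ _ h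
        rw [if_neg]
        rintro ⟨h1, h2⟩
        exact h (Prod.ext (Fin.ext h1) (Fin.ext h2))
      · simp
    · rw [hH _ _ (by omega)]; simp
  · by_cases hm : d ≤ m.1
    · rw [if_pos hm, Finset.sum_eq_single ((⟨r.1 + 1, by omega⟩, ⟨m.1 - d, by omega⟩) : Fin k × Fin (Edeg ℓ d + 1))]
      · simp [Nat.sub_add_cancel hm]
      · rintro ⟨c, j⟩ _ h
        rw [if_neg]
        rintro ⟨h1, h2⟩
        simp only at h1 h2
        exact h (Prod.ext (Fin.ext h1) (Fin.ext (by simp only; omega)))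
      · simp
    · rw [if_neg hm]
      refine Finset.sum_eq_zero fun b _ => if_neg (by omega)

theorem LM_surj {ℓ k d : ℕ} (hlk : ℓ < k) (a : Fin ℓ × Fin (Edeg ℓ d + d + 1)) :
    ∃ h, (LM (d := d) (pzero (k := k) d)).mulVec h = Pi.single a 1 := by
  obtain ⟨i, q⟩ := a
  have hs : ∀ (r : Fin ℓ) (m : Fin (Edeg ℓ d + d + 1)), (Pi.single (i, q) 1 : Fin ℓ × Fin (Edeg ℓ d + d + 1) → ℂ) (r, m) =
      if r.1 = i.1 ∧ m.1 = q.1 then 1 else 0 := by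
    intro r m
    rw [Pi.single_apply]
    simp only [Prod.mk.injEq, Fin.ext_iff]
  by_cases hq : q.1 + i.1 * d ≤ Edeg ℓ d
  · obtain ⟨H, hH⟩ : ∃ H : ℕ → ℕ → ℂ, ∀ c j, H c j = if c ≤ i.1 ∧ j = q.1 + (i.1 - c) * d then ((-1)^(i.1 - c) : ℂ) else 0 := ⟨_, fun _ _ => rfl⟩
    refine ⟨fun b => H b.1.1 b.2.1, ?_⟩
    ext ⟨r, m⟩
    rw [LM_pzero hlk H, hs, hH, hH]
    · rcases lt_trichotomy r.1 i.1 with h | h | h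
      · obtain ⟨e, he⟩ : ∃ e, i.1 = r.1 + 1 + e := ⟨i.1 - (r.1+1), by omega⟩
        have e1 : i.1 - r.1 = e + 1 := by omega
        have e2 : i.1 - (r.1 + 1) = e := by omega
        rw [if_neg (fun h' : r.1 = i.1 ∧ m.1 = q.1 => by omega), e1, e2, add_mul, one_mul]
        by_cases hm : m.1 = q.1 + (e * d + d)
        · rw [if_pos ⟨by omega, hm⟩, if_pos (by omega), if_pos ⟨by omega, by omega⟩, pow_succ]; ring
        · rw [if_neg (fun h' => hm h'.2), zero_add]
          split_ifs with h1 h2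
          · exact absurd (by omega) hm
          · rfl
          · rfl
      · simp only [h, le_refl, true_and, Nat.sub_self, zero_mul, add_zero, pow_zero]
        rw [if_neg (fun h' : i.1 + 1 ≤ i.1 ∧ _ => by omega)]; simp
      · rw [if_neg (by omega), if_neg (fun h' : r.1 + 1 ≤ i.1 ∧ _ => by omega)]; simp; omega
    · intro c j hj
      rw [hH, if_neg]
      rintro ⟨h1, h2⟩
      have : (i.1 - c) * d ≤ i.1 * d := Nat.mul_le_mul_right _ (by omega)
      omega
  · have hq1 : d * (ℓ - i.1) ≤ q.1 := by
      have : d * (ℓ - i.1) + d * i.1 = d * ℓ := by rw [← mul_add]; congr 1; omega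
      have hE : Edeg ℓ d = d * ℓ + 1 := rfl
      have := mul_comm i.1 d
      omega
    obtain ⟨H, hH⟩ : ∃ H : ℕ → ℕ → ℂ, ∀ c j, H c j = if i.1 < c ∧ c ≤ ℓ ∧ j + (c - i.1) * d = q.1 then ((-1)^(c - i.1 - 1) : ℂ) else 0 := ⟨_, fun _ _ => rfl⟩
    refine ⟨fun b => H b.1.1 b.2.1, ?_⟩
    ext ⟨r, m⟩
    rw [LM_pzero hlk H, hs, hH, hH]
    · rcases lt_trichotomy r.1 i.1 with h | h | h
      · rw [if_neg (by omega), if_neg (fun h' : i.1 < r.1 + 1 ∧ _ => by omega)]; simp; omega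
      · have hd : d ≤ d * (ℓ - i.1) := Nat.le_mul_of_pos_right _ (by omega)
        rw [if_neg (by omega), h]
        have e1 : i.1 + 1 - i.1 = 1 := by omega
        simp only [e1, true_and, zero_add, one_mul]
        have hr := r.2
        by_cases hm : m.1 = q.1
        · rw [if_pos (by omega), if_pos (by omega), if_pos hm]; simp
        · rw [if_neg hm]
          split_ifs with h1 h2
          · omega
          · rfl
          · rfl
      · obtain ⟨e, he⟩ : ∃ e, r.1 = i.1 + 1 + e := ⟨r.1 - (i.1+1), by omega⟩
        obtain ⟨f, hf⟩ : ∃ f, ℓ = r.1 + 1 + f := ⟨ℓ - (r.1+1), by omega⟩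
        have e1 : r.1 - i.1 = e + 1 := by omega
        have e2 : r.1 + 1 - i.1 = e + 2 := by omega
        have e3 : ℓ - i.1 = e + 2 + f := by omega
        rw [if_neg (fun h' : r.1 = i.1 ∧ m.1 = q.1 => by omega), e1, e2]
        rw [e3] at hq1
        have e4 : d * (e + 2 + f) = d * e + 2 * d + d * f := by ring
        have e5 : (e+1)*d = d * e + d := by ring
        have e6 : (e+2)*d = d * e + 2 * d := by ring
        rw [e5, e6]
        by_cases hm : m.1 + (d * e + d) = q.1
        · rw [if_pos ⟨by omega, by omega, hm⟩, if_pos (by omega), if_pos ⟨by omega, by omega, by omega⟩,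
            show e + 2 - 1 = e + 1 by omega, show e + 1 - 1 = e by omega, pow_succ]; ring
        · rw [if_neg (fun h' => hm h'.2.2), zero_add]
          split_ifs with h1 h2
          · exact absurd (by omega) hm
          · rfl
          · rfl
    · intro c j hj
      rw [hH, if_neg]
      rintro ⟨h1, h2, h3⟩
      have : d ≤ (c - i.1) * d := Nat.le_mul_of_pos_left _ (by omega)
      have := q.2
      omega

theorem univ_generic {ℓ k : ℕ} (d : ℕ) (hlk : ℓ < k) :
    ∃ F : MvPolynomial (Fin ℓ × Fin k × Fin (d+1)) ℂ, F ≠ 0 ∧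
      ∀ p : Fin ℓ × Fin k × Fin (d+1) → ℂ, eval p F ≠ 0 → ∀ a, ∃ h,
        (LM (d := d) (fun r c q => if hq : q < d + 1 then p (r, c, ⟨q, hq⟩) else 0)).mulVec h = Pi.single a 1 := by
  choose h0 hh0 using fun a => LM_surj (d := d) hlk a
  set R0 : Matrix (Fin k × Fin (Edeg ℓ d + 1)) (Fin ℓ × Fin (Edeg ℓ d + d + 1)) ℂ := fun b a => h0 a b with hR0
  set G : Matrix (Fin ℓ × Fin (Edeg ℓ d + d + 1)) (Fin k × Fin (Edeg ℓ d + 1)) (MvPolynomial (Fin ℓ × Fin k × Fin (d+1)) ℂ) :=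
    LM (d := d) (fun r c q => if hq : q < d + 1 then X (r, c, ⟨q, hq⟩) else 0) with hG
  set R1 : Matrix (Fin k × Fin (Edeg ℓ d + 1)) (Fin ℓ × Fin (Edeg ℓ d + d + 1)) (MvPolynomial (Fin ℓ × Fin k × Fin (d+1)) ℂ) :=
    fun b a => C (R0 b a) with hR1
  have hev : ∀ p : Fin ℓ × Fin k × Fin (d+1) → ℂ, eval p (G * R1).det =
      (LM (d := d) (fun r c q => if hq : q < d + 1 then p (r, c, ⟨q, hq⟩) else 0) * R0).det := by
    intro p
    rw [RingHom.map_det, RingHom.mapMatrix_apply, Matrix.map_mul]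
    congr 2
    · ext a b
      simp only [hG, LM, Matrix.map_apply]
      split_ifs <;> simp
    · ext a b
      rw [Matrix.map_apply]
      exact eval_C _
  refine ⟨(G * R1).det, fun h => ?_, fun p hp a => ?_⟩
  · have h1 := hev (fun v => pzero d v.1 v.2.1 v.2.2.1)
    rw [h, map_zero] at h1
    have h2 : LM (ℓ := ℓ) (k := k) (d := d) (fun r c q => if hq : q < d + 1 then pzero d r c q else 0) =
        LM (d := d) (pzero (k := k) d) := by
      ext a b
      simp only [LM]
      split_ifs with h3 h4
      · rfl
      · rw [pzero, if_neg (by omega), if_neg (by omega), add_zero]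
      · rfl
    have h3 : LM (d := d) (pzero (ℓ := ℓ) (k := k) d) * R0 = 1 := by
      ext a b
      have := congrFun (hh0 b) a
      rw [Matrix.mul_apply]
      rw [Matrix.mulVec, dotProduct] at this
      rw [Matrix.one_apply, ← Pi.single_apply, ← this]
    rw [h2, h3, Matrix.det_one] at h1
    exact zero_ne_one h1
  · rw [hev] at hp
    set L := LM (d := d) (fun r c q => if hq : q < d + 1 then p (r, c, ⟨q, hq⟩) else 0) with hL
    refine ⟨R0.mulVec ((L * R0)⁻¹.mulVec (Pi.single a 1)), ?_⟩
    rw [Matrix.mulVec_mulVec, Matrix.mulVec_mulVec, Matrix.mul_nonsing_inv _ (isUnit_iff_ne_zero.2 hp), Matrix.one_mulVec]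

end univ

set_option autoImplicit false
open MvPolynomial Filter Topology

section head

theorem head_mul {n ℓ k d : ℕ} (x y : AA n) (p : Fin ℓ → Fin k → ℕ → ℂ) (hp : ∀ r c q, d < q → p r c q = 0)
    {h : Fin k × Fin (Edeg ℓ d + 1) → ℂ} {a : Fin ℓ × Fin (Edeg ℓ d + d + 1)}
    (hh : (LM (d := d) p).mulVec h = Pi.single a 1) (r : Fin ℓ) :
    ∑ c, (∑ q ∈ Finset.range (d+1), C (p r c q) * (x^q * y^(d-q))) *
      (∑ t : Fin (Edeg ℓ d + 1), C (h (c, t)) * (x^t.1 * y^(Edeg ℓ d - t.1))) =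
      if r = a.1 then x^a.2.1 * y^(Edeg ℓ d + d - a.2.1) else 0 := by
  have h1 : (if r = a.1 then x^a.2.1 * y^(Edeg ℓ d + d - a.2.1) else 0) =
      ∑ m : Fin (Edeg ℓ d + d + 1), C ((Pi.single a 1 : Fin ℓ × Fin (Edeg ℓ d + d + 1) → ℂ) (r, m)) *
        (x^m.1 * y^(Edeg ℓ d + d - m.1)) := by
    rw [Finset.sum_eq_single a.2]
    · rw [Pi.single_apply]
      by_cases hr : r = a.1
      · rw [if_pos hr, if_pos (show (r, a.2) = a from Prod.ext hr rfl)]; simp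
      · rw [if_neg hr, if_neg (fun h => hr (congrArg Prod.fst h))]; simp
    · intro m _ hm
      rw [Pi.single_apply, if_neg (fun h => hm (congrArg Prod.snd h))]; simp
    · simp
  rw [h1, ← hh]
  have h2 : ∀ m : Fin (Edeg ℓ d + d + 1), C ((LM (d := d) p).mulVec h (r, m)) * (x^m.1 * y^(Edeg ℓ d + d - m.1)) =
      ∑ c, ∑ t, C (h (c, t)) * (C (LM (d := d) p (r, m) (c, t)) * (x^m.1 * y^(Edeg ℓ d + d - m.1))) := by
    intro m
    rw [Matrix.mulVec, dotProduct, Fintype.sum_prod_type, map_sum, Finset.sum_mul]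
    refine Finset.sum_congr rfl fun c _ => ?_
    rw [map_sum, Finset.sum_mul]
    refine Finset.sum_congr rfl fun t _ => ?_
    rw [map_mul]; ring
  rw [Finset.sum_congr rfl fun m _ => h2 m, Finset.sum_comm]
  refine Finset.sum_congr rfl fun c _ => ?_
  rw [Finset.sum_comm, Finset.mul_sum]
  refine Finset.sum_congr rfl fun t _ => ?_
  rw [← Finset.mul_sum]
  have h3 : ∑ m : Fin (Edeg ℓ d + d + 1), (C (LM (d := d) p (r, m) (c, t)) * (x^m.1 * y^(Edeg ℓ d + d - m.1)) : AA n) =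
      ∑ m ∈ Finset.range (Edeg ℓ d + d + 1), (if t.1 ≤ m then C (p r c (m - t.1)) * (x^m * y^(Edeg ℓ d + d - m)) else 0) := by
    rw [Finset.sum_range]
    refine Finset.sum_congr rfl fun m _ => ?_
    simp only [LM]
    split_ifs <;> simp
  have ht := t.2
  rw [h3, ← Finset.sum_subset (s₁ := (Finset.range (d+1)).image (fun q => q + t.1)) (s₂ := Finset.range (Edeg ℓ d + d + 1))]
  · rw [Finset.sum_image (fun a _ b _ h => by simpa using h), Finset.sum_mul, Finset.mul_sum]
    refine Finset.sum_congr rfl fun q hq => ?_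
    rw [Finset.mem_range] at hq
    rw [if_pos (by omega), Nat.add_sub_cancel, pow_add,
      show Edeg ℓ d + d - (q + t.1) = (d - q) + (Edeg ℓ d - t.1) by omega, pow_add]
    ring
  · intro m hm
    simp only [Finset.mem_image, Finset.mem_range] at hm ⊢
    obtain ⟨q, hq, rfl⟩ := hm
    omega
  · intro m _ hm
    simp only [Finset.mem_image, Finset.mem_range, not_exists, not_and] at hm
    by_cases htm : t.1 ≤ m
    · rw [if_pos htm, hp, map_zero, zero_mul]
      by_contra hc
      exact hm (m - t.1) (by omega) (by omega)
    · rw [if_neg htm]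

end head

section low
variable {n : ℕ}

def Low (i j : Fin n) (D : ℕ) (p : AA n) : Prop := ∀ m, coeff m p ≠ 0 → m i + m j < D ∧ m.degree ≤ D

theorem deg_ge {i j : Fin n} (hij : i ≠ j) (m : Fin n →₀ ℕ) : m i + m j ≤ m.degree := by
  rw [Finsupp.degree_eq_sum, ← Finset.sum_pair hij]
  exact Finset.sum_le_sum_of_subset (Finset.subset_univ _)

theorem deg_le_of_coeff {p : AA n} {D : ℕ} (h : p.totalDegree ≤ D) {m : Fin n →₀ ℕ} (hm : coeff m p ≠ 0) : m.degree ≤ D := by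
  refine le_trans ?_ h
  exact le_totalDegree (mem_support_iff.2 hm)

theorem totalDegree_le_of {p : AA n} {D : ℕ} (h : ∀ m, coeff m p ≠ 0 → m.degree ≤ D) : p.totalDegree ≤ D :=
  Finset.sup_le fun m hm => h m (mem_support_iff.1 hm)

theorem Low.add {i j : Fin n} {D : ℕ} {p q : AA n} (hp : Low i j D p) (hq : Low i j D q) : Low i j D (p + q) := by
  intro m hm
  rw [coeff_add] at hm
  by_cases h : coeff m p = 0
  · exact hq m (by simpa [h] using hm)
  · exact hp m h

theorem Low.sum {i j : Fin n} {D : ℕ} {ι : Type} (s : Finset ι) {p : ι → AA n} (hp : ∀ t ∈ s, Low i j D (p t)) :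
    Low i j D (∑ t ∈ s, p t) := by
  intro m hm
  rw [coeff_sum] at hm
  obtain ⟨t, ht, h⟩ := Finset.exists_ne_zero_of_sum_ne_zero hm
  exact hp t ht m h

theorem Low.mul {i j : Fin n} (hij : i ≠ j) {d E : ℕ} {p q : AA n} (hp : Low i j d p) (hq : q.totalDegree ≤ E) :
    Low i j (E + d) (p * q) := by
  intro m hm
  rw [coeff_mul] at hm
  obtain ⟨⟨m1, m2⟩, ht, h⟩ := Finset.exists_ne_zero_of_sum_ne_zero hm
  rw [Finset.HasAntidiagonal.mem_antidiagonal] at ht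
  have h1 := hp m1 (left_ne_zero_of_mul h)
  have h2 : m2.degree ≤ E := deg_le_of_coeff hq (right_ne_zero_of_mul h)
  have h3 := deg_ge hij m2
  simp only at ht
  rw [← ht, map_add, Finsupp.add_apply, Finsupp.add_apply]
  omega

theorem low_sub_head {i j : Fin n} (hij : i ≠ j) {d : ℕ} {p : AA n} (hp : p.totalDegree ≤ d) :
    Low i j d (p - ∑ q ∈ Finset.range (d+1), C (coeff (Finsupp.single i q + Finsupp.single j (d-q)) p) * (X i^q * X j^(d-q))) := by
  intro m hm
  have h1 : ∀ q, coeff m (C (coeff (Finsupp.single i q + Finsupp.single j (d-q)) p) * (X i^q * X j^(d-q)) : AA n) =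
      if Finsupp.single i q + Finsupp.single j (d-q) = m then coeff m p else 0 := by
    intro q
    rw [X_pow_eq_monomial, X_pow_eq_monomial, monomial_mul, C_mul_monomial, coeff_monomial]
    split_ifs with h
    · rw [h]; simp
    · rfl
  rw [coeff_sub, coeff_sum, Finset.sum_congr rfl fun q _ => h1 q] at hm
  by_cases h2 : ∃ q ∈ Finset.range (d+1), Finsupp.single i q + Finsupp.single j (d-q) = m
  · obtain ⟨q, hq, hqm⟩ := h2
    exfalso
    apply hm
    rw [Finset.sum_eq_single_of_mem q hq, if_pos hqm, sub_self]
    intro q' _ hq'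
    rw [if_neg]
    intro h
    apply hq'
    rw [← hqm] at h
    have := DFunLike.congr_fun h i
    simpa [hij, Finsupp.single_apply, hij.symm] using this
  · rw [Finset.sum_eq_zero, sub_zero] at hm
    · have hd := deg_le_of_coeff hp hm
      refine ⟨?_, hd⟩
      by_contra hc
      apply h2
      have h3 := deg_ge hij m
      refine ⟨m i, by rw [Finset.mem_range]; omega, ?_⟩
      have h4 : Finsupp.single i (m i) + Finsupp.single j (d - m i) ≤ m := by
        intro t
        rw [Finsupp.add_apply, Finsupp.single_apply, Finsupp.single_apply]
        split_ifs with h5 h6 h6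
        · exact absurd (h5.trans h6.symm) hij
        · rw [h5]; simp
        · rw [← h6]; omega
        · simp
      obtain ⟨e, he⟩ := exists_add_of_le h4
      have h5 := congrArg Finsupp.degree he
      simp only [map_add, Finsupp.degree_single] at h5
      have h6 : e = 0 := by rw [← Finsupp.degree_eq_zero_iff]; omega
      rw [h6, add_zero] at he
      exact he.symm
    · intro q hq
      rw [if_neg]
      exact fun h => h2 ⟨q, hq, h⟩

end low

set_option autoImplicit false
open MvPolynomial Filter Topology

section expand
variable {n : ℕ}

theorem mem_supported_of {T : Set (Fin n)} {p : AA n} (h : ∀ m, coeff m p ≠ 0 → ∀ t, m t ≠ 0 → t ∈ T) : p ∈ supported ℂ T := by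
  rw [mem_supported]
  intro t ht
  rw [Finset.mem_coe, mem_vars] at ht
  obtain ⟨m, hm, hmt⟩ := ht
  exact h m (mem_support_iff.1 hm) t (Finsupp.mem_support_iff.1 hmt)

theorem of_mem_supported {T : Set (Fin n)} {p : AA n} (h : p ∈ supported ℂ T) {m : Fin n →₀ ℕ} (hm : coeff m p ≠ 0) {t : Fin n}
    (ht : m t ≠ 0) : t ∈ T := by
  rw [mem_supported] at h
  exact h ((mem_vars t).2 ⟨m, mem_support_iff.2 hm, Finsupp.mem_support_iff.2 ht⟩)

theorem erase_add (i : Fin n) (m : Fin n →₀ ℕ) : m.erase i + Finsupp.single i (m i) = m := by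
  rw [Finsupp.erase_add_single]

theorem coeff_sum_monomial {ι : Type} (s : Finset ι) (e : ι → Fin n →₀ ℕ) (c : ι → ℂ) {m : Fin n →₀ ℕ}
    (h : coeff m (∑ t ∈ s, monomial (e t) (c t)) ≠ 0) : ∃ t ∈ s, e t = m := by
  rw [coeff_sum] at h
  obtain ⟨t, ht, h⟩ := Finset.exists_ne_zero_of_sum_ne_zero h
  rw [coeff_monomial] at h
  exact ⟨t, ht, by_contra fun h' => h (if_neg h')⟩

/-- expansion in one variable -/
theorem exists_coeffs (i : Fin n) {T : Set (Fin n)} {p : AA n} {q : ℕ} (hT : p ∈ supported ℂ T) (hq : p.totalDegree ≤ q) :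
    ∃ α : ℕ → AA n, p = ∑ f ∈ Finset.range (q+1), α f * X i ^ f ∧
      (∀ f, α f ∈ supported ℂ (T \ {i})) ∧ (∀ f ≤ q, (α f).totalDegree + f ≤ q) ∧
      α q = C (coeff (Finsupp.single i q) p) := by
  obtain ⟨α, hα⟩ : ∃ α : ℕ → AA n, ∀ f, α f = ∑ m ∈ p.support.filter (fun m => m i = f), monomial (m.erase i) (coeff m p) :=
    ⟨_, fun _ => rfl⟩
  have hdeg : ∀ m ∈ p.support, m.degree ≤ q := fun m hm => deg_le_of_coeff hq (mem_support_iff.1 hm)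
  have hdeg2 : ∀ m : Fin n →₀ ℕ, (m.erase i).degree + m i = m.degree := fun m => by
    conv_rhs => rw [← erase_add i m, map_add, Finsupp.degree_single]
  have hc : ∀ f m, coeff m (α f) ≠ 0 → ∃ m' ∈ p.support, m' i = f ∧ m'.erase i = m := by
    intro f m hm
    rw [hα] at hm
    obtain ⟨m', h1, h2⟩ := coeff_sum_monomial _ _ _ hm
    rw [Finset.mem_filter] at h1
    exact ⟨m', h1.1, h1.2, h2⟩
  have h1 : p = ∑ f ∈ Finset.range (q+1), α f * X i ^ f := by
    conv_lhs => rw [p.as_sum]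
    rw [← Finset.sum_fiberwise_of_maps_to (s := p.support) (t := Finset.range (q+1)) (g := fun m => m i)]
    · refine Finset.sum_congr rfl fun f _ => ?_
      rw [hα, Finset.sum_mul]
      refine Finset.sum_congr rfl fun m hm => ?_
      rw [Finset.mem_filter] at hm
      rw [X_pow_eq_monomial, monomial_mul, mul_one, ← hm.2, erase_add]
    · intro m hm
      rw [Finset.mem_range]
      have := hdeg2 m
      have := hdeg m hm
      omega
  refine ⟨α, h1, ?_, ?_, ?_⟩
  · intro f
    refine mem_supported_of fun m hm t ht => ?_
    obtain ⟨m', h2, h3, h4⟩ := hc f m hm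
    by_cases hti : t = i
    · rw [hti, ← h4, Finsupp.erase_same] at ht
      exact absurd rfl ht
    · rw [← h4, Finsupp.erase_ne hti] at ht
      exact ⟨of_mem_supported hT (mem_support_iff.1 h2) ht, hti⟩
  · intro f hf
    have : (α f).totalDegree ≤ q - f := by
      refine totalDegree_le_of fun m hm => ?_
      obtain ⟨m', h2, h3, h4⟩ := hc f m hm
      have := hdeg m' h2
      have := hdeg2 m'
      rw [h4] at this
      omega
    omega
  · have h5 : ∀ m ∈ p.support, m i = q → m = Finsupp.single i q := by
      intro m hm hmi
      have h6 := hdeg m hm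
      have h7 := hdeg2 m
      have h8 : m.erase i = 0 := by rw [← Finsupp.degree_eq_zero_iff]; omega
      rw [← erase_add i m, h8, zero_add, hmi]
    rw [hα]
    by_cases h0 : coeff (Finsupp.single i q) p = 0
    · rw [h0, map_zero]
      refine Finset.sum_eq_zero fun m hm => ?_
      rw [Finset.mem_filter] at hm
      rw [h5 m hm.1 hm.2, h0, map_zero]
    · rw [Finset.sum_eq_single_of_mem (Finsupp.single i q)]
      · simp
      · rw [Finset.mem_filter]
        exact ⟨mem_support_iff.2 h0, by simp⟩
      · intro m hm hne
        rw [Finset.mem_filter] at hm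
        exact absurd (h5 m hm.1 hm.2) hne

theorem exists_HD {i : Fin n} {T : Set (Fin n)} {p : AA n} {q : ℕ} (hT : p ∈ supported ℂ T) (hq : p.totalDegree ≤ q)
    (h1 : coeff (Finsupp.single i q) p = 1) : ∃ α, HD i T q p α := by
  obtain ⟨α, h2, h3, h4, h5⟩ := exists_coeffs i hT hq
  refine ⟨α, ?_, fun f hf => ⟨h3 f, h4 f hf.le⟩⟩
  rw [h1, map_one] at h5
  conv_lhs => rw [h2, Finset.sum_range_succ, h5, one_mul, add_comm]

abbrev GS (D : ℕ) : Type := {x : ℕ × ℕ // x ∈ (Finset.range D ×ˢ Finset.range D).filter (fun x => x.1 + x.2 < D)}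

theorem GS.lt {D : ℕ} (x : GS D) : x.1.1 + x.1.2 < D := (Finset.mem_filter.1 x.2).2

theorem GS.mk_mem {D : ℕ} {a b : ℕ} (h : a + b < D) : (a, b) ∈ (Finset.range D ×ˢ Finset.range D).filter (fun x => x.1 + x.2 < D) := by
  rw [Finset.mem_filter, Finset.mem_product, Finset.mem_range, Finset.mem_range]
  exact ⟨⟨by simp only; omega, by simp only; omega⟩, h⟩

theorem Low.expand {i j : Fin n} (hij : i ≠ j) {D : ℕ} {p : AA n} (hp : Low i j D p) :
    ∃ w : GS D → AA n, p = ∑ x, w x * (X i ^ x.1.1 * X j ^ x.1.2) ∧ (∀ x, w x ∈ supported ℂ ({i, j}ᶜ : Set (Fin n))) ∧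
      ∀ x, (w x).totalDegree + (x.1.1 + x.1.2) ≤ D := by
  have hdeg2 : ∀ m : Fin n →₀ ℕ, ((m.erase i).erase j).degree + m i + m j = m.degree := fun m => by
    conv_rhs => rw [← erase_add i m, map_add, Finsupp.degree_single, ← erase_add j (m.erase i), map_add, Finsupp.degree_single,
      Finsupp.erase_ne hij.symm]
    omega
  obtain ⟨w, hw⟩ : ∃ w : ℕ × ℕ → AA n, ∀ x, w x = ∑ m ∈ p.support.filter (fun m => (m i, m j) = x), monomial ((m.erase i).erase j) (coeff m p) :=
    ⟨_, fun _ => rfl⟩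
  have hc : ∀ f m, coeff m (w f) ≠ 0 → ∃ m' ∈ p.support, (m' i, m' j) = f ∧ (m'.erase i).erase j = m := by
    intro f m hm
    rw [hw] at hm
    obtain ⟨m', h1, h2⟩ := coeff_sum_monomial _ _ _ hm
    rw [Finset.mem_filter] at h1
    exact ⟨m', h1.1, h1.2, h2⟩
  refine ⟨fun x => w x.1, ?_, ?_, ?_⟩
  · rw [Finset.sum_coe_sort ((Finset.range D ×ˢ Finset.range D).filter (fun x => x.1 + x.2 < D)) (fun x : ℕ × ℕ => w x * (X i ^ x.1 * X j ^ x.2))]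
    conv_lhs => rw [p.as_sum]
    rw [← Finset.sum_fiberwise_of_maps_to (s := p.support) (t := (Finset.range D ×ˢ Finset.range D).filter (fun x => x.1 + x.2 < D))
      (g := fun m => (m i, m j))]
    · refine Finset.sum_congr rfl fun f _ => ?_
      rw [hw, Finset.sum_mul]
      refine Finset.sum_congr rfl fun m hm => ?_
      rw [Finset.mem_filter] at hm
      rw [X_pow_eq_monomial, X_pow_eq_monomial, monomial_mul, monomial_mul, mul_one, mul_one, ← hm.2]
      congr 1
      rw [add_comm (Finsupp.single i _), ← add_assoc]
      conv_lhs => rw [← erase_add i m, ← erase_add j (m.erase i), Finsupp.erase_ne hij.symm]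
    · intro m hm
      exact GS.mk_mem (hp m (mem_support_iff.1 hm)).1
  · intro f
    refine mem_supported_of fun m hm t ht => ?_
    obtain ⟨m', h2, h3, h4⟩ := hc _ m hm
    rw [← h4] at ht
    simp only [Set.mem_compl_iff, Set.mem_insert_iff, Set.mem_singleton_iff, not_or]
    constructor
    · rintro rfl
      rw [Finsupp.erase_ne hij, Finsupp.erase_same] at ht
      exact ht rfl
    · rintro rfl
      rw [Finsupp.erase_same] at ht
      exact ht rfl
  · intro x
    have hx := x.lt
    have : (w x.1).totalDegree ≤ D - (x.1.1 + x.1.2) := by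
      refine totalDegree_le_of fun m hm => ?_
      obtain ⟨m', h2, h3, h4⟩ := hc _ m hm
      have h5 := (hp m' (mem_support_iff.1 h2)).2
      have h6 := hdeg2 m'
      rw [h4] at h6
      rw [← h3]
      simp only
      omega
    beta_reduce
    omega

end expand

section dets
variable {n : ℕ}

theorem det_smul_mem {γ V : Type} [Fintype γ] [DecidableEq γ] {R : Type} [CommRing R] [AddCommGroup V] [Module R V] (W : Submodule R V)
    (N : Matrix γ γ R) (vec : γ → V) (h : ∀ g, ∑ g', N g g' • vec g' ∈ W) (g0 : γ) : N.det • vec g0 ∈ W := by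
  have h1 : N.det • vec g0 = ∑ g, N.adjugate g0 g • ∑ g', N g g' • vec g' := by
    simp_rw [Finset.smul_sum, smul_smul]
    rw [Finset.sum_comm]
    simp_rw [← Finset.sum_smul]
    have h2 : ∀ g', ∑ g, N.adjugate g0 g * N g g' = if g0 = g' then N.det else 0 := by
      intro g'
      rw [← Matrix.mul_apply, Matrix.adjugate_mul, Matrix.smul_apply, Matrix.one_apply]
      simp
    simp_rw [h2, ite_smul, zero_smul]
    simp
  rw [h1]
  exact Submodule.sum_mem _ fun g _ => Submodule.smul_mem _ _ (h g)

theorem det_mem {γ : Type} [Fintype γ] [DecidableEq γ] (S : Subalgebra ℂ (AA n)) (N : Matrix γ γ (AA n)) (h : ∀ g g', N g g' ∈ S) : N.det ∈ S := by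
  rw [Matrix.det_apply]
  refine Subalgebra.sum_mem _ fun σ _ => ?_
  have : ∏ g, N (σ g) g ∈ S := Subalgebra.prod_mem _ fun g _ => h _ _
  rcases Int.units_eq_one_or (Equiv.Perm.sign σ) with h | h
  · rw [h, one_smul]; exact this
  · rw [h, Units.neg_smul, one_smul]; exact Subalgebra.neg_mem _ this

theorem det_deg {γ : Type} [Fintype γ] [DecidableEq γ] (N : Matrix γ γ (AA n)) (wt : γ → ℕ)
    (h : ∀ g g', N g g' ≠ 0 → (N g g').totalDegree + wt g' ≤ wt g + 1) : N.det.totalDegree ≤ Fintype.card γ := by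
  rw [Matrix.det_apply]
  refine totalDegree_finsetSum_le fun σ _ => ?_
  have h1 : (∏ g, N (σ g) g).totalDegree ≤ Fintype.card γ := by
    by_cases h0 : ∀ g, N (σ g) g ≠ 0
    · refine (totalDegree_finset_prod _ _).trans ?_
      have h2 := Finset.sum_le_sum fun g (_ : g ∈ Finset.univ) => h _ _ (h0 g)
      rw [Finset.sum_add_distrib, Finset.sum_add_distrib, Equiv.sum_comp σ wt] at h2
      simp at h2
      omega
    · push Not at h0
      obtain ⟨g, hg⟩ := h0
      rw [Finset.prod_eq_zero (f := fun g => N (σ g) g) (Finset.mem_univ g) hg]; simp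
  rcases Int.units_eq_one_or (Equiv.Perm.sign σ) with h | h
  · rw [h, one_smul]; exact h1
  · rw [h, Units.neg_smul, one_smul, totalDegree_neg]; exact h1

theorem det_expand0 {γ : Type} [Fintype γ] [DecidableEq γ] {R S : Type} [CommRing R] [CommRing S] [Nontrivial R] (φ : S →+* R) (M : Matrix γ γ R)
    (M0 : Matrix γ γ S) (hM : M = M0.map φ) (x : R) :
    (x • (1 : Matrix γ γ R) - M).det = x ^ Fintype.card γ + ∑ f ∈ Finset.range (Fintype.card γ), φ (M0.charpoly.coeff f) * x ^ f := by
  have h2 : x • (1 : Matrix γ γ R) = Matrix.scalar γ x := by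
    rw [Matrix.scalar_apply, Matrix.smul_one_eq_diagonal]
  rw [h2, ← Matrix.eval_charpoly]
  conv_lhs => rw [(Matrix.charpoly_monic M).as_sum, Matrix.charpoly_natDegree_eq_dim]
  rw [Polynomial.eval_add, Polynomial.eval_finset_sum]
  simp only [Polynomial.eval_pow, Polynomial.eval_X, Polynomial.eval_mul, Polynomial.eval_C]
  congr 1
  refine Finset.sum_congr rfl fun f _ => ?_
  rw [hM, Matrix.charpoly_map, Polynomial.coeff_map]

theorem det_expand {γ : Type} [Fintype γ] [DecidableEq γ] (S : Subalgebra ℂ (AA n)) (M : Matrix γ γ (AA n)) (h : ∀ g g', M g g' ∈ S) (x : AA n) :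
    ∃ α : ℕ → AA n, (∀ f, α f ∈ S) ∧
      (x • (1 : Matrix γ γ (AA n)) - M).det = x ^ Fintype.card γ + ∑ f ∈ Finset.range (Fintype.card γ), α f * x ^ f :=
  ⟨_, fun f => SetLike.coe_mem _, det_expand0 (S.val : S →+* AA n) M (fun g g' => ⟨M g g', h g g'⟩) rfl x⟩

end dets

set_option autoImplicit false
open MvPolynomial Filter Topology

section pair
variable {n ℓ k d : ℕ}

/-- genericity in the directions `i, j` -/
def Gen (d : ℕ) (P : Matrix (Fin ℓ) (Fin k) (AA n)) (i j : Fin n) : Prop :=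
  ∀ a, ∃ h, (LM (d := d) (fun r c q => if q < d + 1 then coeff (Finsupp.single i q + Finsupp.single j (d-q)) (P r c) else 0)).mulVec h = Pi.single a 1

theorem mult_deg {i j : Fin n} {E : ℕ} (h : Fin (E+1) → ℂ) :
    (∑ t : Fin (E + 1), C (h t) * (X i^t.1 * X j^(E - t.1)) : AA n).totalDegree ≤ E := by
  refine totalDegree_finsetSum_le fun t _ => ?_
  refine (totalDegree_mul _ _).trans ?_
  rw [totalDegree_C, zero_add]
  refine (totalDegree_mul _ _).trans ?_
  rw [totalDegree_X_pow, totalDegree_X_pow]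
  omega

theorem rel_low {i j : Fin n} (hij : i ≠ j) {P : Matrix (Fin ℓ) (Fin k) (AA n)} (hP : ∀ r c, (P r c).totalDegree ≤ d)
    (hg : Gen d P i j) (a : Fin ℓ × Fin (Edeg ℓ d + d + 1)) :
    ∃ L : Fin ℓ → AA n, (∀ r, Low i j (Edeg ℓ d + d) (L r)) ∧
      (fun r => (if r = a.1 then X i^a.2.1 * X j^(Edeg ℓ d + d - a.2.1) else 0) + L r) ∈ LinearMap.range P.mulVecLin := by
  obtain ⟨h, hh⟩ := hg a
  have h1 := head_mul (X i : AA n) (X j) _ (fun r c q hq => if_neg (by omega)) hh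
  obtain ⟨v, hv⟩ : ∃ v : Fin k → AA n, ∀ c, v c = ∑ t : Fin (Edeg ℓ d + 1), C (h (c, t)) * (X i^t.1 * X j^(Edeg ℓ d - t.1)) := ⟨_, fun _ => rfl⟩
  refine ⟨fun r => ∑ c, (P r c - ∑ q ∈ Finset.range (d+1), C (coeff (Finsupp.single i q + Finsupp.single j (d-q)) (P r c)) * (X i^q * X j^(d-q))) * v c,
    fun r => Low.sum _ fun c _ => Low.mul hij (low_sub_head hij (hP r c)) ?_, ⟨v, ?_⟩⟩
  · rw [hv]; exact mult_deg _
  · ext1 r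
    rw [← h1 r, ← Finset.sum_add_distrib, Matrix.mulVecLin_apply, Matrix.mulVec, dotProduct]
    refine Finset.sum_congr rfl fun c _ => ?_
    rw [← hv, ← add_mul]
    congr 1
    rw [Finset.sum_congr rfl (g := fun q => C (coeff (Finsupp.single i q + Finsupp.single j (d-q)) (P r c)) * (X i^q * X j^(d-q)))]
    · ring
    · intro q hq
      rw [if_pos (Finset.mem_range.1 hq)]

def vecG (i j : Fin n) {D : ℕ} (g : Fin ℓ × GS D) : Fin ℓ → AA n := Pi.single g.1 (X i ^ g.2.1.1 * X j ^ g.2.1.2)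

theorem rel_row {i j : Fin n} (hij : i ≠ j) {P : Matrix (Fin ℓ) (Fin k) (AA n)} (hP : ∀ r c, (P r c).totalDegree ≤ d)
    (hg : Gen d P i j) (g : Fin ℓ × GS (Edeg ℓ d + d)) :
    ∃ M : Fin ℓ × GS (Edeg ℓ d + d) → AA n, (∀ g', M g' ∈ supported ℂ ({i, j}ᶜ : Set (Fin n))) ∧
      (∀ g', M g' ≠ 0 → (M g').totalDegree + (g'.2.1.1 + g'.2.1.2) ≤ g.2.1.1 + g.2.1.2 + 1) ∧
      (X i : AA n) • vecG i j g - ∑ g', M g' • vecG i j g' ∈ LinearMap.range P.mulVecLin := by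
  obtain ⟨r0, ⟨⟨q1, q2⟩, hx⟩⟩ := g
  have hlt := GS.lt ⟨(q1, q2), hx⟩
  simp only at hlt ⊢
  by_cases hD : q1 + 1 + q2 < Edeg ℓ d + d
  · refine ⟨Pi.single (r0, ⟨(q1+1, q2), GS.mk_mem hD⟩) 1, ?_, ?_, ?_⟩
    · intro g'
      rw [Pi.single_apply]
      split_ifs
      · exact Subalgebra.one_mem _
      · exact Subalgebra.zero_mem _
    · intro g' hg'
      rw [Pi.single_apply] at hg' ⊢
      split_ifs at hg' ⊢ with h
      · rw [h]; simp; omega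
      · exact absurd rfl hg'
    · rw [Finset.sum_eq_single (r0, ⟨(q1+1, q2), GS.mk_mem hD⟩)]
      · rw [Pi.single_eq_same, one_smul, vecG, vecG, ← Pi.single_smul, smul_eq_mul, ← mul_assoc, ← pow_succ', sub_self]
        exact Submodule.zero_mem _
      · intro g' _ h
        rw [Pi.single_eq_of_ne h, zero_smul]
      · simp
  · obtain ⟨L, hL1, hL2⟩ := rel_low hij hP hg (r0, ⟨q1 + 1, by omega⟩)
    choose w hw1 hw2 hw3 using fun r => (hL1 r).expand hij
    refine ⟨fun g' => - w g'.1 g'.2, fun g' => Subalgebra.neg_mem _ (hw2 _ _), fun g' _ => ?_, ?_⟩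
    · rw [totalDegree_neg]
      have := hw3 g'.1 g'.2
      omega
    · convert hL2 using 1
      ext1 r
      simp only [neg_smul, Finset.sum_neg_distrib, sub_neg_eq_add]
      rw [Pi.add_apply, Finset.sum_apply, Fintype.sum_prod_type]
      congr 1
      · rw [vecG, ← Pi.single_smul, smul_eq_mul, ← mul_assoc, ← pow_succ', Pi.single_apply,
          show Edeg ℓ d + d - (q1 + 1) = q2 by omega]
      · rw [Finset.sum_eq_single r]
        · conv_rhs => rw [hw1 r]
          refine Finset.sum_congr rfl fun x _ => ?_
          rw [vecG, Pi.smul_apply, Pi.single_eq_same, smul_eq_mul]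
        · intro r' _ hr'
          refine Finset.sum_eq_zero fun x _ => ?_
          rw [vecG, Pi.smul_apply, Pi.single_eq_of_ne hr'.symm, smul_zero]
        · simp

theorem coeff_lead {i : Fin n} {q : ℕ} {a : AA n} {α : ℕ → AA n} (hα : ∀ f, α f ∈ supported ℂ ({i}ᶜ : Set (Fin n)))
    (ha : a = X i ^ q + ∑ f ∈ Finset.range q, α f * X i ^ f) : coeff (Finsupp.single i q) a = 1 := by
  rw [ha, coeff_add, coeff_sum, Finset.sum_eq_zero, add_zero, X_pow_eq_monomial, coeff_monomial, if_pos rfl]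
  intro f hf
  rw [Finset.mem_range] at hf
  rw [X_pow_eq_monomial, coeff_mul_monomial']
  split_ifs with h
  · rw [mul_one]
    by_contra h0
    refine of_mem_supported (hα f) h0 (t := i) ?_ rfl
    rw [Finsupp.tsub_apply, Finsupp.single_eq_same, Finsupp.single_eq_same]
    omega
  · rfl

theorem pair_det {i j : Fin n} (hij : i ≠ j) {P : Matrix (Fin ℓ) (Fin k) (AA n)} (hP : ∀ r c, (P r c).totalDegree ≤ d)
    (hg : Gen d P i j) :
    ∃ (a : AA n) (Q : Matrix (Fin k) (Fin ℓ) (AA n)), P * Q = a • (1 : Matrix (Fin ℓ) (Fin ℓ) (AA n)) ∧ a ∈ supported ℂ ({j}ᶜ : Set (Fin n)) ∧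
      a.totalDegree ≤ Fintype.card (Fin ℓ × GS (Edeg ℓ d + d)) ∧
      coeff (Finsupp.single i (Fintype.card (Fin ℓ × GS (Edeg ℓ d + d)))) a = 1 := by
  choose M hM1 hM2 hM3 using rel_row hij hP hg
  obtain ⟨N, hN⟩ : ∃ N : Matrix (Fin ℓ × GS (Edeg ℓ d + d)) (Fin ℓ × GS (Edeg ℓ d + d)) (AA n),
    N = (X i : AA n) • (1 : Matrix (Fin ℓ × GS (Edeg ℓ d + d)) (Fin ℓ × GS (Edeg ℓ d + d)) (AA n)) - Matrix.of M := ⟨_, rfl⟩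
  have hN1 : ∀ g g', N g g' = (if g = g' then X i else 0) - M g g' := by
    intro g g'
    rw [hN, Matrix.sub_apply, Matrix.smul_apply, Matrix.one_apply]
    simp
  have hdet : ∀ r, N.det • (Pi.single r 1 : Fin ℓ → AA n) ∈ LinearMap.range P.mulVecLin := by
    intro r
    have hE : Edeg ℓ d = d * ℓ + 1 := rfl
    have h := det_smul_mem (LinearMap.range P.mulVecLin) N (vecG i j) (fun g => ?_) (r, ⟨(0, 0), GS.mk_mem (by omega)⟩)
    · rw [vecG, pow_zero, pow_zero, one_mul] at h
      exact h
    · convert hM3 g using 1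
      simp only [hN1, sub_smul, Finset.sum_sub_distrib, ite_smul, zero_smul]
      simp
  choose Q hQ using hdet
  refine ⟨N.det, Matrix.of fun c r => Q r c, ?_, ?_, ?_, ?_⟩
  · ext1 r r'
    have := congrFun (hQ r') r
    rw [Matrix.mulVecLin_apply, Matrix.mulVec, dotProduct] at this
    rw [Matrix.mul_apply]
    simp only [Matrix.of_apply]
    rw [this, Pi.smul_apply, Matrix.smul_apply, Matrix.one_apply, Pi.single_apply]
  · refine det_mem _ _ fun g g' => ?_
    rw [hN1]
    refine Subalgebra.sub_mem _ ?_ (supported_mono (fun x hx => ?_) (hM1 g g'))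
    · split_ifs
      · exact X_mem_supported.2 hij
      · exact Subalgebra.zero_mem _
    · simp only [Set.mem_compl_iff, Set.mem_insert_iff, Set.mem_singleton_iff, not_or] at hx ⊢
      exact hx.2
  · refine det_deg _ (fun g => g.2.1.1 + g.2.1.2) fun g g' h => ?_
    rw [hN1] at h ⊢
    have hmax := totalDegree_sub (if g = g' then (X i : AA n) else 0) (M g g')
    by_cases hMz : M g g' = 0
    · rw [hMz, sub_zero] at h ⊢
      by_cases hgg : g = g'
      · rw [if_pos hgg, hgg, totalDegree_X]; omega
      · rw [if_neg hgg] at h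
        exact absurd rfl h
    · have h3 := hM2 g g' hMz
      by_cases hgg : g = g'
      · rw [if_pos hgg, totalDegree_X] at hmax
        rw [if_pos hgg]
        rw [← hgg] at h3 hmax ⊢
        have := max_le_iff.1 (le_refl (max 1 (totalDegree (M g g))))
        rcases max_choice 1 (totalDegree (M g g)) with h4 | h4 <;> rw [h4] at hmax <;> omega
      · rw [if_neg hgg, zero_sub, totalDegree_neg]
        exact h3
  · obtain ⟨α, h1, h2⟩ := det_expand (supported ℂ ({i, j}ᶜ : Set (Fin n))) (Matrix.of M) hM1 (X i)
    refine coeff_lead (fun f => supported_mono (fun x hx => ?_) (h1 f)) (by rw [hN]; exact h2)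
    simp only [Set.mem_compl_iff, Set.mem_insert_iff, Set.mem_singleton_iff, not_or] at hx ⊢
    exact hx.1

end pair

set_option autoImplicit false
open MvPolynomial Filter Topology

section cj
variable {n : ℕ}

/-- reducible modulo `I` -/
def Red (I : Ideal (AA n)) (S : Subalgebra ℂ (AA n)) (x : AA n) (q : ℕ) (p : AA n) : Prop :=
  ∃ w : Fin q → AA n, (∀ u, w u ∈ S) ∧ p - ∑ u, w u * x ^ u.1 ∈ I

variable {I : Ideal (AA n)} {S : Subalgebra ℂ (AA n)} {x : AA n} {q : ℕ}

theorem Red.zero : Red I S x q 0 := ⟨0, fun _ => Subalgebra.zero_mem _, by simp⟩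

theorem Red.add {p p' : AA n} (h : Red I S x q p) (h' : Red I S x q p') : Red I S x q (p + p') := by
  obtain ⟨w, h1, h2⟩ := h
  obtain ⟨w', h1', h2'⟩ := h'
  refine ⟨w + w', fun u => Subalgebra.add_mem _ (h1 u) (h1' u), ?_⟩
  have := I.add_mem h2 h2'
  convert this using 1
  simp only [Pi.add_apply, add_mul, Finset.sum_add_distrib]
  ring

theorem Red.sum {ι : Type} (s : Finset ι) {p : ι → AA n} (h : ∀ t ∈ s, Red I S x q (p t)) : Red I S x q (∑ t ∈ s, p t) := by
  classical
  induction s using Finset.induction_on with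
  | empty => simpa using Red.zero
  | insert a s ha ih =>
    rw [Finset.sum_insert ha]
    exact (h a (by simp)).add (ih fun t ht => h t (by simp [ht]))

theorem Red.smul {c p : AA n} (hc : c ∈ S) (h : Red I S x q p) : Red I S x q (c * p) := by
  obtain ⟨w, h1, h2⟩ := h
  refine ⟨fun u => c * w u, fun u => Subalgebra.mul_mem _ hc (h1 u), ?_⟩
  have := I.mul_mem_left c h2
  convert this using 1
  rw [mul_sub, Finset.mul_sum]
  simp only [mul_assoc]

theorem Red.congr {p p' : AA n} (h : Red I S x q p) (h' : p' - p ∈ I) : Red I S x q p' := by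
  obtain ⟨w, h1, h2⟩ := h
  refine ⟨w, h1, ?_⟩
  have := I.add_mem h2 h'
  convert this using 1
  ring

theorem Red.pow_lt {u : ℕ} (hu : u < q) : Red I S x q (x ^ u) := by
  refine ⟨Pi.single ⟨u, hu⟩ 1, fun v => ?_, ?_⟩
  · rw [Pi.single_apply]
    split_ifs
    · exact Subalgebra.one_mem _
    · exact Subalgebra.zero_mem _
  · rw [Finset.sum_eq_single ⟨u, hu⟩]
    · simp
    · intro v _ hv
      rw [Pi.single_eq_of_ne hv, zero_mul]
    · simp

theorem Red.pow {u0 : ℂ} (hu0 : u0 ≠ 0) {α : ℕ → AA n} (hα : ∀ f, α f ∈ S)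
    (ha : C u0 * x ^ q + ∑ f ∈ Finset.range q, α f * x ^ f ∈ I) (u : ℕ) : Red I S x q (x ^ u) := by
  induction u using Nat.strong_induction_on with
  | _ u ih =>
    by_cases hu : u < q
    · exact Red.pow_lt hu
    · obtain ⟨v, rfl⟩ := Nat.exists_eq_add_of_le (not_lt.1 hu)
      have h1 : Red I S x q (∑ f ∈ Finset.range q, (C (- u0⁻¹) * α f) * x ^ (f + v)) := by
        refine Red.sum _ fun f hf => Red.smul ?_ (ih _ ?_)
        · exact Subalgebra.mul_mem _ (Subalgebra.algebraMap_mem S _) (hα f)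
        · have := Finset.mem_range.1 hf
          omega
      refine h1.congr ?_
      have h2 := I.mul_mem_left (C u0⁻¹ * x ^ v) ha
      convert h2 using 1
      have h3 : (C u0⁻¹ * C u0 : AA n) = 1 := by rw [← map_mul, inv_mul_cancel₀ hu0, map_one]
      have h4 : C u0⁻¹ * x ^ v * (C u0 * x ^ q) = x ^ (q + v) := by
        calc C u0⁻¹ * x ^ v * (C u0 * x ^ q) = (C u0⁻¹ * C u0) * (x ^ q * x ^ v) := by ring
          _ = _ := by rw [h3, one_mul, pow_add]
      rw [mul_add, h4, sub_eq_add_neg, Finset.mul_sum, ← Finset.sum_neg_distrib]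
      congr 1
      refine Finset.sum_congr rfl fun f _ => ?_
      rw [pow_add, map_neg]; ring

theorem exists_cj {j last : Fin n} (hj : j ≠ last) {q q' : ℕ} (hq : 0 < q) (hq' : 0 < q') {a b : AA n} (ha : a ∈ supported ℂ ({last}ᶜ : Set (Fin n)))
    (ha1 : a.totalDegree ≤ q) (ha2 : coeff (Finsupp.single j q) a ≠ 0) {T : Set (Fin n)} {αb : ℕ → AA n} (hb : HD last T q' b αb) :
    ∃ c α β : AA n, c = α * a + β * b ∧ c ∈ supported ℂ ({j}ᶜ : Set (Fin n)) ∧ MonicIn last c := by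
  obtain ⟨α, h1, h2, h3, h4⟩ := exists_coeffs j ha ha1
  obtain ⟨I, hI⟩ : ∃ I : Ideal (AA n), I = Ideal.span {a, b} := ⟨_, rfl⟩
  obtain ⟨S, hS⟩ : ∃ S : Subalgebra ℂ (AA n), S = supported ℂ (({last}ᶜ : Set (Fin n)) \ {j}) := ⟨_, rfl⟩
  have haI : a ∈ I := by rw [hI]; exact Ideal.subset_span (by simp)
  have hbI : b ∈ I := by rw [hI]; exact Ideal.subset_span (by simp)
  have hpow : ∀ u, Red I S (X j) q (X j ^ u) := by
    refine Red.pow ha2 (α := α) (fun f => by rw [hS]; exact h2 f) ?_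
    rw [Finset.sum_range_succ, h4] at h1
    rw [add_comm, ← h1]
    exact haI
  have hred : ∀ p ∈ supported ℂ ({last}ᶜ : Set (Fin n)), Red I S (X j) q p := by
    intro p hp
    obtain ⟨β, g1, g2, -, -⟩ := exists_coeffs j hp le_rfl
    rw [g1]
    exact Red.sum _ fun f _ => Red.smul (by rw [hS]; exact g2 f) (hpow f)
  have hrow : ∀ g : Fin q × Fin q', ∃ M : Fin q × Fin q' → AA n, (∀ g', M g' ∈ S) ∧
      X last * (X j ^ g.1.1 * X last ^ g.2.1) - ∑ g', M g' * (X j ^ g'.1.1 * X last ^ g'.2.1) ∈ I := by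
    rintro ⟨u, v⟩
    by_cases hv : v.1 + 1 < q'
    · refine ⟨Pi.single (u, ⟨v.1 + 1, hv⟩) 1, fun g' => ?_, ?_⟩
      · rw [Pi.single_apply]
        split_ifs
        · exact Subalgebra.one_mem _
        · exact Subalgebra.zero_mem _
      · rw [Finset.sum_eq_single (u, ⟨v.1 + 1, hv⟩)]
        · rw [Pi.single_eq_same, one_mul]
          simp only
          convert I.zero_mem using 1
          ring
        · intro v _ hv
          rw [Pi.single_eq_of_ne hv, zero_mul]
        · simp
    · have hv1 : v.1 + 1 = q' := by omega
      have hw : ∀ f : Fin q', Red I S (X j) q (- (αb f.1 * X j ^ u.1)) := by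
        intro f
        refine hred _ (Subalgebra.neg_mem _ (Subalgebra.mul_mem _ (supported_mono (fun t ht => ht.2) (hb.2 f.1 f.2).1)
          (Subalgebra.pow_mem _ (X_mem_supported.2 hj) _)))
      choose w hw1 hw2 using hw
      refine ⟨fun g' => w g'.2 g'.1, fun g' => hw1 _ _, ?_⟩
      have h5 : X last * (X j ^ u.1 * X last ^ v.1) - ∑ g' : Fin q × Fin q', w g'.2 g'.1 * (X j ^ g'.1.1 * X last ^ g'.2.1) =
          X j ^ u.1 * b + ∑ f : Fin q', X last ^ f.1 * (- (αb f.1 * X j ^ u.1) - ∑ u', w f u' * X j ^ u'.1) := by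
        rw [Fintype.sum_prod_type, Finset.sum_comm, hb.1, ← Fin.sum_univ_eq_sum_range (fun f => αb f * X last ^ f) q']
        simp only [mul_sub, Finset.sum_sub_distrib, Finset.mul_sum, mul_add]
        have h6 : ∑ f : Fin q', X last ^ f.1 * (- (αb f.1 * X j ^ u.1)) = - ∑ f : Fin q', X j ^ u.1 * (αb f.1 * X last ^ f.1) := by
          rw [← Finset.sum_neg_distrib]
          exact Finset.sum_congr rfl fun f _ => by ring
        have h7 : ∑ y : Fin q', ∑ x : Fin q, w y x * (X j ^ x.1 * X last ^ y.1) = ∑ x : Fin q', ∑ i : Fin q, X last ^ x.1 * (w x i * X j ^ i.1) :=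
          Finset.sum_congr rfl fun f _ => Finset.sum_congr rfl fun f' _ => by ring
        rw [h6, h7]
        have h8 : (X last : AA n) ^ q' = X last ^ v.1 * X last := by rw [← pow_succ, hv1]
        rw [h8]
        ring
      simp only
      rw [h5]
      exact I.add_mem (I.mul_mem_left _ hbI) (Submodule.sum_mem _ fun f _ => I.mul_mem_left _ (hw2 f))
  choose M hM1 hM2 using hrow
  obtain ⟨N, hN⟩ : ∃ N : Matrix (Fin q × Fin q') (Fin q × Fin q') (AA n),
    N = (X last : AA n) • (1 : Matrix (Fin q × Fin q') (Fin q × Fin q') (AA n)) - Matrix.of M := ⟨_, rfl⟩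
  have hN1 : ∀ g g', N g g' = (if g = g' then X last else 0) - M g g' := by
    intro g g'
    rw [hN, Matrix.sub_apply, Matrix.smul_apply, Matrix.one_apply]
    simp
  have hdet : N.det ∈ I := by
    have h := det_smul_mem I N (fun g => X j ^ g.1.1 * X last ^ g.2.1) (fun g => ?_) (⟨0, hq⟩, ⟨0, hq'⟩)
    · simpa using h
    · convert hM2 g using 1
      simp only [hN1, sub_mul, Finset.sum_sub_distrib, ite_mul, zero_mul, smul_eq_mul]
      simp
  rw [hI, Ideal.mem_span_pair] at hdet
  obtain ⟨A, B, hAB⟩ := hdet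
  refine ⟨N.det, A, B, hAB.symm, ?_, ?_⟩
  · refine det_mem _ _ fun g g' => ?_
    rw [hN1]
    have := hM1 g g'
    rw [hS] at this
    refine Subalgebra.sub_mem _ ?_ (supported_mono (fun x hx => hx.2) this)
    split_ifs
    · exact X_mem_supported.2 hj.symm
    · exact Subalgebra.zero_mem _
  · obtain ⟨γ, g1, g2⟩ := det_expand S (Matrix.of M) hM1 (X last)
    refine ⟨Fintype.card (Fin q × Fin q'), 1, γ, one_ne_zero, fun f => ?_, ?_⟩
    · have := g1 f
      rw [hS] at this
      exact supported_mono (fun x hx => hx.1) this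
    · rw [hN, g2, map_one, one_mul]

end cj

set_option autoImplicit false
open MvPolynomial Filter Topology

section fin
variable {n ℓ k d : ℕ} [Module (AA n) (Cinf n)] [GoodMod n]

theorem exists_t (κ : Fin n → Fin n → ℂ) (s : Finset (Fin n)) (h : ∀ j ∈ s, κ j j ≠ 0) :
    ∃ t : Fin n → ℂ, ∀ j ∈ s, ∑ i ∈ s, t i * κ i j ≠ 0 := by
  have h1 : ∏ j ∈ s, (∑ i ∈ s, X i * C (κ i j) : MvPolynomial (Fin n) ℂ) ≠ 0 := by
    rw [Finset.prod_ne_zero_iff]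
    intro j hj h0
    have h2 := congrArg (eval (Pi.single j 1 : Fin n → ℂ)) h0
    rw [map_sum, map_zero, Finset.sum_eq_single_of_mem j hj] at h2
    · simp at h2
      exact h j hj h2
    · intro i _ hij
      simp [hij]
  have h3 : ∃ t : Fin n → ℂ, eval t (∏ j ∈ s, (∑ i ∈ s, X i * C (κ i j) : MvPolynomial (Fin n) ℂ)) ≠ 0 := by
    by_contra hc
    push Not at hc
    exact h1 (MvPolynomial.funext fun t => by rw [hc t, map_zero])
  obtain ⟨t, ht⟩ := h3
  refine ⟨t, fun j hj h0 => ht ?_⟩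
  rw [map_prod]
  refine Finset.prod_eq_zero hj ?_
  rw [← h0]
  simp

theorem controllable_two (hl : 0 < ℓ) {s last : Fin n} (hsl : s ≠ last) {P : Matrix (Fin ℓ) (Fin k) (AA n)}
    (hP : ∀ r c, (P r c).totalDegree ≤ d) (hg : ∀ i j : Fin n, i ≠ j → Gen d P i j) : IsControllable (system P) := by
  classical
  obtain ⟨q, hq⟩ : ∃ q, q = Fintype.card (Fin ℓ × GS (Edeg ℓ d + d)) := ⟨_, rfl⟩
  have hq0 : 0 < q := by
    rw [hq, Fintype.card_pos_iff]
    have hE : Edeg ℓ d = d * ℓ + 1 := rfl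
    exact ⟨(⟨0, hl⟩, ⟨(0, 0), GS.mk_mem (by omega)⟩)⟩
  have hpd : ∀ i j : Fin n, ∃ (a : AA n) (Q : Matrix (Fin k) (Fin ℓ) (AA n)), i ≠ j → (P * Q = a • (1 : Matrix (Fin ℓ) (Fin ℓ) (AA n)) ∧
      a ∈ supported ℂ ({j}ᶜ : Set (Fin n)) ∧ a.totalDegree ≤ q ∧ coeff (Finsupp.single i q) a = 1) := by
    intro i j
    by_cases hij : i = j
    · exact ⟨0, 0, fun h => absurd hij h⟩
    · obtain ⟨a, Q, h⟩ := pair_det hij hP (hg i j hij)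
      rw [← hq] at h
      exact ⟨a, Q, fun _ => h⟩
  choose a Q haQ using hpd
  obtain ⟨t, ht⟩ := exists_t (fun i j => coeff (Finsupp.single j q) (a i last)) (Finset.univ.erase last) (fun j hj => by
    rw [(haQ j last (Finset.ne_of_mem_erase hj)).2.2.2]; exact one_ne_zero)
  obtain ⟨v, hv⟩ : ∃ v : ℂ, v = (∑ i ∈ Finset.univ.erase last, t i * coeff (Finsupp.single s q) (a i last))⁻¹ := ⟨_, rfl⟩
  have hv0 : v ≠ 0 := by
    rw [hv]; exact inv_ne_zero (ht s (Finset.mem_erase.2 ⟨hsl, Finset.mem_univ _⟩))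
  obtain ⟨A, hA⟩ : ∃ A : AA n, A = C v * ∑ i ∈ Finset.univ.erase last, C (t i) * a i last := ⟨_, rfl⟩
  have hAc : ∀ j, coeff (Finsupp.single j q) A = v * ∑ i ∈ Finset.univ.erase last, t i * coeff (Finsupp.single j q) (a i last) := by
    intro j
    rw [hA, coeff_C_mul, coeff_sum]
    simp only [coeff_C_mul]
  have hA1 : A ∈ supported ℂ ({last}ᶜ : Set (Fin n)) := by
    rw [hA]
    refine Subalgebra.mul_mem _ (Subalgebra.algebraMap_mem _ v) (Subalgebra.sum_mem _ fun i hi => ?_)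
    exact Subalgebra.mul_mem _ (Subalgebra.algebraMap_mem _ (t i)) (haQ i last (Finset.ne_of_mem_erase hi)).2.1
  have hA2 : A.totalDegree ≤ q := by
    rw [hA]
    refine (totalDegree_mul _ _).trans ?_
    rw [totalDegree_C, zero_add]
    refine totalDegree_finsetSum_le fun i hi => (totalDegree_mul _ _).trans ?_
    rw [totalDegree_C, zero_add]
    exact (haQ i last (Finset.ne_of_mem_erase hi)).2.2.1
  have hA3 : coeff (Finsupp.single s q) A = 1 := by
    rw [hAc, hv, inv_mul_cancel₀]
    exact ht s (Finset.mem_erase.2 ⟨hsl, Finset.mem_univ _⟩)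
  have hA4 : P * ((C v : AA n) • ∑ i ∈ Finset.univ.erase last, (C (t i) : AA n) • Q i last) = A • (1 : Matrix (Fin ℓ) (Fin ℓ) (AA n)) := by
    rw [Matrix.mul_smul, Matrix.mul_sum, hA, mul_smul, Finset.sum_smul]
    congr 1
    refine Finset.sum_congr rfl fun i hi => ?_
    rw [Matrix.mul_smul, (haQ i last (Finset.ne_of_mem_erase hi)).1, smul_smul]
  obtain ⟨αa, hαa⟩ := exists_HD hA1 hA2 hA3
  obtain ⟨hb1, hb2, hb3, hb4⟩ := haQ last s hsl.symm
  obtain ⟨αb, hαb⟩ := exists_HD hb2 hb3 hb4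
  have hc : ∀ j : Fin n, ∃ c α β : AA n, j ≠ last → (c = α * A + β * a last s ∧ c ∈ supported ℂ ({j}ᶜ : Set (Fin n)) ∧ MonicIn last c) := by
    intro j
    by_cases hj : j = last
    · exact ⟨0, 0, 0, fun h => absurd hj h⟩
    by_cases hjs : j = s
    · exact ⟨a last s, 0, 1, fun _ => ⟨by ring, by rw [hjs]; exact hb2, hαb.monicIn⟩⟩
    · obtain ⟨c, α, β, h⟩ := exists_cj hj hq0 hq0 hA1 hA2 (by
        rw [hAc]
        exact mul_ne_zero hv0 (ht j (Finset.mem_erase.2 ⟨hj, Finset.mem_univ _⟩))) hαb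
      exact ⟨c, α, β, fun _ => h⟩
  choose c α β hcab using hc
  exact controllable_main P hsl hq0 hq0 _ _ hA4 hb1 hαa hA1 hαb (fun j hj => (hcab j hj).1) (fun j hj => (hcab j hj).2.1)
    (fun j hj => (hcab j hj).2.2)

theorem sum_coeff_one (p : AA 1) (hp : p.totalDegree ≤ d) :
    p = ∑ q ∈ Finset.range (d+1), C (coeff (Finsupp.single 0 q) p) * (X 0 ^ q * 1 ^ (d - q)) := by
  ext m
  have hm : m = Finsupp.single 0 (m 0) := by
    refine Finsupp.ext fun i => ?_
    rw [Subsingleton.elim i 0]; simp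
  have h1 : ∀ q, coeff m (C (coeff (Finsupp.single 0 q) p) * (X 0 ^ q * 1 ^ (d - q)) : AA 1) = if q = m 0 then coeff m p else 0 := by
    intro q
    rw [one_pow, mul_one, coeff_C_mul, X_pow_eq_monomial, coeff_monomial]
    by_cases h : q = m 0
    · rw [if_pos h, h, ← hm, if_pos rfl, mul_one]
    · rw [if_neg h, if_neg, mul_zero]
      intro h'
      apply h
      rw [← h']; simp
  rw [coeff_sum, Finset.sum_congr rfl fun q _ => h1 q, Finset.sum_ite_eq']
  split_ifs with h
  · rfl
  · by_contra h0
    have := deg_le_of_coeff hp h0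
    rw [hm, Finsupp.degree_single] at this
    rw [Finset.mem_range] at h
    omega

theorem controllable_uni [Module (AA 1) (Cinf 1)] [GoodMod 1] {P : Matrix (Fin ℓ) (Fin k) (AA 1)}
    (hP : ∀ r c, (P r c).totalDegree ≤ d)
    (hg : ∀ a, ∃ h, (LM (d := d) (fun r c q => if q < d + 1 then coeff (Finsupp.single 0 q) (P r c) else 0)).mulVec h = Pi.single a 1) :
    IsControllable (system P) := by
  choose h hh using fun r => hg (r, ⟨0, by omega⟩)
  refine controllable_one P (Matrix.of fun c r => ∑ t : Fin (Edeg ℓ d + 1), C (h r (c, t)) * ((X 0)^t.1 * 1^(Edeg ℓ d - t.1))) ?_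
  ext1 r r'
  have h1 := head_mul (X 0 : AA 1) 1 _ (fun r c q hq => if_neg (by omega)) (hh r') r
  rw [Matrix.mul_apply, Matrix.one_apply]
  simp only [pow_zero, one_pow, mul_one] at h1
  rw [← h1]
  refine Finset.sum_congr rfl fun c _ => ?_
  rw [Matrix.of_apply]
  congr 1
  · conv_lhs => rw [sum_coeff_one (P r c) (hP r c)]
    refine Finset.sum_congr rfl fun q hq => ?_
    rw [if_pos (Finset.mem_range.1 hq), one_pow, mul_one]
  · simp

end fin

set_option autoImplicit false
open MvPolynomial Filter Topology

/-- **Theorem 1.2**, first half (Shankar). In the strictly underdetermined case `ℓ < k`, a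
generic system is controllable: the set of matrices in `M_{ℓ,k}(d)` defining a controllable
distributed system contains a nonempty Zariski-open subset; i.e. there is a nonzero polynomial
`F` in the `N = ℓ·k·(n+d choose n)` coefficient variables such that every `ℓ × k` matrix of
degree at most `d` whose coefficient vector does not annihilate `F` defines a controllable
system. -/
theorem generic_controllable (n k ℓ d : ℕ) (hn : 0 < n) (hl : 0 < ℓ) (hlk : ℓ < k)
    [Module (MvPolynomial (Fin n) ℂ) (Cinf n)]
    (hX : ∀ (i : Fin n) (f : Cinf n),
      (((MvPolynomial.X i : MvPolynomial (Fin n) ℂ) • f : Cinf n) : (Fin n → ℝ) → ℂ) =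
        fun x => fderiv ℝ (f : (Fin n → ℝ) → ℂ) x (Pi.single i 1))
    (hC : ∀ (c : ℂ) (f : Cinf n),
      ((MvPolynomial.C c : MvPolynomial (Fin n) ℂ) • f : Cinf n) = c • f) :
    ∃ F : MvPolynomial (Fin ℓ × Fin k × {m : Fin n →₀ ℕ // m.degree ≤ d}) ℂ,
      F ≠ 0 ∧
      ∀ M : Matrix (Fin ℓ) (Fin k) (MvPolynomial (Fin n) ℂ),
        (∀ i j, (M i j).totalDegree ≤ d) →
        MvPolynomial.eval (matrixCoeffs (d := d) M) F ≠ 0 →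
        IsControllable (system M) := by
  haveI : GoodMod n := ⟨hX, hC⟩
  obtain ⟨F0, hF0, hF1⟩ := univ_generic (ℓ := ℓ) (k := k) d hlk
  have hn1 : n = 1 ∨ 1 < n := by omega
  rcases hn1 with rfl | hn2
  · obtain ⟨e, he⟩ : ∃ e : Fin ℓ × Fin k × Fin (d+1) → Fin ℓ × Fin k × {m : Fin 1 →₀ ℕ // m.degree ≤ d},
        ∀ v, e v = (v.1, v.2.1, ⟨Finsupp.single 0 v.2.2.1, by rw [Finsupp.degree_single]; omega⟩) := ⟨_, fun _ => rfl⟩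
    have hinj : Function.Injective e := by
      rintro ⟨r, c, q⟩ ⟨r', c', q'⟩ h
      rw [he, he] at h
      simp only [Prod.mk.injEq, Subtype.mk.injEq] at h
      obtain ⟨h1, h2, h3⟩ := h
      have h4 := DFunLike.congr_fun h3 0
      simp only [Finsupp.single_eq_same] at h4
      rw [h1, h2, Fin.ext h4]
    refine ⟨rename e F0, fun h => hF0 (rename_injective e hinj (by rw [h, map_zero])), fun M hM hev => ?_⟩
    rw [eval_rename] at hev
    refine controllable_uni hM fun a => ?_
    obtain ⟨h, hh⟩ := hF1 _ hev a
    refine ⟨h, ?_⟩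
    rw [← hh]
    congr 2
    refine _root_.funext fun r => _root_.funext fun c => _root_.funext fun q => ?_
    by_cases hq : q < d + 1
    · rw [if_pos hq, dif_pos hq, Function.comp_apply, he]
      rfl
    · rw [if_neg hq, dif_neg hq]
  · have hE : ∀ i j : Fin n, ∃ e : Fin ℓ × Fin k × Fin (d+1) → Fin ℓ × Fin k × {m : Fin n →₀ ℕ // m.degree ≤ d},
        ∀ v, e v = (v.1, v.2.1, ⟨Finsupp.single i v.2.2.1 + Finsupp.single j (d - v.2.2.1), by
          rw [map_add, Finsupp.degree_single, Finsupp.degree_single]; omega⟩) := fun i j => ⟨_, fun _ => rfl⟩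
    choose e he using hE
    have hinj : ∀ i j, i ≠ j → Function.Injective (e i j) := by
      rintro i j hij ⟨r, c, q⟩ ⟨r', c', q'⟩ h
      rw [he, he] at h
      simp only [Prod.mk.injEq, Subtype.mk.injEq] at h
      obtain ⟨h1, h2, h3⟩ := h
      have h4 := DFunLike.congr_fun h3 i
      rw [Finsupp.add_apply, Finsupp.add_apply, Finsupp.single_eq_same, Finsupp.single_eq_same,
        Finsupp.single_eq_of_ne hij, Finsupp.single_eq_of_ne hij, add_zero, add_zero] at h4
      rw [h1, h2, Fin.ext h4]
    refine ⟨∏ v ∈ (Finset.univ : Finset (Fin n × Fin n)).filter (fun v => v.1 ≠ v.2), rename (e v.1 v.2) F0, ?_, fun M hM hev => ?_⟩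
    · rw [Finset.prod_ne_zero_iff]
      intro v hv h
      exact hF0 (rename_injective _ (hinj _ _ (Finset.mem_filter.1 hv).2) (by rw [h, map_zero]))
    · rw [map_prod, Finset.prod_ne_zero_iff] at hev
      refine controllable_two (s := ⟨n - 2, by omega⟩) (last := ⟨n - 1, by omega⟩) hl (by
        rw [Ne, Fin.mk.injEq]; omega) hM fun i j hij a => ?_
      have h1 := hev (i, j) (Finset.mem_filter.2 ⟨Finset.mem_univ _, hij⟩)
      rw [eval_rename] at h1
      obtain ⟨h, hh⟩ := hF1 _ h1 a
      refine ⟨h, ?_⟩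
      rw [← hh]
      congr 2
      refine _root_.funext fun r => _root_.funext fun c => _root_.funext fun q => ?_
      by_cases hq : q < d + 1
      · rw [if_pos hq, dif_pos hq, Function.comp_apply, he]
        rfl
      · rw [if_neg hq, dif_neg hq]
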